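/- arXiv:2103.14309 — 2 statements merged into one kernel-verified Lean document; each statement's English description precedes it below -/
import Mathlib

section
/- For every ε > 0 and every map f ∈ C_λ(I) there exist δ with 0 < δ < ε/2 and a map F ∈ C_λ(I) such that: (1) F is piecewise affine and ρ(f,F) < ε/2; (2) for every g ∈ C_λ(I) with ρ(F,g) < δ, every δ-pseudo orbit (x_i)_{i≥0} of g is ε-traced by some point z ∈ [0,1], and moreover if the δ-pseudo orbit is periodic then z can be chosen to be a periodic point of g. -/
open MeasureTheory Set Metric Filter Topology

noncomputable section

/-- Lebesgue measure on the unit interval `[0,1]`, viewed as a measure on the subtype. -/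
def lebI : Measure unitInterval := (volume : Measure ℝ).comap Subtype.val

/-- A continuous self-map of `[0,1]` preserves Lebesgue measure. -/
def MeasPres (f : C(unitInterval, unitInterval)) : Prop :=
  ∀ A : Set unitInterval, MeasurableSet A → lebI (f ⁻¹' A) = lebI A

/-- The space `C_λ(I)` of continuous Lebesgue-measure-preserving maps of `[0,1]`. -/
def CLam : Set C(unitInterval, unitInterval) := {f | MeasPres f}

/-- `Fix(f,k) = {x : f^k x = x}`. -/
def FixSet {X : Type*} (f : X → X) (k : ℕ) : Set X := {x | f^[k] x = x}

/-- `Per(f,k) = {x : f^k x = x and f^i x ≠ x for 1 ≤ i < k}`. -/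
def PerSet {X : Type*} (f : X → X) (k : ℕ) : Set X :=
  {x | f^[k] x = x ∧ ∀ i : ℕ, 1 ≤ i → i < k → f^[i] x ≠ x}

/-- `Per(f) = ⋃_{k ≥ 1} Fix(f,k)`, the set of all periodic points. -/
def PerAll {X : Type*} (f : X → X) : Set X := ⋃ k ∈ {k : ℕ | 1 ≤ k}, FixSet f k

/-- A Cantor set: nonempty, compact, perfect and totally disconnected. -/
def IsCantorSet {X : Type*} [TopologicalSpace X] (C : Set X) : Prop :=
  C.Nonempty ∧ IsCompact C ∧ Perfect C ∧ IsTotallyDisconnected C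

/-- `y` is a `δ`-pseudo orbit of `f`. -/
def IsPseudoOrbit (f : unitInterval → unitInterval) (δ : ℝ) (y : ℕ → unitInterval) : Prop :=
  ∀ n : ℕ, dist (f (y n)) (y (n + 1)) < δ

/-- The point `x` `ε`-traces the sequence `y`. -/
def Traces (f : unitInterval → unitInterval) (ε : ℝ) (x : unitInterval) (y : ℕ → unitInterval) :
    Prop :=
  ∀ n : ℕ, dist (f^[n] x) (y n) < ε

/-- The shadowing property. -/
def Shadowing (f : unitInterval → unitInterval) : Prop :=
  ∀ ε > (0 : ℝ), ∃ δ > (0 : ℝ), ∀ y : ℕ → unitInterval,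
    IsPseudoOrbit f δ y → ∃ x : unitInterval, Traces f ε x y

/-- A sequence is periodic (with some period `N ≥ 1`). -/
def PeriodicSeq (y : ℕ → unitInterval) : Prop :=
  ∃ N : ℕ, 1 ≤ N ∧ ∀ n : ℕ, y (n + N) = y n

/-- `x` is a periodic point of `f`. -/
def IsPeriodicPt' (f : unitInterval → unitInterval) (x : unitInterval) : Prop :=
  ∃ N : ℕ, 1 ≤ N ∧ f^[N] x = x

/-- The periodic shadowing property. -/
def PeriodicShadowing (f : unitInterval → unitInterval) : Prop :=
  ∀ ε > (0 : ℝ), ∃ δ > (0 : ℝ), ∀ y : ℕ → unitInterval,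
    IsPseudoOrbit f δ y → PeriodicSeq y →
      ∃ x : unitInterval, IsPeriodicPt' f x ∧ Traces f ε x y

/-- `g` is piecewise affine: there is a finite partition `0 = t 0 < t 1 < … < t m = 1`
of `[0,1]` such that `g` is affine on each piece. -/
def PiecewiseAffine (g : C(unitInterval, unitInterval)) : Prop :=
  ∃ (m : ℕ) (t : ℕ → ℝ), t 0 = 0 ∧ t m = 1 ∧ (∀ j < m, t j < t (j + 1)) ∧
    ∀ j < m, ∃ a b : ℝ, ∀ x : unitInterval,
      t j ≤ (x : ℝ) → (x : ℝ) ≤ t (j + 1) → (g x : ℝ) = a * (x : ℝ) + b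

/-- `p` is a transverse periodic point of `g` for the power `k`. -/
def TransversePt (g : unitInterval → unitInterval) (k : ℕ) (p : unitInterval) : Prop :=
  ∃ a₁ a₂ c₁ c₂ : ℝ, 0 ≤ a₁ ∧ a₁ < a₂ ∧ a₂ ≤ c₁ ∧ c₁ < c₂ ∧ c₂ ≤ 1 ∧
    a₂ ≤ (p : ℝ) ∧ (p : ℝ) ≤ c₁ ∧
    (∀ x : unitInterval, a₂ ≤ (x : ℝ) → (x : ℝ) ≤ c₁ → g^[k] x = x) ∧
    ((∀ x : unitInterval, a₁ < (x : ℝ) → (x : ℝ) < a₂ → (x : ℝ) < (g^[k] x : ℝ)) ∧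
       (∀ x : unitInterval, c₁ < (x : ℝ) → (x : ℝ) < c₂ → ((g^[k] x : ℝ) < (x : ℝ))) ∨
     (∀ x : unitInterval, a₁ < (x : ℝ) → (x : ℝ) < a₂ → ((g^[k] x : ℝ) < (x : ℝ))) ∧
       (∀ x : unitInterval, c₁ < (x : ℝ) → (x : ℝ) < c₂ → (x : ℝ) < (g^[k] x : ℝ)))

/-- Real functions generated from the identity and the constants by sums, scalar multiples and
absolute values: continuous piecewise affine functions of one variable. -/
inductive PLin : (ℝ → ℝ) → Prop
  | id : PLin fun x => x
  | const (c : ℝ) : PLin fun _ => c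
  | add {f g : ℝ → ℝ} : PLin f → PLin g → PLin fun x => f x + g x
  | const_mul (c : ℝ) {f : ℝ → ℝ} : PLin f → PLin fun x => c * f x
  | abs {f : ℝ → ℝ} : PLin f → PLin fun x => |f x|

namespace PLin

theorem comp {f g : ℝ → ℝ} (hf : PLin f) (hg : PLin g) : PLin fun x => f (g x) := by
  induction hf with
  | id => exact hg
  | const c => exact .const c
  | add _ _ h₁ h₂ => exact .add h₁ h₂
  | const_mul c _ h => exact .const_mul c h
  | abs _ h => exact .abs h

theorem continuous {f : ℝ → ℝ} (hf : PLin f) : Continuous f := by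
  induction hf with
  | id => exact continuous_id
  | const c => exact continuous_const
  | add _ _ h₁ h₂ => exact h₁.add h₂
  | const_mul c _ h => exact continuous_const.mul h
  | abs _ h => exact h.abs

theorem sub {f g : ℝ → ℝ} (hf : PLin f) (hg : PLin g) : PLin fun x => f x - g x := by
  have := hf.add (hg.const_mul (-1))
  convert this using 2
  ring

theorem max {f g : ℝ → ℝ} (hf : PLin f) (hg : PLin g) : PLin fun x => f x ⊔ g x := by
  have := ((hf.add hg).add (hf.sub hg).abs).const_mul (1 / 2)
  convert this using 2 with x
  rcases le_total (f x) (g x) with h | h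
  · rw [max_eq_right h, abs_of_nonpos (by linarith)]; ring
  · rw [max_eq_left h, abs_of_nonneg (by linarith)]; ring

theorem min {f g : ℝ → ℝ} (hf : PLin f) (hg : PLin g) : PLin fun x => f x ⊓ g x := by
  have := (hf.add hg).sub (hf.max hg)
  convert this using 2 with x
  linarith [min_add_max (f x) (g x)]

theorem sum {ι : Type*} (s : Finset ι) {f : ι → ℝ → ℝ} (hf : ∀ i ∈ s, PLin (f i)) :
    PLin fun x => ∑ i ∈ s, f i x := by
  classical
  induction s using Finset.induction_on with
  | empty => simpa using PLin.const 0
  | insert a s ha ih =>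
    simp only [Finset.sum_insert ha]
    exact (hf a (by simp)).add (ih fun i hi => hf i (by simp [hi]))

/-- Along a one-sided neighbourhood filter of `x` on which `y - x` has constant sign, the
absolute value of an affine function is eventually affine. -/
theorem eventually_abs_affine {l : Filter ℝ} {x σ : ℝ} (hl : l ≤ 𝓝 x)
    (hσ : ∀ᶠ y in l, |y - x| = σ * (y - x)) (a b : ℝ) :
    ∃ a' b' : ℝ, ∀ᶠ y in l, |a * y + b| = a' * y + b' := by
  have hc : Tendsto (fun y => a * y + b) l (𝓝 (a * x + b)) :=
    ((continuous_const.mul continuous_id).add continuous_const).continuousAt.mono_left hl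
  rcases lt_trichotomy (a * x + b) 0 with h | h | h
  · refine ⟨-a, -b, ?_⟩
    filter_upwards [hc.eventually (gt_mem_nhds h)] with y hy
    rw [abs_of_neg hy]; ring
  · refine ⟨|a| * σ, -(|a| * σ * x), ?_⟩
    filter_upwards [hσ] with y hy
    have : a * y + b = a * (y - x) := by linarith
    rw [this, abs_mul, hy]; ring
  · refine ⟨a, b, ?_⟩
    filter_upwards [hc.eventually (lt_mem_nhds h)] with y hy
    rw [abs_of_pos hy]

theorem eventually_affine {f : ℝ → ℝ} (hf : PLin f) {l : Filter ℝ} {x σ : ℝ} (hl : l ≤ 𝓝 x)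
    (hσ : ∀ᶠ y in l, |y - x| = σ * (y - x)) :
    ∃ a b : ℝ, ∀ᶠ y in l, f y = a * y + b := by
  induction hf with
  | id => exact ⟨1, 0, by simp⟩
  | const c => exact ⟨0, c, by simp⟩
  | add _ _ h₁ h₂ =>
    obtain ⟨a, b, h₁⟩ := h₁
    obtain ⟨a', b', h₂⟩ := h₂
    refine ⟨a + a', b + b', ?_⟩
    filter_upwards [h₁, h₂] with y h₁ h₂
    rw [h₁, h₂]; ring
  | const_mul c _ h =>
    obtain ⟨a, b, h⟩ := h
    refine ⟨c * a, c * b, ?_⟩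
    filter_upwards [h] with y h
    rw [h]; ring
  | abs _ h =>
    obtain ⟨a, b, h⟩ := h
    obtain ⟨a', b', h'⟩ := eventually_abs_affine hl hσ a b
    refine ⟨a', b', ?_⟩
    filter_upwards [h, h'] with y h h'
    rw [h, h']

theorem eventually_right {f : ℝ → ℝ} (hf : PLin f) (x : ℝ) :
    ∃ u > x, ∃ a b : ℝ, ∀ y ∈ Icc x u, f y = a * y + b := by
  obtain ⟨a, b, h⟩ := hf.eventually_affine (l := 𝓝[≥] x) (x := x) (σ := 1) nhdsWithin_le_nhds (by
    filter_upwards [self_mem_nhdsWithin] with y hy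
    rw [abs_of_nonneg (sub_nonneg.2 hy), one_mul])
  obtain ⟨u, hu, h⟩ := mem_nhdsGE_iff_exists_Icc_subset.1 h
  exact ⟨u, hu, a, b, fun y hy => h hy⟩

theorem eventually_left {f : ℝ → ℝ} (hf : PLin f) (x : ℝ) :
    ∃ u < x, ∃ a b : ℝ, ∀ y ∈ Icc u x, f y = a * y + b := by
  obtain ⟨a, b, h⟩ := hf.eventually_affine (l := 𝓝[≤] x) (x := x) (σ := -1) nhdsWithin_le_nhds (by
    filter_upwards [self_mem_nhdsWithin] with y hy
    rw [abs_of_nonpos (sub_nonpos.2 hy), neg_one_mul])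
  obtain ⟨u, hu, h⟩ := mem_nhdsLE_iff_exists_Icc_subset.1 h
  exact ⟨u, hu, a, b, fun y hy => h hy⟩

end PLin

/-- `f` has a finite partition of `[a, b]` into intervals on which it is affine. -/
def HasAffinePartition (f : ℝ → ℝ) (a b : ℝ) : Prop :=
  ∃ (m : ℕ) (t : ℕ → ℝ), t 0 = a ∧ t m = b ∧ (∀ j < m, t j < t (j + 1)) ∧
    ∀ j < m, ∃ α β : ℝ, ∀ x ∈ Icc (t j) (t (j + 1)), f x = α * x + β

theorem HasAffinePartition.extend {f : ℝ → ℝ} {a b c : ℝ} (h : HasAffinePartition f a b)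
    (hbc : b < c) (hf : ∃ α β : ℝ, ∀ x ∈ Icc b c, f x = α * x + β) :
    HasAffinePartition f a c := by
  obtain ⟨m, t, h0, hm, hlt, haff⟩ := h
  refine ⟨m + 1, fun j => if j ≤ m then t j else c, by simp [h0], by simp, ?_, ?_⟩
  · intro j hj
    rcases Nat.lt_succ_iff_lt_or_eq.1 hj with hj | rfl
    · have : j + 1 ≤ m := hj
      simp only [hj.le, this, if_true]
      exact hlt j hj
    · simp [hm, hbc]
  · intro j hj
    rcases Nat.lt_succ_iff_lt_or_eq.1 hj with hj | rfl
    · have : j + 1 ≤ m := hj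
      simp only [hj.le, this, if_true]
      exact haff j hj
    · simpa [hm] using hf

theorem PLin.hasAffinePartition {f : ℝ → ℝ} (hf : PLin f) {a b : ℝ} (hab : a ≤ b) :
    HasAffinePartition f a b := by
  have haa : HasAffinePartition f a a := ⟨0, fun _ => a, rfl, rfl, by simp, by simp⟩
  set S : Set ℝ := {t | t ∈ Icc a b ∧ HasAffinePartition f a t} with hS
  have hne : S.Nonempty := ⟨a, ⟨le_rfl, hab⟩, haa⟩
  have hbdd : BddAbove S := ⟨b, fun t ht => ht.1.2⟩
  have hle : sSup S ≤ b := csSup_le hne fun t ht => ht.1.2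
  have hge : a ≤ sSup S := le_csSup hbdd ⟨⟨le_rfl, hab⟩, haa⟩
  have hmem : HasAffinePartition f a (sSup S) := by
    obtain ⟨u, hu, α, β, haff⟩ := hf.eventually_left (sSup S)
    obtain ⟨t, ht, hut⟩ := exists_lt_of_lt_csSup hne hu
    rcases (le_csSup hbdd ht).eq_or_lt with h | h
    · exact h ▸ ht.2
    · exact ht.2.extend h ⟨α, β, fun x hx => haff x ⟨hut.le.trans hx.1, hx.2⟩⟩
  rcases hle.eq_or_lt with h | h
  · exact h ▸ hmem
  · obtain ⟨u, hu, α, β, haff⟩ := hf.eventually_right (sSup S)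
    have hlt : sSup S < Min.min u b := lt_min hu h
    have : Min.min u b ∈ S := ⟨⟨hge.trans hlt.le, min_le_right _ _⟩,
      hmem.extend hlt ⟨α, β, fun x hx => haff x ⟨hx.1, hx.2.trans (min_le_left _ _)⟩⟩⟩
    exact absurd (le_csSup hbdd this) (not_le.2 hlt)

theorem exists_iterate_mem_of_covers {X : Type*} {g : X → X} {W : ℕ → Set X}
    (hcov : ∀ k, W (k + 1) ⊆ g '' W k) (n : ℕ) :
    ∀ k, (W (k + n)).Nonempty → ∃ z, ∀ i ≤ n, g^[i] z ∈ W (k + i) := by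
  induction n with
  | zero =>
    rintro k ⟨x, hx⟩
    exact ⟨x, fun i hi => by obtain rfl : i = 0 := by omega
                             exact hx⟩
  | succ n ih =>
    intro k hk
    obtain ⟨x, hx⟩ := ih (k + 1) (by convert hk using 2; omega)
    obtain ⟨z, hz, hzx⟩ := hcov k (hx 0 (Nat.zero_le _))
    refine ⟨z, fun i hi => ?_⟩
    change g z = x at hzx
    rcases i with _ | i
    · exact hz
    · rw [Function.iterate_succ_apply, hzx]
      convert hx i (by omega) using 2
      omega

/-- A sequence of nonempty closed sets each of which covers the next one is realized by an orbit. -/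
theorem exists_orbit_of_covers {X : Type*} [TopologicalSpace X] [CompactSpace X] {g : X → X}
    (hg : Continuous g) {W : ℕ → Set X} (hW : ∀ k, IsClosed (W k)) (hne : ∀ k, (W k).Nonempty)
    (hcov : ∀ k, W (k + 1) ⊆ g '' W k) : ∃ z, ∀ k, g^[k] z ∈ W k := by
  let K : ℕ → Set X := fun n => ⋂ i ∈ Iic n, g^[i] ⁻¹' W i
  have hK : ∀ n, IsClosed (K n) := fun n =>
    isClosed_biInter fun i _ => (hW i).preimage (hg.iterate i)
  obtain ⟨z, hz⟩ := IsCompact.nonempty_iInter_of_sequence_nonempty_isCompact_isClosed K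
    (fun n => biInter_subset_biInter_left (Iic_subset_Iic.2 n.le_succ))
    (fun n => by
      obtain ⟨z, hz⟩ := exists_iterate_mem_of_covers hcov n 0 (hne _)
      exact ⟨z, mem_iInter₂.2 fun i hi => by simpa using hz i hi⟩)
    (hK 0).isCompact hK
  refine ⟨z, fun k => ?_⟩
  exact mem_iInter₂.1 (mem_iInter.1 hz k) k (mem_Iic.2 le_rfl)

theorem unitInterval.uIcc_subset_of_mem {p q a b : unitInterval} (ha : a ∈ Icc p q)
    (hb : b ∈ Icc p q) : uIcc a b ⊆ Icc p q :=
  fun _ hx => ⟨(le_inf ha.1 hb.1).trans hx.1, hx.2.trans (sup_le ha.2 hb.2)⟩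

/-- If two values are attained on an interval, there is a subinterval whose end points attain these
values and which is mapped between them. -/
theorem exists_uIcc_mapsTo {g : unitInterval → unitInterval} (hg : Continuous g)
    {p q s t : unitInterval} (hs : s ∈ g '' Icc p q) (ht : t ∈ g '' Icc p q) :
    ∃ a ∈ Icc p q, ∃ b ∈ Icc p q, g a = s ∧ g b = t ∧ ∀ x ∈ uIcc a b, g x ∈ uIcc s t := by
  obtain ⟨a₀, ha₀, hs⟩ := hs
  obtain ⟨b₀, hb₀, ht⟩ := ht
  let K : Set (unitInterval × unitInterval) :=
    {z | z.1 ∈ Icc p q ∧ z.2 ∈ Icc p q ∧ g z.1 = s ∧ g z.2 = t}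
  have hK : IsCompact K := by
    refine IsClosed.isCompact ?_
    exact (isClosed_Icc.preimage continuous_fst).inter <|
      (isClosed_Icc.preimage continuous_snd).inter <|
      (isClosed_eq (hg.comp continuous_fst) continuous_const).inter
      (isClosed_eq (hg.comp continuous_snd) continuous_const)
  obtain ⟨⟨a, b⟩, ⟨ha, hb, hga, hgb⟩, hmin⟩ :=
    hK.exists_isMinOn ⟨(a₀, b₀), ha₀, hb₀, hs, ht⟩
      (f := fun z : unitInterval × unitInterval => dist z.1 z.2) (by fun_prop)
  simp only at ha hb hga hgb
  refine ⟨a, ha, b, hb, hga, hgb, fun x hx => ?_⟩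
  have hxpq := unitInterval.uIcc_subset_of_mem ha hb hx
  have key : ∀ a' ∈ uIcc a b, ∀ b' ∈ uIcc a b, g a' = s → g b' = t → dist a b ≤ dist a' b' :=
    fun a' ha' b' hb' h₁ h₂ => hmin (a := (a', b'))
      ⟨unitInterval.uIcc_subset_of_mem ha hb ha', unitInterval.uIcc_subset_of_mem ha hb hb', h₁, h₂⟩
  by_contra hgx
  have hcase : t ∈ uIcc (g a) (g x) ∨ s ∈ uIcc (g b) (g x) := by
    rw [hga, hgb]
    simp only [mem_uIcc] at hgx ⊢
    rcases le_total s t with h | h <;> rcases le_total (g x) s with h₁ | h₁ <;>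
      rcases le_total (g x) t with h₂ | h₂ <;> tauto
  have hdist : ∀ u v w : unitInterval, w ∈ uIcc u v → w ≠ v → dist u w < dist u v := by
    intro u v w hw hne
    have hne' : (w : ℝ) ≠ v := fun h => hne (Subtype.ext h)
    rw [Subtype.dist_eq, Subtype.dist_eq, Real.dist_eq, Real.dist_eq]
    rcases mem_uIcc.1 hw with ⟨h₁, h₂⟩ | ⟨h₁, h₂⟩
    · have h₁ : (u : ℝ) ≤ w := h₁
      have h₂ : (w : ℝ) < v := lt_of_le_of_ne h₂ hne'
      rw [abs_of_nonpos (by linarith), abs_of_nonpos (by linarith)]; linarith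
    · have h₁ : (v : ℝ) < w := lt_of_le_of_ne h₁ hne'.symm
      have h₂ : (w : ℝ) ≤ u := h₂
      rw [abs_of_nonneg (by linarith), abs_of_nonneg (by linarith)]; linarith
  have hle : ∀ u v w : unitInterval, w ∈ uIcc u v → dist u w ≤ dist u v := by
    intro u v w hw
    by_cases h : w = v
    · rw [h]
    · exact (hdist u v w hw h).le
  rcases hcase with h | h
  · obtain ⟨b', hb', hgb'⟩ := intermediate_value_uIcc hg.continuousOn h
    have h₁ := key a left_mem_uIcc b' (uIcc_subset_uIcc left_mem_uIcc hx hb') hga hgb'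
    have h₂ := hdist a b x hx (by rintro rfl; exact hgx (hgb ▸ right_mem_uIcc))
    linarith [hle a x b' hb']
  · obtain ⟨a', ha', hga'⟩ := intermediate_value_uIcc hg.continuousOn h
    have h₁ := key a' (uIcc_subset_uIcc right_mem_uIcc hx ha') b right_mem_uIcc hga' hgb
    have h₂ := hdist b a x (uIcc_comm a b ▸ hx) (by rintro rfl; exact hgx (hga ▸ left_mem_uIcc))
    rw [dist_comm a b, dist_comm a' b] at h₁
    have := hle b x a' ha'
    linarith

/-- A chain of intervals each covering the next one contains a subinterval following the chain whose
end points are mapped to those of the last interval. -/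
theorem exists_uIcc_iterate_of_covers {g : unitInterval → unitInterval} (hg : Continuous g)
    (n : ℕ) : ∀ lo hi : ℕ → unitInterval, (∀ k, lo k ≤ hi k) →
      (∀ k, Icc (lo (k + 1)) (hi (k + 1)) ⊆ g '' Icc (lo k) (hi k)) →
      ∃ a ∈ Icc (lo 0) (hi 0), ∃ b ∈ Icc (lo 0) (hi 0), g^[n] a = lo n ∧ g^[n] b = hi n ∧
        ∀ x ∈ uIcc a b, ∀ i ≤ n, g^[i] x ∈ Icc (lo i) (hi i) := by
  induction n with
  | zero =>
    intro lo hi hle _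
    refine ⟨lo 0, left_mem_Icc.2 (hle 0), hi 0, right_mem_Icc.2 (hle 0), rfl, rfl, ?_⟩
    intro x hx i hi
    obtain rfl : i = 0 := by omega
    rwa [uIcc_of_le (hle 0)] at hx
  | succ n ih =>
    intro lo hi hle hcov
    obtain ⟨a', ha', b', hb', hna, hnb, hfol⟩ := ih (fun k => lo (k + 1)) (fun k => hi (k + 1))
      (fun k => hle _) (fun k => hcov _)
    obtain ⟨a, ha, b, hb, rfl, rfl, hmap⟩ := exists_uIcc_mapsTo hg (hcov 0 ha') (hcov 0 hb')
    refine ⟨a, ha, b, hb, hna, hnb, fun x hx i hi => ?_⟩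
    rcases i with _ | i
    · exact unitInterval.uIcc_subset_of_mem ha hb hx
    · exact hfol (g x) (hmap x hx) i (by omega)

theorem exists_periodic_orbit_of_covers {g : unitInterval → unitInterval} (hg : Continuous g)
    {lo hi : ℕ → unitInterval} (hle : ∀ k, lo k ≤ hi k)
    (hcov : ∀ k, Icc (lo (k + 1)) (hi (k + 1)) ⊆ g '' Icc (lo k) (hi k)) {N : ℕ} (hN : 1 ≤ N)
    (hlo : ∀ k, lo (k + N) = lo k) (hhi : ∀ k, hi (k + N) = hi k) :
    ∃ z, g^[N] z = z ∧ ∀ k, g^[k] z ∈ Icc (lo k) (hi k) := by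
  obtain ⟨a, ha, b, hb, hna, hnb, hfol⟩ := exists_uIcc_iterate_of_covers hg N lo hi hle hcov
  have h0 : lo N = lo 0 := by simpa using hlo 0
  have h1 : hi N = hi 0 := by simpa using hhi 0
  obtain ⟨z, hz, hfix⟩ : ∃ z ∈ uIcc a b, g^[N] z = z := by
    rw [uIcc_comm]
    exact exists_mem_uIcc_isFixedPt (hg.iterate N).continuousOn
      (by rw [hnb, h1]; exact hb.2) (by rw [hna, h0]; exact ha.1)
  refine ⟨z, hfix, fun k => ?_⟩
  have hper : ∀ q r, r < N → g^[r + N * q] z ∈ Icc (lo (r + N * q)) (hi (r + N * q)) := by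
    intro q r hr
    induction q with
    | zero => exact hfol z hz r hr.le
    | succ q ih =>
      rw [Nat.mul_succ, ← add_assoc, hlo, hhi, Function.iterate_add_apply, hfix]
      exact ih
  have := hper (k / N) (k % N) (Nat.mod_lt _ hN)
  rwa [Nat.mod_add_div] at this

/-- Left end point of one of the two windows of length `δ` in the block `[b/N, (b+1)/N]`, the first
one near the left end of the block and the second one near its right end. -/
def windowLeft (N : ℕ) (δ : ℝ) (b : ℕ) (σ : Bool) : ℝ :=
  if σ then ((b : ℝ) + 1) / N - 2 * δ else (b : ℝ) / N + δ

/-- The map `F` sends each block `[b/N, (b+1)/N]` into an interval with end points in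
`{j/(N+1)}` whose end points are attained in both windows of the block. -/
def WindowCovering (N : ℕ) (δ : ℝ) (F : unitInterval → unitInterval) : Prop :=
  ∀ b < N, ∃ c d : ℕ, c < d ∧ d ≤ N + 1 ∧
    (∀ x : unitInterval, (b : ℝ) / N ≤ x → (x : ℝ) ≤ ((b : ℝ) + 1) / N →
      (c : ℝ) / (N + 1) ≤ F x ∧ (F x : ℝ) ≤ (d : ℝ) / (N + 1)) ∧
    ∀ σ, (∃ x : unitInterval, windowLeft N δ b σ ≤ x ∧ (x : ℝ) ≤ windowLeft N δ b σ + δ ∧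
        (F x : ℝ) = (c : ℝ) / (N + 1)) ∧
      ∃ x : unitInterval, windowLeft N δ b σ ≤ x ∧ (x : ℝ) ≤ windowLeft N δ b σ + δ ∧
        (F x : ℝ) = (d : ℝ) / (N + 1)

/-- If a point of the block `b` is `2δ`-close to `[c/(N+1), d/(N+1)]`, then one of the windows of
this block lies in that interval, at distance at least `δ` from the end points. -/
theorem exists_window_subset {N b c d : ℕ} {δ p : ℝ} (hδ : 0 < δ)
    (hδN : 3 * δ ≤ 1 / (N * (N + 1))) (hb : b < N) (hcd : c < d) (hd : d ≤ N + 1)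
    (hp₁ : (b : ℝ) / N ≤ p) (hp₂ : p ≤ ((b : ℝ) + 1) / N)
    (hc' : (c : ℝ) / (N + 1) - 2 * δ ≤ p) (hd' : p ≤ (d : ℝ) / (N + 1) + 2 * δ) :
    ∃ σ, (c : ℝ) / (N + 1) + δ ≤ windowLeft N δ b σ ∧
      windowLeft N δ b σ + δ ≤ (d : ℝ) / (N + 1) - δ := by
  have hN : (0 : ℝ) < N := by exact_mod_cast (Nat.zero_le b).trans_lt hb
  obtain ⟨θ, hθ⟩ : ∃ θ : ℝ, θ = 1 / (N * (N + 1)) := ⟨_, rfl⟩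
  have hθ0 : 0 < θ := by rw [hθ]; positivity
  have hA : ∀ k : ℝ, k / (N + 1) = k * (N * θ) := fun k => by rw [hθ]; field_simp
  have hB : ∀ k : ℝ, k / N = k * (N * θ + θ) := fun k => by rw [hθ]; field_simp
  rw [← hθ] at hδN
  have hbN : (b : ℝ) + 1 ≤ N := by exact_mod_cast hb
  have hb0 : (0 : ℝ) ≤ b := Nat.cast_nonneg b
  simp only [windowLeft, hA, hB] at *
  have hbd : b + 1 ≤ d := by
    by_contra h
    have h₁ : (d : ℝ) ≤ b := by exact_mod_cast (by omega : d ≤ b)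
    have h₂ : (1 : ℝ) ≤ d := by exact_mod_cast (by omega : 1 ≤ d)
    nlinarith [mul_nonneg (sub_nonneg.2 h₁) (by positivity : 0 ≤ N * θ + θ),
      mul_nonneg (sub_nonneg.2 h₂) hθ0.le]
  have hcb : c ≤ b + 1 := by
    by_contra h
    have h₁ : (b : ℝ) + 2 ≤ c := by exact_mod_cast (by omega : b + 2 ≤ c)
    have h₂ : (c : ℝ) ≤ N := by exact_mod_cast (by omega : c ≤ N)
    nlinarith [mul_nonneg (sub_nonneg.2 h₁) (by positivity : 0 ≤ N * θ + θ),
      mul_nonneg (sub_nonneg.2 h₂) hθ0.le]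
  have hNθ : 0 ≤ N * θ := by positivity
  rcases hcb.eq_or_lt with h | h
  · refine ⟨true, ?_, ?_⟩
    · have : (c : ℝ) = b + 1 := by exact_mod_cast h
      simp only [if_true, this]
      nlinarith [mul_nonneg hb0 hθ0.le]
    · have : (b : ℝ) + 2 ≤ d := by exact_mod_cast (by omega : b + 2 ≤ d)
      simp only [if_true]
      nlinarith [mul_nonneg (sub_nonneg.2 this) hNθ, mul_nonneg (sub_nonneg.2 hbN) hθ0.le]
  · refine ⟨false, ?_, ?_⟩
    · have : (c : ℝ) ≤ b := by exact_mod_cast (by omega : c ≤ b)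
      simp only [Bool.false_eq_true, if_false]
      nlinarith [mul_nonneg (sub_nonneg.2 this) hNθ, mul_nonneg hb0 hθ0.le]
    · have : (b : ℝ) + 1 ≤ d := by exact_mod_cast hbd
      simp only [Bool.false_eq_true, if_false]
      nlinarith [mul_nonneg (sub_nonneg.2 this) hNθ, mul_nonneg (sub_nonneg.2 hbN) hθ0.le]

theorem windowLeft_mem_block {N b : ℕ} {δ : ℝ} (hδ : 0 < δ)
    (hδN : 3 * δ ≤ 1 / (N * (N + 1))) (hb : b < N) (σ : Bool) :
    (b : ℝ) / N < windowLeft N δ b σ ∧ windowLeft N δ b σ + δ < ((b : ℝ) + 1) / N := by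
  have hN : (0 : ℝ) < N := by exact_mod_cast (Nat.zero_le b).trans_lt hb
  have h : 1 / ((N : ℝ) * (N + 1)) ≤ 1 / N := by
    apply one_div_le_one_div_of_le hN
    nlinarith
  have : ((b : ℝ) + 1) / N = b / N + 1 / N := add_div _ _ _
  cases σ <;> simp only [windowLeft, Bool.false_eq_true, if_true, if_false] <;>
    constructor <;> linarith

theorem exists_block {N : ℕ} (hN : 0 < N) (p : unitInterval) :
    ∃ b < N, (b : ℝ) / N ≤ p ∧ (p : ℝ) ≤ ((b : ℝ) + 1) / N := by
  have hN' : (0 : ℝ) < N := by exact_mod_cast hN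
  have hp0 : (0 : ℝ) ≤ p := p.2.1
  have hp1 : (p : ℝ) ≤ 1 := p.2.2
  rcases hp1.eq_or_lt with h | h
  · refine ⟨N - 1, by omega, ?_, ?_⟩
    · rw [h, div_le_one hN']
      exact_mod_cast Nat.sub_le _ _
    · rw [h, Nat.cast_sub hN]; simp [hN'.ne']
  · have hpos : (0 : ℝ) ≤ p * N := by positivity
    refine ⟨⌊(p : ℝ) * N⌋₊, ?_, ?_, ?_⟩
    · rw [Nat.floor_lt hpos]; nlinarith
    · rw [div_le_iff₀ hN']; exact Nat.floor_le hpos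
    · rw [le_div_iff₀ hN']; exact (Nat.lt_floor_add_one _).le

theorem WindowCovering.shadowing {N : ℕ} (hN : 0 < N) {δ ε : ℝ} (hδ : 0 < δ)
    (hδN : 3 * δ ≤ 1 / (N * (N + 1))) (hε : 1 / (N : ℝ) < ε) {F g : unitInterval → unitInterval}
    (hF : WindowCovering N δ F) (hg : Continuous g) (hFg : ∀ x, dist (F x) (g x) < δ)
    {y : ℕ → unitInterval} (hy : IsPseudoOrbit g δ y) :
    (∃ z, Traces g ε z y) ∧ (PeriodicSeq y → ∃ z, IsPeriodicPt' g z ∧ Traces g ε z y) := by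
  have hN' : (0 : ℝ) < N := by exact_mod_cast hN
  choose blk hblk hblk₁ hblk₂ using exists_block hN
  let pr : ℝ → unitInterval := projIcc 0 1 zero_le_one
  let lo : ℕ → Bool → unitInterval := fun b σ => pr (windowLeft N δ b σ)
  let hi : ℕ → Bool → unitInterval := fun b σ => pr (windowLeft N δ b σ + δ)
  have hblock : ∀ b < N, (0 : ℝ) ≤ b / N ∧ ((b : ℝ) + 1) / N ≤ 1 := fun b hb =>
    ⟨by positivity, by rw [div_le_one hN']; exact_mod_cast hb⟩
  have hlo : ∀ b < N, ∀ σ, (lo b σ : ℝ) = windowLeft N δ b σ := by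
    intro b hb σ
    have := windowLeft_mem_block hδ hδN hb σ
    have := hblock b hb
    simp only [lo, pr]
    rw [projIcc_of_mem zero_le_one ⟨by linarith, by linarith⟩]
  have hhi : ∀ b < N, ∀ σ, (hi b σ : ℝ) = windowLeft N δ b σ + δ := by
    intro b hb σ
    have := windowLeft_mem_block hδ hδN hb σ
    have := hblock b hb
    simp only [hi, pr]
    rw [projIcc_of_mem zero_le_one ⟨by linarith, by linarith⟩]
  have hle : ∀ b σ, lo b σ ≤ hi b σ := fun b σ => monotone_projIcc _ (by linarith)
  have hnear : ∀ p σ, ∀ w ∈ Icc (lo (blk p) σ) (hi (blk p) σ), dist w p < ε := by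
    intro p σ w hw
    have h := windowLeft_mem_block hδ hδN (hblk p) σ
    have h₁ : (lo (blk p) σ : ℝ) ≤ w := hw.1
    have h₂ : (w : ℝ) ≤ hi (blk p) σ := hw.2
    rw [hlo _ (hblk p)] at h₁
    rw [hhi _ (hblk p)] at h₂
    have h₃ := hblk₁ p
    have h₄ := hblk₂ p
    rw [add_div] at h h₄
    rw [Subtype.dist_eq, Real.dist_eq]
    refine lt_of_lt_of_le ?_ hε.le
    rw [abs_lt]
    constructor <;> linarith
  have hstep : ∀ p p', dist (g p) p' < δ → ∃ σ', ∀ σ,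
      Icc (lo (blk p') σ') (hi (blk p') σ') ⊆ g '' Icc (lo (blk p) σ) (hi (blk p) σ) := by
    intro p p' hpp'
    obtain ⟨c, d, hcd, hd, himg, hatt⟩ := hF (blk p) (hblk p)
    obtain ⟨hc₁, hd₁⟩ := himg p (hblk₁ p) (hblk₂ p)
    have h₁ := hFg p
    rw [Subtype.dist_eq, Real.dist_eq, abs_lt] at h₁ hpp'
    obtain ⟨σ', hσ₁, hσ₂⟩ := exists_window_subset hδ hδN (hblk p') hcd hd (hblk₁ p') (hblk₂ p')
      (by linarith) (by linarith)
    refine ⟨σ', fun σ => ?_⟩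
    obtain ⟨⟨u, hu₁, hu₂, hu⟩, v, hv₁, hv₂, hv⟩ := hatt σ
    have hmem : ∀ x : unitInterval, windowLeft N δ (blk p) σ ≤ x →
        (x : ℝ) ≤ windowLeft N δ (blk p) σ + δ → x ∈ Icc (lo (blk p) σ) (hi (blk p) σ) :=
      fun x hx₁ hx₂ => ⟨by rw [← Subtype.coe_le_coe, hlo _ (hblk p)]; exact hx₁,
        by rw [← Subtype.coe_le_coe, hhi _ (hblk p)]; exact hx₂⟩
    refine Subset.trans ?_ (isPreconnected_Icc.intermediate_value (hmem u hu₁ hu₂)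
      (hmem v hv₁ hv₂) hg.continuousOn)
    have h₂ := hFg u
    have h₃ := hFg v
    rw [Subtype.dist_eq, Real.dist_eq, abs_lt] at h₂ h₃
    apply Icc_subset_Icc
    · rw [← Subtype.coe_le_coe, hlo _ (hblk p')]; linarith
    · rw [← Subtype.coe_le_coe, hhi _ (hblk p')]; linarith
  choose σ hσ using fun k => hstep (y k) (y (k + 1)) (hy k)
  constructor
  · let τ : ℕ → Bool := fun k => Nat.casesOn k false σ
    obtain ⟨z, hz⟩ := exists_orbit_of_covers hg
      (W := fun k => Icc (lo (blk (y k)) (τ k)) (hi (blk (y k)) (τ k))) (fun k => isClosed_Icc)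
      (fun k => nonempty_Icc.2 (hle _ _)) (fun k => hσ k (τ k))
    exact ⟨z, fun k => hnear _ _ _ (hz k)⟩
  · rintro ⟨M, hM, hper⟩
    let τ : ℕ → Bool := fun k => σ (k % M)
    have hmod : ∀ k, y (k % M) = y k := by
      have : ∀ q r, y (r + M * q) = y r := by
        intro q r
        induction q with
        | zero => rfl
        | succ q ih => rw [Nat.mul_succ, ← add_assoc, hper, ih]
      intro k
      conv_rhs => rw [← Nat.mod_add_div k M]
      rw [this]
    have hmod' : ∀ k, y (k % M + 1) = y (k + 1) := by
      intro k
      rw [← hmod (k % M + 1), ← hmod (k + 1), Nat.mod_add_mod]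
    obtain ⟨z, hfix, hz⟩ := exists_periodic_orbit_of_covers hg
      (lo := fun k => lo (blk (y (k + 1))) (τ k)) (hi := fun k => hi (blk (y (k + 1))) (τ k))
      (fun k => hle _ _)
      (fun k => by
        have := hσ ((k + 1) % M) (τ k)
        rwa [hmod, hmod'] at this) hM
      (fun k => by simp only [τ, Nat.add_mod_right, add_right_comm k M 1, hper])
      (fun k => by simp only [τ, Nat.add_mod_right, add_right_comm k M 1, hper])
    refine ⟨g^[M - 1] z, ⟨M, hM, ?_⟩, fun k => ?_⟩
    · rw [← Function.iterate_add_apply, add_comm, Function.iterate_add_apply, hfix]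
    · rw [← Function.iterate_add_apply]
      have := hnear _ _ _ (hz (k + (M - 1)))
      rwa [show k + (M - 1) + 1 = k + M by omega, hper] at this

/-- A self-map of `[0,1]` with the distribution function of the identity preserves Lebesgue
measure. -/
theorem measurePreserving_of_volume_sublevel {T : ℝ → ℝ} (hT : Measurable T)
    (hmaps : MapsTo T (Icc 0 1) (Icc 0 1))
    (hvol : ∀ s, 0 ≤ s → s < 1 → volume (Icc 0 1 ∩ {x | T x ≤ s}) = ENNReal.ofReal s) :
    MeasurePreserving T (volume.restrict (Icc 0 1)) (volume.restrict (Icc 0 1)) := by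
  refine ⟨hT, ?_⟩
  refine Measure.ext_of_Iic _ _ fun s => ?_
  rw [Measure.map_apply hT measurableSet_Iic, Measure.restrict_apply (hT measurableSet_Iic),
    Measure.restrict_apply measurableSet_Iic, inter_comm, inter_comm (Iic s)]
  change volume (Icc 0 1 ∩ {x | T x ≤ s}) = _
  rcases lt_or_ge s 0 with h | h
  · have h₁ : Icc 0 1 ∩ {x | T x ≤ s} = ∅ := by
      ext x
      simp only [mem_inter_iff, mem_ofPred_eq, mem_empty_iff_false, iff_false, not_and, not_le]
      exact fun hx => h.trans_le (hmaps hx).1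
    have h₂ : Icc (0 : ℝ) 1 ∩ Iic s = ∅ := by
      ext x
      simp only [mem_inter_iff, mem_Iic, mem_empty_iff_false, iff_false, not_and, not_le]
      exact fun hx => h.trans_le hx.1
    rw [h₁, h₂]
  rcases lt_or_ge s 1 with h' | h'
  · have h₂ : Icc (0 : ℝ) 1 ∩ Iic s = Icc 0 s := by
      ext x
      simp only [mem_inter_iff, mem_Icc, mem_Iic]
      constructor <;> rintro h <;> (refine ⟨?_, ?_⟩ <;> grind)
    rw [h₂, hvol s h h', Real.volume_Icc, sub_zero]
  · have h₁ : Icc 0 1 ∩ {x | T x ≤ s} = Icc 0 1 :=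
      inter_eq_left.2 fun x hx => (hmaps hx).2.trans h'
    have h₂ : Icc (0 : ℝ) 1 ∩ Iic s = Icc 0 1 := inter_eq_left.2 fun x hx => hx.2.trans h'
    rw [h₁, h₂]

/-- Piecewise affine Lebesgue measure preserving maps of `[0,1]` onto itself. -/
structure IsFolding (T : ℝ → ℝ) : Prop where
  pLin : PLin T
  mapsTo : MapsTo T (Icc 0 1) (Icc 0 1)
  surjOn : SurjOn T (Icc 0 1) (Icc 0 1)
  measurePreserving :
    MeasurePreserving T (volume.restrict (Icc 0 1)) (volume.restrict (Icc 0 1))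

namespace IsFolding

theorem of_volume_sublevel {T : ℝ → ℝ} (hT : PLin T) (hmaps : MapsTo T (Icc 0 1) (Icc 0 1))
    {u v : ℝ} (hu : u ∈ Icc (0 : ℝ) 1) (hv : v ∈ Icc (0 : ℝ) 1) (h0 : T u = 0) (h1 : T v = 1)
    (hvol : ∀ s, 0 ≤ s → s < 1 → volume (Icc 0 1 ∩ {x | T x ≤ s}) = ENNReal.ofReal s) :
    IsFolding T := by
  refine ⟨hT, hmaps, ?_, measurePreserving_of_volume_sublevel hT.continuous.measurable hmaps hvol⟩
  have := isPreconnected_Icc.intermediate_value hu hv hT.continuous.continuousOn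
  rwa [h0, h1] at this

theorem comp {S T : ℝ → ℝ} (hS : IsFolding S) (hT : IsFolding T) :
    IsFolding fun x => S (T x) :=
  ⟨hS.pLin.comp hT.pLin, hS.mapsTo.comp hT.mapsTo, hS.surjOn.comp hT.surjOn,
    hS.measurePreserving.comp hT.measurePreserving⟩

theorem volume_sublevel {T : ℝ → ℝ} (hT : IsFolding T) {s : Set ℝ} (hs : MeasurableSet s) :
    volume (Icc 0 1 ∩ T ⁻¹' s) = volume (Icc 0 1 ∩ s) := by
  have := hT.measurePreserving.measure_preimage hs.nullMeasurableSet
  rw [Measure.restrict_apply (hT.pLin.continuous.measurable hs), Measure.restrict_apply hs] at this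
  rwa [inter_comm, inter_comm _ s]

theorem iterate {T : ℝ → ℝ} (hT : IsFolding T) (k : ℕ) : IsFolding T^[k] := by
  induction k with
  | zero =>
    exact ⟨.id, fun _ h => h, fun x h => ⟨x, h, rfl⟩, MeasurePreserving.id _⟩
  | succ k ih => exact ih.comp hT

theorem reflection : IsFolding fun x => 1 - x := by
  refine of_volume_sublevel ((PLin.const 1).sub .id) ?_ (u := 1) (v := 0) (by simp) (by simp)
    (by simp) (by simp) ?_
  · rintro x ⟨h₁, h₂⟩
    exact ⟨by linarith, by linarith⟩
  · intro s h0 h1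
    have : Icc (0 : ℝ) 1 ∩ {x | 1 - x ≤ s} = Icc (1 - s) 1 := by
      ext x
      simp only [mem_inter_iff, mem_Icc, mem_ofPred_eq]
      constructor
      · rintro ⟨⟨_, _⟩, _⟩; constructor <;> linarith
      · rintro ⟨_, _⟩; refine ⟨⟨?_, ?_⟩, ?_⟩ <;> linarith
    rw [this, Real.volume_Icc]
    congr 1; ring

end IsFolding

/-- The map folding `[0,u]` onto itself in two affine pieces and fixing all points above `u`. -/
def foldBelow (u x : ℝ) : ℝ := |2 * (x ⊓ u) - u| + (x ⊔ u - u)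

theorem foldBelow_of_le {u x : ℝ} (h : x ≤ u) : foldBelow u x = |2 * x - u| := by
  simp [foldBelow, h]

theorem foldBelow_of_ge {u x : ℝ} (hu : 0 ≤ u) (h : u ≤ x) : foldBelow u x = x := by
  rw [foldBelow, min_eq_right h, max_eq_left h, abs_of_nonneg (by linarith)]
  ring

theorem isFolding_foldBelow {u : ℝ} (hu : u ∈ Icc (0 : ℝ) 1) : IsFolding (foldBelow u) := by
  obtain ⟨hu0, hu1⟩ := hu
  have hPL : PLin (foldBelow u) :=
    (((PLin.id.min (.const u)).const_mul 2).sub (.const u)).abs.add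
      ((PLin.id.max (.const u)).sub (.const u))
  refine IsFolding.of_volume_sublevel hPL ?_ (u := u / 2) (v := 1) ⟨by linarith, by linarith⟩
    (by simp) ?_ (foldBelow_of_ge hu0 hu1) ?_
  · rintro x ⟨h₁, h₂⟩
    rcases le_total x u with h | h
    · rw [foldBelow_of_le h]
      exact ⟨abs_nonneg _, abs_le.2 ⟨by linarith, by linarith⟩⟩
    · rw [foldBelow_of_ge hu0 h]; exact ⟨h₁, h₂⟩
  · rw [foldBelow_of_le (by linarith)]
    rw [abs_eq_zero]; ring
  · intro s hs0 hs1
    rcases lt_or_ge s u with hsu | hsu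
    · have : Icc (0 : ℝ) 1 ∩ {x | foldBelow u x ≤ s} = Icc ((u - s) / 2) ((u + s) / 2) := by
        ext x
        simp only [mem_inter_iff, mem_Icc, mem_ofPred_eq]
        rcases le_total x u with h | h
        · rw [foldBelow_of_le h, abs_le]
          constructor
          · rintro ⟨⟨_, _⟩, _, _⟩; constructor <;> linarith
          · rintro ⟨_, _⟩; refine ⟨⟨?_, ?_⟩, ?_, ?_⟩ <;> linarith
        · rw [foldBelow_of_ge hu0 h]
          constructor
          · rintro ⟨⟨_, _⟩, _⟩; constructor <;> linarith
          · rintro ⟨_, _⟩; refine ⟨⟨?_, ?_⟩, ?_⟩ <;> linarith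
      rw [this, Real.volume_Icc]
      congr 1; ring
    · have : Icc (0 : ℝ) 1 ∩ {x | foldBelow u x ≤ s} = Icc 0 s := by
        ext x
        simp only [mem_inter_iff, mem_Icc, mem_ofPred_eq]
        rcases le_total x u with h | h
        · rw [foldBelow_of_le h, abs_le]
          constructor
          · rintro ⟨⟨_, _⟩, _, _⟩; constructor <;> linarith
          · rintro ⟨_, _⟩; refine ⟨⟨?_, ?_⟩, ?_, ?_⟩ <;> linarith
        · rw [foldBelow_of_ge hu0 h]
          constructor
          · rintro ⟨⟨_, _⟩, _⟩; constructor <;> linarith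
          · rintro ⟨_, _⟩; refine ⟨⟨?_, ?_⟩, ?_⟩ <;> linarith
      rw [this, Real.volume_Icc, sub_zero]

/-- Any two end values are realized by a folding of `[0,1]`. -/
theorem exists_isFolding {u v : ℝ} (hu : u ∈ Icc (0 : ℝ) 1) (hv : v ∈ Icc (0 : ℝ) 1) :
    ∃ T, IsFolding T ∧ T 0 = u ∧ T 1 = v := by
  have key : ∀ u v : ℝ, u ∈ Icc (0 : ℝ) 1 → v ∈ Icc (0 : ℝ) 1 → u ≤ v →
      ∃ T, IsFolding T ∧ T 0 = u ∧ T 1 = v := by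
    intro u v hu hv huv
    have hv' : 1 - v ∈ Icc (0 : ℝ) 1 := ⟨by linarith [hv.2], by linarith [hv.1]⟩
    refine ⟨_, ((isFolding_foldBelow hu).comp IsFolding.reflection).comp
      ((isFolding_foldBelow hv').comp IsFolding.reflection), ?_, ?_⟩
    · simp only [sub_zero]
      rw [foldBelow_of_ge hv'.1 hv'.2, sub_self, foldBelow_of_le hu.1]
      simp [abs_of_nonneg hu.1]
    · simp only [sub_self]
      rw [foldBelow_of_le hv'.1, mul_zero, zero_sub, abs_neg, abs_of_nonneg hv'.1, sub_sub_cancel,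
        foldBelow_of_ge hu.1 huv]
  rcases le_total u v with h | h
  · exact key u v hu hv h
  · obtain ⟨T, hT, h0, h1⟩ := key v u hv hu h
    exact ⟨_, hT.comp IsFolding.reflection, by simpa using h1, by simpa using h0⟩

/-- The three-fold zigzag map through `(0,0)`, `(1/3,1)`, `(2/3,0)` and `(1,1)`. -/
def zigzag (x : ℝ) : ℝ := 3 * x - |3 * x - 1| + |3 * x - 2| - 1

theorem zigzag_left {x : ℝ} (h : x ≤ 1 / 3) : zigzag x = 3 * x := by
  rw [zigzag, abs_of_nonpos (by linarith), abs_of_nonpos (by linarith)]; ring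

theorem zigzag_mid {x : ℝ} (h : 1 / 3 ≤ x) (h' : x ≤ 2 / 3) : zigzag x = 2 - 3 * x := by
  rw [zigzag, abs_of_nonneg (by linarith), abs_of_nonpos (by linarith)]; ring

theorem zigzag_right {x : ℝ} (h : 2 / 3 ≤ x) : zigzag x = 3 * x - 2 := by
  rw [zigzag, abs_of_nonneg (by linarith), abs_of_nonneg (by linarith)]; ring

theorem zigzag_zero : zigzag 0 = 0 := by rw [zigzag_left] <;> norm_num

theorem zigzag_one : zigzag 1 = 1 := by rw [zigzag_right] <;> norm_num

theorem isFolding_zigzag : IsFolding zigzag := by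
  have h3 : PLin fun x => 3 * x := PLin.id.const_mul 3
  have hPL : PLin zigzag :=
    (((h3.sub (h3.sub (.const 1)).abs).add (h3.sub (.const 2)).abs).sub (.const 1))
  refine IsFolding.of_volume_sublevel hPL ?_ (u := 0) (v := 1) (by simp) (by simp)
    zigzag_zero zigzag_one ?_
  · rintro x ⟨h₁, h₂⟩
    rcases le_total x (1 / 3) with h | h
    · rw [zigzag_left h]; constructor <;> linarith
    rcases le_total x (2 / 3) with h' | h'
    · rw [zigzag_mid h h']; constructor <;> linarith
    · rw [zigzag_right h']; constructor <;> linarith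
  · intro s hs0 hs1
    have : Icc (0 : ℝ) 1 ∩ {x | zigzag x ≤ s} =
        Icc 0 (s / 3) ∪ Icc (2 / 3 - s / 3) (2 / 3 + s / 3) := by
      ext x
      simp only [mem_inter_iff, mem_Icc, mem_ofPred_eq, mem_union]
      rcases le_total x (1 / 3) with h | h
      · rw [zigzag_left h]; grind
      rcases le_total x (2 / 3) with h' | h'
      · rw [zigzag_mid h h']; grind
      · rw [zigzag_right h']; grind
    rw [this, measure_union _ measurableSet_Icc, Real.volume_Icc, Real.volume_Icc,
      ← ENNReal.ofReal_add (by linarith) (by linarith)]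
    · congr 1; ring
    · rw [Set.disjoint_left]
      rintro x ⟨_, h₁⟩ ⟨h₂, _⟩
      linarith

/-- The zigzag map either stretches an interval by the factor `3/2` or maps it onto `[0,1]`. -/
theorem zigzag_expands {a b : ℝ} (ha : 0 ≤ a) (hab : a ≤ b) (hb : b ≤ 1) :
    ∃ x ∈ Icc a b, ∃ y ∈ Icc a b, (zigzag x = 0 ∧ zigzag y = 1) ∨
      3 / 2 * (b - a) ≤ zigzag y - zigzag x := by
  have hamem : a ∈ Icc a b := ⟨le_rfl, hab⟩
  have hbmem : b ∈ Icc a b := ⟨hab, le_rfl⟩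
  have e1 : zigzag (1 / 3) = 1 := by rw [zigzag_left le_rfl]; norm_num
  have e2 : zigzag (2 / 3) = 0 := by rw [zigzag_right le_rfl]; norm_num
  rcases le_total a (1 / 3) with h₁ | h₁ <;> rcases le_total b (1 / 3) with h₂ | h₂
  · exact ⟨a, hamem, b, hbmem, .inr (by rw [zigzag_left h₁, zigzag_left h₂]; linarith)⟩
  · have hm : (1 / 3 : ℝ) ∈ Icc a b := ⟨h₁, h₂⟩
    rcases le_total b (2 / 3) with h₃ | h₃
    · rcases le_total (1 / 3 - a) (b - 1 / 3) with h₄ | h₄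
      · exact ⟨b, hbmem, 1 / 3, hm, .inr (by rw [e1, zigzag_mid h₂ h₃]; linarith)⟩
      · exact ⟨a, hamem, 1 / 3, hm, .inr (by rw [e1, zigzag_left h₁]; linarith)⟩
    · exact ⟨2 / 3, ⟨by linarith, h₃⟩, 1 / 3, hm, .inl ⟨e2, e1⟩⟩
  · obtain rfl : a = 1 / 3 := by linarith
    obtain rfl : b = 1 / 3 := by linarith
    exact ⟨1 / 3, hamem, 1 / 3, hamem, .inr (by simp)⟩
  · rcases le_total a (2 / 3) with h₄ | h₄ <;> rcases le_total b (2 / 3) with h₃ | h₃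
    · exact ⟨b, hbmem, a, hamem, .inr (by rw [zigzag_mid h₁ h₄, zigzag_mid h₂ h₃]; linarith)⟩
    · have hm : (2 / 3 : ℝ) ∈ Icc a b := ⟨h₄, h₃⟩
      rcases le_total (2 / 3 - a) (b - 2 / 3) with h₅ | h₅
      · exact ⟨2 / 3, hm, b, hbmem, .inr (by rw [e2, zigzag_right h₃]; linarith)⟩
      · exact ⟨2 / 3, hm, a, hamem, .inr (by rw [e2, zigzag_mid h₁ h₄]; linarith)⟩
    · obtain rfl : a = 2 / 3 := by linarith
      obtain rfl : b = 2 / 3 := by linarith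
      exact ⟨2 / 3, hamem, 2 / 3, hamem, .inr (by simp)⟩
    · exact ⟨a, hamem, b, hbmem, .inr (by rw [zigzag_right h₃, zigzag_right h₄]; linarith)⟩

theorem zigzag_iterate_zero (k : ℕ) : zigzag^[k] 0 = 0 := Function.iterate_fixed zigzag_zero k

theorem zigzag_iterate_one (k : ℕ) : zigzag^[k] 1 = 1 := Function.iterate_fixed zigzag_one k

theorem exists_zigzag_iterate_of_pow_le (n : ℕ) : ∀ a b : ℝ, 0 ≤ a → b ≤ 1 →
    (2 / 3 : ℝ) ^ n ≤ b - a →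
    ∃ x ∈ Icc a b, ∃ y ∈ Icc a b, zigzag^[n] x = 0 ∧ zigzag^[n] y = 1 := by
  induction n with
  | zero =>
    intro a b ha hb h
    rw [pow_zero] at h
    exact ⟨a, ⟨le_rfl, by linarith⟩, b, ⟨by linarith, le_rfl⟩,
      by simp only [Function.iterate_zero, id_eq]; linarith,
      by simp only [Function.iterate_zero, id_eq]; linarith⟩
  | succ n ih =>
    intro a b ha hb h
    have hpos : (0 : ℝ) < (2 / 3) ^ n := by positivity
    rw [pow_succ] at h
    have hab : a ≤ b := by linarith
    obtain ⟨x, hx, y, hy, ⟨h0, h1⟩ | hxy⟩ := zigzag_expands ha hab hb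
    · exact ⟨x, hx, y, hy, by rw [Function.iterate_succ_apply, h0, zigzag_iterate_zero],
        by rw [Function.iterate_succ_apply, h1, zigzag_iterate_one]⟩
    · have hI : ∀ z ∈ Icc a b, z ∈ Icc (0 : ℝ) 1 := fun z hz => ⟨ha.trans hz.1, hz.2.trans hb⟩
      obtain ⟨x', hx', y', hy', h0, h1⟩ := ih (zigzag x) (zigzag y)
        (isFolding_zigzag.mapsTo (hI x hx)).1 (isFolding_zigzag.mapsTo (hI y hy)).2 (by linarith)
      have hivt := isPreconnected_Icc.intermediate_value hx hy
        isFolding_zigzag.pLin.continuous.continuousOn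
      obtain ⟨p, hp, rfl⟩ := hivt hx'
      obtain ⟨q, hq, rfl⟩ := hivt hy'
      exact ⟨p, hp, q, hq, h0, h1⟩

/-- High iterates of the zigzag map send every interval of given length onto `[0,1]`. -/
theorem exists_zigzag_iterate_surjOn {η : ℝ} (hη : 0 < η) :
    ∃ k, ∀ a b : ℝ, 0 ≤ a → b ≤ 1 → η ≤ b - a → SurjOn zigzag^[k] (Icc a b) (Icc 0 1) := by
  obtain ⟨k, hk⟩ := exists_pow_lt_of_lt_one hη (by norm_num : (2 / 3 : ℝ) < 1)
  refine ⟨k, fun a b ha hb hab => ?_⟩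
  obtain ⟨x, hx, y, hy, h0, h1⟩ := exists_zigzag_iterate_of_pow_le k a b ha hb (hk.le.trans hab)
  have := isPreconnected_Icc.intermediate_value hx hy
    (isFolding_zigzag.iterate k).pLin.continuous.continuousOn
  rwa [h0, h1] at this

/-- Truncation of a real number to `[0,1]`. -/
def truncUnit (x : ℝ) : ℝ := 0 ⊔ (x ⊓ 1)

theorem truncUnit_of_nonpos {x : ℝ} (h : x ≤ 0) : truncUnit x = 0 :=
  max_eq_left ((min_le_left _ _).trans h)

theorem truncUnit_of_one_le {x : ℝ} (h : 1 ≤ x) : truncUnit x = 1 := by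
  rw [truncUnit, min_eq_right h, max_eq_right zero_le_one]

theorem truncUnit_of_mem {x : ℝ} (h : 0 ≤ x) (h' : x ≤ 1) : truncUnit x = x := by
  rw [truncUnit, min_eq_left h', max_eq_right h]

theorem truncUnit_mono : Monotone truncUnit := fun _ _ h =>
  max_le_max le_rfl (min_le_min h le_rfl)

theorem pLin_truncUnit : PLin truncUnit := (PLin.const 0).max (PLin.id.min (.const 1))

/-- The distribution function, in the scale where each cell has length one, of the measure with
mass `p i` uniformly distributed on the cell `[i, i+1]` for `i < n`. -/
def cellCdf (p : ℕ → ℝ) (n : ℕ) (τ : ℝ) : ℝ := ∑ i ∈ Finset.range n, p i * truncUnit (τ - i)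

/-- The quantile function inverse to `cellCdf`. -/
def cellQuantile (p : ℕ → ℝ) (n : ℕ) (s : ℝ) : ℝ :=
  ∑ i ∈ Finset.range n, truncUnit ((s - ∑ j ∈ Finset.range i, p j) / p i)

theorem cellCdf_of_ge (p : ℕ → ℝ) {n : ℕ} {τ : ℝ} (h : (n : ℝ) ≤ τ) :
    cellCdf p n τ = ∑ i ∈ Finset.range n, p i := by
  refine Finset.sum_congr rfl fun i hi => ?_
  have : (i : ℝ) + 1 ≤ n := by exact_mod_cast Finset.mem_range.1 hi
  rw [truncUnit_of_one_le (by linarith), mul_one]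

theorem cellCdf_of_nonpos (p : ℕ → ℝ) {n : ℕ} {τ : ℝ} (h : τ ≤ 0) : cellCdf p n τ = 0 := by
  refine Finset.sum_eq_zero fun i _ => ?_
  have : (0 : ℝ) ≤ i := Nat.cast_nonneg i
  rw [truncUnit_of_nonpos (by linarith), mul_zero]

theorem sum_truncUnit_sub {n : ℕ} {τ : ℝ} (h0 : 0 ≤ τ) (hn : τ ≤ n) :
    ∑ i ∈ Finset.range n, truncUnit (τ - i) = τ := by
  induction n with
  | zero =>
    rw [Nat.cast_zero] at hn
    rw [Finset.sum_range_zero]; linarith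
  | succ n ih =>
    rw [Finset.sum_range_succ]
    push_cast at hn
    rcases le_total τ n with h | h
    · rw [ih h, truncUnit_of_nonpos (by linarith), add_zero]
    · have := cellCdf_of_ge (fun _ => 1) h
      simp only [cellCdf, one_mul, Finset.sum_const, Finset.card_range, nsmul_eq_mul,
        mul_one] at this
      rw [this, truncUnit_of_mem (by linarith) (by linarith)]
      ring

theorem continuous_cellCdf (p : ℕ → ℝ) (n : ℕ) : Continuous (cellCdf p n) :=
  continuous_finsetSum _ fun _ _ => continuous_const.mul
    (pLin_truncUnit.continuous.comp (continuous_id.sub continuous_const))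

theorem pLin_cellQuantile (p : ℕ → ℝ) (n : ℕ) : PLin (cellQuantile p n) := by
  refine PLin.sum _ fun i _ => ?_
  have := pLin_truncUnit.comp
    ((PLin.id.sub (.const (∑ j ∈ Finset.range i, p j))).const_mul (p i)⁻¹)
  simpa only [div_eq_inv_mul] using this

section
variable {p : ℕ → ℝ} {n : ℕ} (hp : ∀ i < n, 0 < p i)
include hp

theorem cellCdf_mono : Monotone (cellCdf p n) := fun _ _ h =>
  Finset.sum_le_sum fun i hi => mul_le_mul_of_nonneg_left
    (truncUnit_mono (by linarith)) (hp i (Finset.mem_range.1 hi)).le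

theorem cellQuantile_mono : Monotone (cellQuantile p n) := fun _ _ h =>
  Finset.sum_le_sum fun i hi => truncUnit_mono <|
    div_le_div_of_nonneg_right (by linarith) (hp i (Finset.mem_range.1 hi)).le

theorem cellQuantile_of_ge {s : ℝ} (h : ∑ i ∈ Finset.range n, p i ≤ s) :
    cellQuantile p n s = n := by
  have : ∀ i ∈ Finset.range n,
      truncUnit ((s - ∑ j ∈ Finset.range i, p j) / p i) = 1 := by
    intro i hi
    have hi' := Finset.mem_range.1 hi
    refine truncUnit_of_one_le ?_
    rw [one_le_div (hp i hi')]
    have h₁ : ∑ j ∈ Finset.range (i + 1), p j ≤ ∑ j ∈ Finset.range n, p j :=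
      Finset.sum_le_sum_of_subset_of_nonneg (Finset.range_subset_range.2 hi')
        fun j hj _ => (hp j (Finset.mem_range.1 hj)).le
    rw [Finset.sum_range_succ] at h₁
    linarith
  rw [cellQuantile, Finset.sum_congr rfl this]
  simp

theorem cellQuantile_cellCdf {τ : ℝ} (h0 : 0 ≤ τ) (hn : τ ≤ n) :
    cellQuantile p n (cellCdf p n τ) = τ := by
  induction n with
  | zero =>
    rw [Nat.cast_zero] at hn
    rw [cellQuantile, Finset.sum_range_zero]; linarith
  | succ n ih =>
    have hp' : ∀ i < n, 0 < p i := fun i hi => hp i (by omega)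
    have hpn := hp n n.lt_succ_self
    have hK : cellCdf p (n + 1) τ = cellCdf p n τ + p n * truncUnit (τ - n) :=
      Finset.sum_range_succ _ _
    have hQ : ∀ s, cellQuantile p (n + 1) s =
        cellQuantile p n s + truncUnit ((s - ∑ j ∈ Finset.range n, p j) / p n) :=
      fun s => Finset.sum_range_succ _ _
    push_cast at hn
    rcases le_total τ n with h | h
    · have hle : cellCdf p n τ ≤ ∑ j ∈ Finset.range n, p j :=
        (cellCdf_of_ge p le_rfl (n := n)) ▸ cellCdf_mono hp' h
      rw [hK, truncUnit_of_nonpos (by linarith), mul_zero, add_zero, hQ, ih hp' h,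
        truncUnit_of_nonpos (div_nonpos_of_nonpos_of_nonneg (by linarith) hpn.le), add_zero]
    · have hτ : 0 ≤ τ - n := by linarith
      rw [hK, truncUnit_of_mem hτ (by linarith), cellCdf_of_ge p h, hQ,
        cellQuantile_of_ge hp' (by nlinarith [mul_nonneg hpn.le hτ]), add_sub_cancel_left,
        mul_div_cancel_left₀ _ hpn.ne', truncUnit_of_mem hτ (by linarith)]
      ring

theorem cellQuantile_of_nonpos {s : ℝ} (h : s ≤ 0) : cellQuantile p n s = 0 := by
  refine Finset.sum_eq_zero fun i hi => truncUnit_of_nonpos ?_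
  have hi' := Finset.mem_range.1 hi
  have : 0 ≤ ∑ j ∈ Finset.range i, p j :=
    Finset.sum_nonneg fun j hj => (hp j ((Finset.mem_range.1 hj).trans hi')).le
  exact div_nonpos_of_nonpos_of_nonneg (by linarith) (hp i hi').le

theorem cellQuantile_mem {s : ℝ} : cellQuantile p n s ∈ Icc (0 : ℝ) n := by
  constructor
  · rw [← cellQuantile_of_nonpos hp (min_le_right s 0)]
    exact cellQuantile_mono hp (min_le_left _ _)
  · conv_rhs => rw [← cellQuantile_of_ge hp (le_max_right s _)]
    exact cellQuantile_mono hp (le_max_left _ _)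

theorem volume_cellQuantile_sublevel (τ : ℝ) :
    volume (Icc 0 (∑ i ∈ Finset.range n, p i) ∩ {s | cellQuantile p n s ≤ τ}) =
      ENNReal.ofReal (cellCdf p n τ) := by
  rcases lt_or_ge τ 0 with h | h
  · have : Icc 0 (∑ i ∈ Finset.range n, p i) ∩ {s | cellQuantile p n s ≤ τ} = ∅ := by
      ext s
      simp only [mem_inter_iff, mem_ofPred_eq, mem_empty_iff_false, iff_false, not_and, not_le]
      exact fun _ => h.trans_le (cellQuantile_mem hp).1
    rw [this, cellCdf_of_nonpos p h.le]; simp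
  rcases lt_or_ge (n : ℝ) τ with h' | h'
  · have : Icc 0 (∑ i ∈ Finset.range n, p i) ∩ {s | cellQuantile p n s ≤ τ} =
        Icc 0 (∑ i ∈ Finset.range n, p i) :=
      inter_eq_left.2 fun s _ => (cellQuantile_mem hp).2.trans h'.le
    rw [this, cellCdf_of_ge p h'.le, Real.volume_Icc, sub_zero]
  · have htop : cellCdf p n τ ≤ ∑ i ∈ Finset.range n, p i :=
      (cellCdf_of_ge p le_rfl (n := n)) ▸ cellCdf_mono hp h'
    have : Icc 0 (∑ i ∈ Finset.range n, p i) ∩ {s | cellQuantile p n s ≤ τ} =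
        Icc 0 (cellCdf p n τ) := by
      ext s
      simp only [mem_inter_iff, mem_Icc, mem_ofPred_eq]
      constructor
      · rintro ⟨⟨hs0, hs1⟩, hs⟩
        refine ⟨hs0, ?_⟩
        obtain ⟨τ', hτ', rfl⟩ : s ∈ cellCdf p n '' Icc 0 n := by
          refine intermediate_value_Icc (Nat.cast_nonneg n) (continuous_cellCdf p n).continuousOn ?_
          rw [cellCdf_of_nonpos p le_rfl, cellCdf_of_ge p le_rfl]
          exact ⟨hs0, hs1⟩
        rw [cellQuantile_cellCdf hp hτ'.1 hτ'.2] at hs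
        exact cellCdf_mono hp hs
      · rintro ⟨hs0, hs1⟩
        refine ⟨⟨hs0, hs1.trans htop⟩, ?_⟩
        exact (cellQuantile_mono hp hs1).trans (cellQuantile_cellCdf hp h h').le
    rw [this, Real.volume_Icc, sub_zero]

end

theorem volume_Icc_inter_ne_top (a b : ℝ) (S : Set ℝ) : volume (Icc a b ∩ S) ≠ ⊤ :=
  measure_ne_top_of_subset inter_subset_left measure_Icc_lt_top.ne

theorem volumeReal_Icc_inter_add {a b c : ℝ} (hab : a ≤ b) (hbc : b ≤ c) {S : Set ℝ}
    (hS : MeasurableSet S) :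
    volume.real (Icc a c ∩ S) = volume.real (Icc a b ∩ S) + volume.real (Icc b c ∩ S) := by
  rw [← Icc_union_Icc_eq_Icc hab hbc, union_inter_distrib_right]
  refine measureReal_union₀ (measurableSet_Icc.inter hS).nullMeasurableSet ?_
    (volume_Icc_inter_ne_top _ _ _) (volume_Icc_inter_ne_top _ _ _)
  refine measure_mono_null (t := {b}) ?_ Real.volume_singleton
  rintro x ⟨⟨h₁, _⟩, h₂, _⟩
  exact le_antisymm h₁.2 h₂.1

theorem sum_volumeReal_blocks {N : ℕ} (n : ℕ) {S : Set ℝ} (hS : MeasurableSet S) :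
    ∑ b ∈ Finset.range n, volume.real (Icc ((b : ℝ) / N) (((b : ℝ) + 1) / N) ∩ S) =
      volume.real (Icc 0 ((n : ℝ) / N) ∩ S) := by
  induction n with
  | zero =>
    rw [Finset.sum_range_zero, Nat.cast_zero, zero_div, Icc_self]
    exact ((measureReal_eq_zero_iff (measure_ne_top_of_subset inter_subset_left (by simp))).2
      (measure_mono_null inter_subset_left Real.volume_singleton)).symm
  | succ n ih =>
    rw [Finset.sum_range_succ, ih, Nat.cast_add_one,
      ← volumeReal_Icc_inter_add (by positivity) (by gcongr; linarith) hS]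

/-- The distribution of a map without fat level sets, restricted to `[a,b]` and discretized to the
grid `{j/M}`, charges exactly the cells between two grid points `c/M` and `d/M`. -/
theorem exists_cells {f : ℝ → ℝ} (hf : Continuous f) (hmaps : ∀ x, f x ∈ Icc (0 : ℝ) 1)
    (hnull : ∀ s, volume (Icc 0 1 ∩ f ⁻¹' {s}) = 0) {a b : ℝ} (ha : 0 ≤ a) (hab : a < b)
    (hb : b ≤ 1) {M : ℕ} (hM : 0 < M) :
    ∃ c d : ℕ, c < d ∧ d ≤ M ∧
      (∀ x ∈ Icc a b, (c : ℝ) / M ≤ f x ∧ f x ≤ (d : ℝ) / M) ∧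
      (∃ x ∈ Icc a b, f x < ((c : ℝ) + 1) / M) ∧ (∃ x ∈ Icc a b, ((d : ℝ) - 1) / M < f x) ∧
      (∀ j, c ≤ j → j < d → volume.real (Icc a b ∩ {x | f x ≤ (j : ℝ) / M}) <
        volume.real (Icc a b ∩ {x | f x ≤ ((j : ℝ) + 1) / M})) ∧
      (∀ j ≤ c, volume.real (Icc a b ∩ {x | f x ≤ (j : ℝ) / M}) = 0) ∧
      ∀ j ≥ d, volume.real (Icc a b ∩ {x | f x ≤ (j : ℝ) / M}) = b - a := by
  have hM' : (0 : ℝ) < M := by exact_mod_cast hM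
  have hne : (Icc a b).Nonempty := nonempty_Icc.2 hab.le
  obtain ⟨p, hp, hpmin⟩ := isCompact_Icc.exists_isMinOn hne hf.continuousOn
  obtain ⟨q, hq, hqmax⟩ := isCompact_Icc.exists_isMaxOn hne hf.continuousOn
  have hlo : ∀ x ∈ Icc a b, f p ≤ f x := fun x hx => hpmin hx
  have hhi : ∀ x ∈ Icc a b, f x ≤ f q := fun x hx => hqmax hx
  have hsub : Icc a b ⊆ Icc 0 1 := Icc_subset_Icc ha hb
  have hpq : f p < f q := by
    refine lt_of_le_of_ne (hlo q hq) fun h => ?_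
    have h₁ : Icc a b ⊆ Icc 0 1 ∩ f ⁻¹' {f p} := fun x hx =>
      ⟨hsub hx, le_antisymm ((hhi x hx).trans h.symm.le) (hlo x hx)⟩
    have h₂ := measure_mono_null h₁ (hnull _)
    rw [Real.volume_Icc, ENNReal.ofReal_eq_zero] at h₂
    linarith
  have hpM : 0 ≤ f p * M := mul_nonneg (hmaps p).1 hM'.le
  have hc₁ : (⌊f p * M⌋₊ : ℝ) / M ≤ f p := by rw [div_le_iff₀ hM']; exact Nat.floor_le hpM
  have hc₂ : f p < ((⌊f p * M⌋₊ : ℝ) + 1) / M := by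
    rw [lt_div_iff₀ hM']; exact Nat.lt_floor_add_one _
  have hqM : 0 ≤ f q * M := mul_nonneg (hmaps q).1 hM'.le
  have hd₁ : f q ≤ (⌈f q * M⌉₊ : ℝ) / M := by rw [le_div_iff₀ hM']; exact Nat.le_ceil _
  have hd₂ : ((⌈f q * M⌉₊ : ℝ) - 1) / M < f q := by
    rw [div_lt_iff₀ hM']; linarith [Nat.ceil_lt_add_one hqM]
  refine ⟨⌊f p * M⌋₊, ⌈f q * M⌉₊, ?_, ?_, ?_, ⟨p, hp, hc₂⟩, ⟨q, hq, hd₂⟩, ?_, ?_, ?_⟩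
  · have := (hc₁.trans_lt hpq).trans_le hd₁
    rw [div_lt_div_iff_of_pos_right hM'] at this
    exact_mod_cast this
  · rw [Nat.ceil_le]; nlinarith [(hmaps q).2]
  · exact fun x hx => ⟨hc₁.trans (hlo x hx), (hhi x hx).trans hd₁⟩
  · intro j hcj hjd
    have h₁ : f p < ((j : ℝ) + 1) / M := by
      refine hc₂.trans_le ?_
      gcongr
    have h₂ : (j : ℝ) / M < f q := by
      refine lt_of_le_of_lt ?_ hd₂
      have : (j : ℝ) + 1 ≤ ⌈f q * M⌉₊ := by exact_mod_cast hjd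
      gcongr
      linarith
    have h₃ : (j : ℝ) / M < ((j : ℝ) + 1) / M := by gcongr; linarith
    obtain ⟨s, hs₁, hs₂⟩ : ∃ s, (f p ⊔ (j : ℝ) / M) < s ∧ s < f q ⊓ (((j : ℝ) + 1) / M) :=
      exists_between (max_lt (lt_min hpq h₁) (lt_min h₂ h₃))
    obtain ⟨x, hx, rfl⟩ : s ∈ f '' Icc a b :=
      isPreconnected_Icc.intermediate_value hp hq hf.continuousOn
        ⟨(le_max_left _ _).trans hs₁.le, hs₂.le.trans (min_le_left _ _)⟩
    have hU : IsOpen (f ⁻¹' Ioo ((j : ℝ) / M) (((j : ℝ) + 1) / M)) := isOpen_Ioo.preimage hf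
    have hxU : x ∈ f ⁻¹' Ioo ((j : ℝ) / M) (((j : ℝ) + 1) / M) :=
      ⟨(le_max_right _ _).trans_lt hs₁, hs₂.trans_le (min_le_right _ _)⟩
    have hne' : (f ⁻¹' Ioo ((j : ℝ) / M) (((j : ℝ) + 1) / M) ∩ Ioo a b).Nonempty := by
      have : x ∈ closure (Ioo a b) := by rwa [closure_Ioo hab.ne]
      exact mem_closure_iff.1 this _ hU hxU
    have hpos := (hU.inter isOpen_Ioo).measure_pos volume hne'
    have hd : Disjoint (Icc a b ∩ {x | f x ≤ (j : ℝ) / M})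
        (f ⁻¹' Ioo ((j : ℝ) / M) (((j : ℝ) + 1) / M) ∩ Ioo a b) := by
      rw [Set.disjoint_left]
      rintro z ⟨_, hz⟩ ⟨hz', _⟩
      exact absurd hz (not_le.2 hz'.1)
    have hfin : volume (f ⁻¹' Ioo ((j : ℝ) / M) (((j : ℝ) + 1) / M) ∩ Ioo a b) ≠ ⊤ :=
      measure_ne_top_of_subset inter_subset_right measure_Ioo_lt_top.ne
    have hu := measureReal_union hd (hU.inter isOpen_Ioo).measurableSet
      (volume_Icc_inter_ne_top _ _ _) hfin
    have hle : volume.real (Icc a b ∩ {x | f x ≤ (j : ℝ) / M} ∪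
        f ⁻¹' Ioo ((j : ℝ) / M) (((j : ℝ) + 1) / M) ∩ Ioo a b) ≤
        volume.real (Icc a b ∩ {x | f x ≤ ((j : ℝ) + 1) / M}) := by
      refine measureReal_mono (union_subset ?_ ?_) (volume_Icc_inter_ne_top _ _ _)
      · exact fun z hz => ⟨hz.1, le_trans hz.2 h₃.le⟩
      · exact fun z hz => ⟨Ioo_subset_Icc_self hz.2, hz.1.2.le⟩
    have := ENNReal.toReal_pos hpos.ne' hfin
    rw [hu] at hle
    exact lt_of_lt_of_le (lt_add_of_pos_right _ this) hle
  · intro j hj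
    refine (measureReal_eq_zero_iff (volume_Icc_inter_ne_top _ _ _)).2
      (measure_mono_null ?_ (hnull (f p)))
    rintro x ⟨hx, hxj⟩
    refine ⟨hsub hx, le_antisymm ?_ (hlo x hx)⟩
    refine (le_trans hxj ?_).trans hc₁
    gcongr
  · intro j hj
    have : Icc a b ∩ {x | f x ≤ (j : ℝ) / M} = Icc a b := by
      refine inter_eq_left.2 fun x hx => ((hhi x hx).trans hd₁).trans ?_
      gcongr
    rw [this, Real.volume_real_Icc_of_le hab.le]

/-- A piecewise affine function on `[0,1]` with the end values of `f` on `[a,b]`, whose distribution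
is the one of `f` on `[a,b]` discretized to the grid `{j/M}`, and which attains its extreme
values in every subinterval of length `η`. -/
theorem exists_block_map {f : ℝ → ℝ} (hf : Continuous f) (hmaps : ∀ x, f x ∈ Icc (0 : ℝ) 1)
    (hnull : ∀ s, volume (Icc 0 1 ∩ f ⁻¹' {s}) = 0) {a b : ℝ} (ha : 0 ≤ a) (hab : a < b)
    (hb : b ≤ 1) {M : ℕ} (hM : 0 < M) {η : ℝ} (hη : 0 < η) :
    ∃ G : ℝ → ℝ, PLin G ∧ G 0 = f a ∧ G 1 = f b ∧ ∃ c d : ℕ, c < d ∧ d ≤ M ∧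
      (∀ x ∈ Icc a b, (c : ℝ) / M ≤ f x ∧ f x ≤ (d : ℝ) / M) ∧
      (∃ x ∈ Icc a b, f x < ((c : ℝ) + 1) / M) ∧ (∃ x ∈ Icc a b, ((d : ℝ) - 1) / M < f x) ∧
      (∀ y, (c : ℝ) / M ≤ G y ∧ G y ≤ (d : ℝ) / M) ∧
      (∀ u v, 0 ≤ u → v ≤ 1 → η ≤ v - u →
        (∃ y ∈ Icc u v, G y = (c : ℝ) / M) ∧ ∃ y ∈ Icc u v, G y = (d : ℝ) / M) ∧
      ∀ t, volume.real (Icc 0 1 ∩ {y | G y ≤ t}) * (b - a) = ∑ j ∈ Finset.range M,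
        (volume.real (Icc a b ∩ {x | f x ≤ ((j : ℝ) + 1) / M}) -
          volume.real (Icc a b ∩ {x | f x ≤ (j : ℝ) / M})) * truncUnit (M * t - j) := by
  have hM' : (0 : ℝ) < M := by exact_mod_cast hM
  obtain ⟨c, d, hcd, hdM, hfcd, hfc, hfd, hpos, hzero, hfull⟩ :=
    exists_cells hf hmaps hnull ha hab hb hM
  obtain ⟨V, hV⟩ : ∃ V : ℕ → ℝ, V = fun j : ℕ => volume.real (Icc a b ∩ {x | f x ≤ (j : ℝ) / M}) :=
    ⟨_, rfl⟩
  have hVs : ∀ j : ℕ, volume.real (Icc a b ∩ {x | f x ≤ ((j : ℝ) + 1) / M}) = V (j + 1) :=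
    fun j => by rw [hV]; push_cast; rfl
  have hV0 : ∀ j : ℕ, volume.real (Icc a b ∩ {x | f x ≤ (j : ℝ) / M}) = V j :=
    fun j => by rw [hV]
  simp only [hVs, hV0] at hpos hzero hfull ⊢
  have hba : 0 < b - a := sub_pos.2 hab
  obtain ⟨n, rfl⟩ : ∃ n, d = c + n := ⟨d - c, by omega⟩
  let p : ℕ → ℝ := fun i => (V (c + i + 1) - V (c + i)) / (b - a)
  have hp : ∀ i < n, 0 < p i := fun i hi =>
    div_pos (sub_pos.2 (hpos _ (by omega) (by omega))) hba
  have hsum : ∑ i ∈ Finset.range n, p i = 1 := by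
    have h := Finset.sum_range_sub (fun i => V (c + i)) n
    simp only [← add_assoc, add_zero] at h
    simp only [p, ← Finset.sum_div]
    rw [h, hzero c le_rfl, hfull (c + n) le_rfl, sub_zero, div_self hba.ne']
  have hval : ∀ x ∈ Icc a b, ∃ u ∈ Icc (0 : ℝ) 1, ((c : ℝ) + cellQuantile p n u) / M = f x := by
    intro x hx
    obtain ⟨h₁, h₂⟩ := hfcd x hx
    rw [div_le_iff₀ hM'] at h₁
    rw [le_div_iff₀ hM'] at h₂
    push_cast at h₂
    refine ⟨cellCdf p n (f x * M - c), ⟨?_, ?_⟩, ?_⟩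
    · rw [← cellCdf_of_nonpos p (n := n) le_rfl]
      exact cellCdf_mono hp (by linarith)
    · rw [← hsum, ← cellCdf_of_ge p (n := n) le_rfl]
      exact cellCdf_mono hp (by linarith)
    · rw [cellQuantile_cellCdf hp (by linarith) (by linarith)]
      field_simp
      ring
  obtain ⟨u, hu, hfu⟩ := hval a (left_mem_Icc.2 hab.le)
  obtain ⟨v, hv, hfv⟩ := hval b (right_mem_Icc.2 hab.le)
  obtain ⟨T, hT, hT0, hT1⟩ := exists_isFolding hu hv
  obtain ⟨k, hk⟩ := exists_zigzag_iterate_surjOn hη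
  have hTZ : IsFolding fun y => T (zigzag^[k] y) := hT.comp (isFolding_zigzag.iterate k)
  have hQ : PLin fun s => ((c : ℝ) + cellQuantile p n s) / M := by
    have := ((PLin.const c).add (pLin_cellQuantile p n)).const_mul (M : ℝ)⁻¹
    simpa only [div_eq_inv_mul] using this
  have hQ0 : cellQuantile p n 0 = 0 := cellQuantile_of_nonpos hp le_rfl
  have hQ1 : cellQuantile p n 1 = n := cellQuantile_of_ge hp hsum.le
  refine ⟨fun y => ((c : ℝ) + cellQuantile p n (T (zigzag^[k] y))) / M, hQ.comp hTZ.pLin, ?_, ?_,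
    c, c + n, hcd, hdM, hfcd, hfc, hfd, ?_, ?_, ?_⟩
  · simp only [zigzag_iterate_zero, hT0, hfu]
  · simp only [zigzag_iterate_one, hT1, hfv]
  · intro y
    have := cellQuantile_mem hp (s := T (zigzag^[k] y))
    push_cast
    constructor
    · gcongr; linarith [this.1]
    · gcongr; exact this.2
  · intro w z hw hz hwz
    have hsurj : SurjOn (fun y => T (zigzag^[k] y)) (Icc w z) (Icc 0 1) :=
      hT.surjOn.comp (hk w z hw hz hwz)
    obtain ⟨y₀, hy₀, h0⟩ := hsurj (left_mem_Icc.2 zero_le_one)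
    obtain ⟨y₁, hy₁, h1⟩ := hsurj (right_mem_Icc.2 zero_le_one)
    simp only at h0 h1
    refine ⟨⟨y₀, hy₀, ?_⟩, y₁, hy₁, ?_⟩
    · simp only [h0, hQ0, add_zero]
    · simp only [h1, hQ1]; push_cast; rfl
  · intro t
    have hset : {y | ((c : ℝ) + cellQuantile p n (T (zigzag^[k] y))) / M ≤ t} =
        (fun y => T (zigzag^[k] y)) ⁻¹' {s | cellQuantile p n s ≤ M * t - c} := by
      ext y
      simp only [mem_ofPred_eq, mem_preimage]
      rw [div_le_iff₀ hM']
      constructor <;> intro h <;> linarith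
    have hmeas : MeasurableSet {s | cellQuantile p n s ≤ M * t - c} :=
      (pLin_cellQuantile p n).continuous.measurable measurableSet_Iic
    have hvol := volume_cellQuantile_sublevel hp (M * t - c)
    rw [hsum] at hvol
    have hnonneg : 0 ≤ cellCdf p n (M * t - c) := by
      rw [← cellCdf_of_nonpos p (n := n) (min_le_right (M * t - c) 0)]
      exact cellCdf_mono hp (min_le_left _ _)
    rw [hset, measureReal_def, hTZ.volume_sublevel hmeas, hvol, ENNReal.toReal_ofReal hnonneg]
    have hout : ∀ j ∈ Finset.range M, j ∉ Finset.Ico c (c + n) →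
        (V (j + 1) - V j) * truncUnit (M * t - j) = 0 := by
      intro j _ hj
      rw [Finset.mem_Ico, not_and_or, not_le, not_lt] at hj
      rcases hj with hj | hj
      · rw [hzero j hj.le, hzero (j + 1) hj]; simp
      · rw [hfull j hj, hfull (j + 1) (by omega)]; simp
    rw [← Finset.sum_subset (fun j hj => Finset.mem_range.2
      ((Finset.mem_Ico.1 hj).2.trans_le hdM)) hout, Finset.sum_Ico_eq_sum_range, cellCdf,
      Finset.sum_mul]
    rw [add_tsub_cancel_left]
    refine Finset.sum_congr rfl fun i _ => ?_
    simp only [p]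
    push_cast
    rw [← sub_sub]
    field_simp

theorem lebI_apply {A : Set unitInterval} : lebI A = volume (Subtype.val '' A) :=
  (MeasurableEmbedding.subtype_coe measurableSet_Icc).comap_apply _ _

theorem volume_Icc_inter_preimage_of_mem_cLam {f : C(unitInterval, unitInterval)} (hf : f ∈ CLam)
    {S : Set ℝ} (hS : MeasurableSet S) :
    volume (Icc 0 1 ∩ (fun x : ℝ => (f (projIcc 0 1 zero_le_one x) : ℝ)) ⁻¹' S) =
      volume (Icc 0 1 ∩ S) := by
  have h := hf (Subtype.val ⁻¹' S) (measurable_subtype_coe hS)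
  rw [lebI_apply, lebI_apply, Subtype.image_preimage_coe] at h
  rw [← h]
  congr 1
  ext x
  constructor
  · rintro ⟨hx, hxS⟩
    refine ⟨⟨x, hx⟩, ?_, rfl⟩
    simpa only [mem_preimage, projIcc_of_mem zero_le_one hx] using hxS
  · rintro ⟨y, hy, rfl⟩
    refine ⟨y.2, ?_⟩
    simpa only [mem_preimage, projIcc_val] using hy

theorem exists_mem_cLam_of_measurePreserving {F : ℝ → ℝ} (hF : Continuous F)
    (hmaps : MapsTo F (Icc 0 1) (Icc 0 1))
    (hmp : MeasurePreserving F (volume.restrict (Icc 0 1)) (volume.restrict (Icc 0 1))) :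
    ∃ g ∈ CLam, ∀ x : unitInterval, (g x : ℝ) = F x := by
  refine ⟨⟨fun x => ⟨F x, hmaps x.2⟩, by fun_prop⟩, fun A hA => ?_, fun x => rfl⟩
  have hA' : MeasurableSet (Subtype.val '' A : Set ℝ) :=
    (MeasurableEmbedding.subtype_coe measurableSet_Icc).measurableSet_image.2 hA
  have h := hmp.measure_preimage hA'.nullMeasurableSet
  rw [Measure.restrict_apply hA', Measure.restrict_apply (hF.measurable hA')] at h
  rw [lebI_apply, lebI_apply]
  have hsub : Subtype.val '' A ∩ Icc 0 1 = (Subtype.val '' A : Set ℝ) :=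
    inter_eq_left.2 (by rintro _ ⟨x, _, rfl⟩; exact x.2)
  rw [hsub] at h
  rw [← h]
  congr 1
  ext x
  constructor
  · rintro ⟨y, hy, rfl⟩
    exact ⟨⟨_, hy, rfl⟩, y.2⟩
  · rintro ⟨⟨y, hy, hyx⟩, hx⟩
    refine ⟨⟨x, hx⟩, ?_, rfl⟩
    have : (⟨F x, hmaps hx⟩ : unitInterval) = y := Subtype.ext hyx.symm
    simpa only [mem_preimage, ContinuousMap.coe_mk, this] using hy

theorem exists_pLin_glue {N : ℕ} {G : ℕ → ℝ → ℝ} (hG : ∀ b < N, PLin (G b)) {e : ℕ → ℝ}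
    (h0 : ∀ b < N, G b 0 = e b) (h1 : ∀ b < N, G b 1 = e (b + 1)) (hN : 0 < N) :
    ∃ F, PLin F ∧ ∀ b < N, ∀ x ∈ Icc ((b : ℝ) / N) (((b : ℝ) + 1) / N),
      F x = G b (N * x - b) := by
  have hN' : (0 : ℝ) < N := by exact_mod_cast hN
  refine ⟨fun x => e 0 + ∑ b ∈ Finset.range N, (G b (truncUnit (N * x - b)) - G b 0),
    (PLin.const _).add (PLin.sum _ fun b hb => ?_), ?_⟩
  · exact ((hG b (Finset.mem_range.1 hb)).comp (pLin_truncUnit.comp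
      ((PLin.id.const_mul (N : ℝ)).sub (.const (b : ℝ))))).sub (.const _)
  · intro b hb x ⟨hx₁, hx₂⟩
    rw [div_le_iff₀ hN'] at hx₁
    rw [le_div_iff₀ hN'] at hx₂
    let e' : ℕ → ℝ := fun i => if i ≤ b then e i else G b (N * x - b)
    have hterm : ∀ i ∈ Finset.range N,
        G i (truncUnit (N * x - i)) - G i 0 = e' (i + 1) - e' i := by
      intro i hi
      rw [Finset.mem_range] at hi
      rcases lt_trichotomy i b with hib | rfl | hib
      · have : (i : ℝ) + 1 ≤ b := by exact_mod_cast hib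
        rw [truncUnit_of_one_le (by linarith), h0 i hi, h1 i hi]
        simp only [e', if_pos hib.le, if_pos (show i + 1 ≤ b from hib)]
      · rw [truncUnit_of_mem (by linarith) (by linarith), h0 i hi]
        simp [e']
      · have : (b : ℝ) + 1 ≤ i := by exact_mod_cast hib
        rw [truncUnit_of_nonpos (by linarith)]
        simp only [e', if_neg (show ¬ i ≤ b by omega), if_neg (show ¬ i + 1 ≤ b by omega), sub_self]
    simp only
    rw [Finset.sum_congr rfl hterm, Finset.sum_range_sub]
    simp only [e', if_neg (not_le.2 hb), if_pos (Nat.zero_le b)]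
    ring

theorem volumeReal_rescale {N b : ℕ} (hN : 0 < N) {F G : ℝ → ℝ}
    (hFG : ∀ x ∈ Icc ((b : ℝ) / N) (((b : ℝ) + 1) / N), F x = G (N * x - b)) (t : ℝ) :
    volume.real (Icc ((b : ℝ) / N) (((b : ℝ) + 1) / N) ∩ {x | F x ≤ t}) =
      volume.real (Icc 0 1 ∩ {y | G y ≤ t}) * (((b : ℝ) + 1) / N - b / N) := by
  have hN' : (0 : ℝ) < N := by exact_mod_cast hN
  have hset : Icc ((b : ℝ) / N) (((b : ℝ) + 1) / N) ∩ {x | F x ≤ t} =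
      (fun x => (N : ℝ) * x) ⁻¹' ((fun x => x + -(b : ℝ)) ⁻¹' (Icc 0 1 ∩ {y | G y ≤ t})) := by
    ext x
    have hmem : x ∈ Icc ((b : ℝ) / N) (((b : ℝ) + 1) / N) ↔ N * x + -(b : ℝ) ∈ Icc (0 : ℝ) 1 := by
      rw [mem_Icc, mem_Icc, div_le_iff₀ hN', le_div_iff₀ hN']
      constructor <;> rintro ⟨h₁, h₂⟩ <;> constructor <;> linarith
    simp only [mem_inter_iff, mem_preimage, ← hmem, mem_ofPred_eq]
    refine and_congr_right fun hx => ?_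
    rw [hFG x hx, sub_eq_add_neg]
  rw [hset, measureReal_def, Real.volume_preimage_mul_left hN'.ne', measure_preimage_add_right,
    ENNReal.toReal_mul, ENNReal.toReal_ofReal (abs_nonneg _), abs_of_pos (inv_pos.2 hN'),
    ← measureReal_def]
  field_simp
  ring

/-- A measure-preserving map can be replaced by a piecewise affine measure-preserving map which,
on every subinterval of definite length of a block `[b/N, (b+1)/N]`, attains its extreme values
over the block, these being multiples of `1/(N+1)`. -/
theorem exists_pLin_measurePreserving {f : ℝ → ℝ} (hf : Continuous f)
    (hmaps : ∀ x, f x ∈ Icc (0 : ℝ) 1) (hnull : ∀ s, volume (Icc 0 1 ∩ f ⁻¹' {s}) = 0)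
    (hvol : ∀ s ∈ Icc (0 : ℝ) 1, volume.real (Icc 0 1 ∩ {x | f x ≤ s}) = s)
    {N : ℕ} (hN : 0 < N) {η : ℝ} (hη : 0 < η) :
    ∃ F : ℝ → ℝ, PLin F ∧ MapsTo F (Icc 0 1) (Icc 0 1) ∧
      MeasurePreserving F (volume.restrict (Icc 0 1)) (volume.restrict (Icc 0 1)) ∧
      ∀ b < N, ∃ c d : ℕ, c < d ∧ d ≤ N + 1 ∧
        (∀ x ∈ Icc ((b : ℝ) / N) (((b : ℝ) + 1) / N),
          (c : ℝ) / (N + 1) ≤ f x ∧ f x ≤ (d : ℝ) / (N + 1)) ∧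
        (∃ x ∈ Icc ((b : ℝ) / N) (((b : ℝ) + 1) / N), f x < ((c : ℝ) + 1) / (N + 1)) ∧
        (∃ x ∈ Icc ((b : ℝ) / N) (((b : ℝ) + 1) / N), ((d : ℝ) - 1) / (N + 1) < f x) ∧
        (∀ x ∈ Icc ((b : ℝ) / N) (((b : ℝ) + 1) / N),
          (c : ℝ) / (N + 1) ≤ F x ∧ F x ≤ (d : ℝ) / (N + 1)) ∧
        ∀ u v, (b : ℝ) / N ≤ u → v ≤ ((b : ℝ) + 1) / N → η ≤ N * (v - u) →
          (∃ x ∈ Icc u v, F x = (c : ℝ) / (N + 1)) ∧ ∃ x ∈ Icc u v, F x = (d : ℝ) / (N + 1) := by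
  have hN' : (0 : ℝ) < N := by exact_mod_cast hN
  have hblock : ∀ b : ℕ, (b : ℝ) / N < ((b : ℝ) + 1) / N := fun b => by gcongr; linarith
  have hG : ∀ b : ℕ, b < N → _ := fun b hb =>
    exists_block_map hf hmaps hnull (a := (b : ℝ) / N) (b := ((b : ℝ) + 1) / N) (by positivity)
      (hblock b) (by rw [div_le_one hN']; exact_mod_cast hb) (M := N + 1) (Nat.succ_pos N) hη
  choose! G hGlin hG0 hG1 c d hcd hdM hfcd hfc hfd hGcd hGη hGvol using hG
  simp only [Nat.cast_add, Nat.cast_one] at hfcd hfc hfd hGcd hGη hGvol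
  obtain ⟨F, hF, hFG⟩ := exists_pLin_glue (e := fun b => f ((b : ℝ) / N)) hGlin hG0
    (fun b hb => by rw [hG1 b hb]; push_cast; rfl) hN
  have hFcd : ∀ b < N, ∀ x ∈ Icc ((b : ℝ) / N) (((b : ℝ) + 1) / N),
      (c b : ℝ) / (N + 1) ≤ F x ∧ F x ≤ (d b : ℝ) / (N + 1) := fun b hb x hx => by
    rw [hFG b hb x hx]
    exact hGcd b hb _
  have hFmaps : MapsTo F (Icc 0 1) (Icc 0 1) := by
    intro x hx
    obtain ⟨b, hb, h₁, h₂⟩ := exists_block hN ⟨x, hx⟩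
    obtain ⟨h₃, h₄⟩ := hFcd b hb x ⟨h₁, h₂⟩
    refine ⟨le_trans (by positivity) h₃, h₄.trans ?_⟩
    rw [div_le_one (by positivity)]
    exact_mod_cast hdM b hb
  have hFvol : ∀ t, 0 ≤ t → t < 1 → volume (Icc 0 1 ∩ {x | F x ≤ t}) = ENNReal.ofReal t := by
    intro t ht0 ht1
    rw [← ENNReal.ofReal_toReal (volume_Icc_inter_ne_top 0 1 {x | F x ≤ t})]
    congr 1
    have hblocks := sum_volumeReal_blocks (N := N) N
      (S := {x | F x ≤ t}) (hF.continuous.measurable measurableSet_Iic)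
    rw [div_self hN'.ne'] at hblocks
    have hV : ∀ s ∈ Icc (0 : ℝ) 1, ∑ b ∈ Finset.range N,
        volume.real (Icc ((b : ℝ) / N) (((b : ℝ) + 1) / N) ∩ {x | f x ≤ s}) = s := by
      intro s hs
      rw [sum_volumeReal_blocks (N := N) N (S := {x | f x ≤ s})
        (hf.measurable measurableSet_Iic), div_self hN'.ne', hvol s hs]
    rw [← measureReal_def, ← hblocks, Finset.sum_congr rfl fun b hb =>
      (volumeReal_rescale hN (hFG b (Finset.mem_range.1 hb)) t).trans
        (hGvol b (Finset.mem_range.1 hb) t), Finset.sum_comm]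
    have hcell : ∀ j ∈ Finset.range (N + 1), ∑ b ∈ Finset.range N,
        (volume.real (Icc ((b : ℝ) / N) (((b : ℝ) + 1) / N) ∩
            {x | f x ≤ ((j : ℝ) + 1) / (N + 1)}) -
          volume.real (Icc ((b : ℝ) / N) (((b : ℝ) + 1) / N) ∩ {x | f x ≤ (j : ℝ) / (N + 1)})) *
          truncUnit ((N + 1) * t - j) = 1 / (N + 1) * truncUnit ((N + 1) * t - j) := by
      intro j hj
      have hj' : (j : ℝ) + 1 ≤ N + 1 := by exact_mod_cast Finset.mem_range.1 hj
      rw [← Finset.sum_mul, Finset.sum_sub_distrib, hV, hV]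
      · ring
      · exact ⟨by positivity, by rw [div_le_one (by positivity)]; linarith⟩
      · exact ⟨by positivity, by rwa [div_le_one (by positivity)]⟩
    rw [Finset.sum_congr rfl hcell, ← Finset.mul_sum, sum_truncUnit_sub (by positivity)
      (by push_cast; nlinarith)]
    field_simp
  refine ⟨F, hF, hFmaps, measurePreserving_of_volume_sublevel hF.continuous.measurable hFmaps hFvol,
    fun b hb => ⟨c b, d b, hcd b hb, hdM b hb, hfcd b hb, hfc b hb, hfd b hb, hFcd b hb, ?_⟩⟩
  intro u v hu hv huv
  have hu' := (div_le_iff₀ hN').1 hu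
  have hv' := (le_div_iff₀ hN').1 hv
  have hlift : ∀ r : ℝ, (∃ y ∈ Icc (N * u - b) (N * v - b), G b y = r) →
      ∃ x ∈ Icc u v, F x = r := by
    rintro r ⟨y, ⟨hy₁, hy₂⟩, rfl⟩
    have h₁ : u ≤ (y + b) / N := by rw [le_div_iff₀ hN']; linarith
    have h₂ : (y + b) / N ≤ v := by rw [div_le_iff₀ hN']; linarith
    refine ⟨(y + b) / N, ⟨h₁, h₂⟩, ?_⟩
    rw [hFG b hb _ ⟨hu.trans h₁, h₂.trans hv⟩, mul_div_cancel₀ _ hN'.ne', add_sub_cancel_right]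
  obtain ⟨hc, hd⟩ := hGη b hb (N * u - b) (N * v - b) (by linarith) (by linarith) (by linarith)
  exact ⟨hlift _ hc, hlift _ hd⟩

theorem key_perturbation_lemma :
    ∀ ε > (0 : ℝ), ∀ f ∈ CLam, ∃ δ : ℝ, 0 < δ ∧ δ < ε / 2 ∧
      ∃ F ∈ CLam, PiecewiseAffine F ∧ dist f F < ε / 2 ∧
        ∀ g ∈ CLam, dist F g < δ →
          ∀ y : ℕ → unitInterval, IsPseudoOrbit (⇑g) δ y →
            (∃ z : unitInterval, Traces (⇑g) ε z y) ∧
            (PeriodicSeq y →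
              ∃ z : unitInterval, IsPeriodicPt' (⇑g) z ∧ Traces (⇑g) ε z y) := by
  intro ε hε f hf
  obtain ⟨h, hh⟩ : ∃ h : ℝ → ℝ, h = fun x => (f (projIcc 0 1 zero_le_one x) : ℝ) := ⟨_, rfl⟩
  have hfh : ∀ x : unitInterval, (f x : ℝ) = h x := fun x => by rw [hh]; simp only [projIcc_val]
  have hcont : Continuous h := by
    rw [hh]
    exact continuous_subtype_val.comp (f.continuous.comp continuous_projIcc)
  have hmaps : ∀ x, h x ∈ Icc (0 : ℝ) 1 := fun x => by rw [hh]; exact Subtype.property _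
  have hpre : ∀ S, MeasurableSet S → volume (Icc 0 1 ∩ h ⁻¹' S) = volume (Icc 0 1 ∩ S) :=
    fun S hS => by rw [hh]; exact volume_Icc_inter_preimage_of_mem_cLam hf hS
  have hnull : ∀ s, volume (Icc 0 1 ∩ h ⁻¹' {s}) = 0 := fun s => by
    rw [hpre _ (measurableSet_singleton s)]
    exact measure_mono_null inter_subset_right Real.volume_singleton
  have hvol : ∀ s ∈ Icc (0 : ℝ) 1, volume.real (Icc 0 1 ∩ {x | h x ≤ s}) = s := by
    intro s hs
    have : Icc 0 1 ∩ Iic s = Icc 0 s := by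
      ext x
      exact ⟨fun hx => ⟨hx.1.1, hx.2⟩, fun hx => ⟨⟨hx.1, hx.2.trans hs.2⟩, hx.2⟩⟩
    rw [measureReal_def, show {x | h x ≤ s} = h ⁻¹' Iic s from rfl, hpre _ measurableSet_Iic, this,
      Real.volume_Icc, sub_zero, ENNReal.toReal_ofReal hs.1]
  obtain ⟨θ, hθ, hosc⟩ := Metric.uniformContinuous_iff.1
    (CompactSpace.uniformContinuous_of_continuous f.continuous) (ε / 4) (by positivity)
  obtain ⟨n, hn⟩ := exists_nat_one_div_lt (lt_min hθ (show 0 < ε / 8 by positivity))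
  obtain ⟨N, hNn⟩ : ∃ N, N = n + 1 := ⟨_, rfl⟩
  have hN : 0 < N := by omega
  have hN' : (0 : ℝ) < N := by exact_mod_cast hN
  have hNlt : 1 / (N : ℝ) < θ ⊓ (ε / 8) := by rw [hNn]; exact_mod_cast hn
  obtain ⟨hNθ, hNε⟩ := lt_min_iff.1 hNlt
  obtain ⟨δ, hδ⟩ : ∃ δ : ℝ, δ = 1 / (3 * ((N : ℝ) * (N + 1))) ⊓ (ε / 4) := ⟨_, rfl⟩
  have hδ0 : 0 < δ := by rw [hδ]; exact lt_min (by positivity) (by positivity)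
  have hδε : δ ≤ ε / 4 := by rw [hδ]; exact min_le_right _ _
  have hδN : 3 * δ ≤ 1 / ((N : ℝ) * (N + 1)) := by
    have h₁ : δ ≤ 1 / (3 * (N * (N + 1))) := by rw [hδ]; exact min_le_left _ _
    have h₂ : 1 / (3 * ((N : ℝ) * (N + 1))) = 1 / (N * (N + 1)) / 3 := by
      rw [div_div, mul_comm 3]
    linarith
  obtain ⟨F, hF, hFmaps, hFmp, hFb⟩ :=
    exists_pLin_measurePreserving hcont hmaps hnull hvol hN (mul_pos hN' hδ0)
  obtain ⟨F', hF', hFF'⟩ := exists_mem_cLam_of_measurePreserving hF.continuous hFmaps hFmp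
  refine ⟨δ, hδ0, by linarith, F', hF', ?_, ?_, ?_⟩
  · obtain ⟨m, t, ht0, htm, htlt, haff⟩ := hF.hasAffinePartition zero_le_one
    refine ⟨m, t, ht0, htm, htlt, fun j hj => ?_⟩
    obtain ⟨α, β, hαβ⟩ := haff j hj
    exact ⟨α, β, fun x h₁ h₂ => by rw [hFF', hαβ _ ⟨h₁, h₂⟩]⟩
  · rw [ContinuousMap.dist_lt_iff (by positivity)]
    intro x
    obtain ⟨b, hb, hx⟩ := exists_block hN x
    obtain ⟨c, d, -, -, hfcd, ⟨p, hp, hpc⟩, ⟨q, hq, hqd⟩, hFcd, -⟩ := hFb b hb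
    have hunit : ∀ z ∈ Icc ((b : ℝ) / N) (((b : ℝ) + 1) / N), z ∈ Icc (0 : ℝ) 1 := fun z hz =>
      ⟨le_trans (by positivity) hz.1,
        hz.2.trans (by rw [div_le_one hN']; exact_mod_cast hb)⟩
    have hpq : dist (⟨p, hunit p hp⟩ : unitInterval) ⟨q, hunit q hq⟩ < θ := by
      refine lt_of_le_of_lt (Real.dist_le_of_mem_Icc hp hq) ?_
      rwa [← sub_div, add_sub_cancel_left]
    have hpq' : |h p - h q| < ε / 4 := by
      have := hosc hpq
      rwa [Subtype.dist_eq, hfh, hfh, Real.dist_eq] at this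
    have hgrid : 1 / ((N : ℝ) + 1) < ε / 8 :=
      lt_of_le_of_lt (one_div_le_one_div_of_le hN' (by linarith)) hNε
    rw [add_div] at hpc
    rw [sub_div] at hqd
    obtain ⟨h₁, h₂⟩ := hfcd x hx
    obtain ⟨h₃, h₄⟩ := hFcd x hx
    rw [Subtype.dist_eq, hfh, hFF', Real.dist_eq, abs_lt]
    have := (abs_lt.1 hpq').1
    constructor <;> linarith
  · intro g _ hFg y hy
    refine WindowCovering.shadowing (F := F') hN hδ0 hδN (by linarith) ?_ g.continuous
      (fun x => (ContinuousMap.dist_apply_le_dist x).trans_lt hFg) hy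
    intro b hb
    obtain ⟨c, d, hcd, hdN, -, -, -, hFcd, hwin⟩ := hFb b hb
    refine ⟨c, d, hcd, hdN, fun x h₁ h₂ => by rw [hFF']; exact hFcd x ⟨h₁, h₂⟩, fun σ => ?_⟩
    obtain ⟨hl, hr⟩ := windowLeft_mem_block hδ0 hδN hb σ
    obtain ⟨⟨p, hp, hpc⟩, q, hq, hqd⟩ :=
      hwin (windowLeft N δ b σ) (windowLeft N δ b σ + δ) hl.le hr.le (by rw [add_sub_cancel_left])
    have hunit : ∀ z ∈ Icc (windowLeft N δ b σ) (windowLeft N δ b σ + δ), z ∈ Icc (0 : ℝ) 1 :=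
      fun z hz => ⟨le_trans (by positivity) (hl.le.trans hz.1),
        (hz.2.trans hr.le).trans (by rw [div_le_one hN']; exact_mod_cast hb)⟩
    exact ⟨⟨⟨p, hunit p hp⟩, hp.1, hp.2, by rw [hFF', hpc]⟩,
      ⟨q, hunit q hq⟩, hq.1, hq.2, by rw [hFF', hqd]⟩
end
end

section
/- The set LS_λ(I) of maps in C_λ(I) having the s-limit shadowing property is dense in C_λ(I). -/
open MeasureTheory Set Metric Filter Topology

noncomputable section

/-- `y` is an asymptotic pseudo orbit of `f`: `dist (f (y n)) (y (n+1)) → 0`. -/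
def AsymptoticPseudoOrbit (f : unitInterval → unitInterval) (y : ℕ → unitInterval) : Prop :=
  Filter.Tendsto (fun n : ℕ => dist (f (y n)) (y (n + 1))) Filter.atTop (𝓝 0)

/-- The s-limit shadowing property. -/
def SLimitShadowing (f : unitInterval → unitInterval) : Prop :=
  ∀ ε > (0 : ℝ), ∃ δ > (0 : ℝ),
    (∀ y : ℕ → unitInterval, IsPseudoOrbit f δ y → ∃ x : unitInterval, Traces f ε x y) ∧
    (∀ y : ℕ → unitInterval, IsPseudoOrbit f δ y → AsymptoticPseudoOrbit f y →
      ∃ x : unitInterval, Traces f ε x y ∧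
        Filter.Tendsto (fun n : ℕ => dist (f^[n] x) (y n)) Filter.atTop (𝓝 0))

/-- A non-atomic finite measure on `ℝ` with support exactly `[α, β]`. -/
structure FullOn (μ : Measure ℝ) (α β : ℝ) : Prop where
  finite : IsFiniteMeasure μ
  singleton : ∀ x, μ {x} = 0
  compl : μ (Icc α β)ᶜ = 0
  pos : ∀ u v, α ≤ u → u < v → v ≤ β → 0 < μ (Ioo u v)

/-- `h` is injective on every subinterval of `[s, t]` whose interior avoids `C`. -/
def LapsOn (h : ℝ → ℝ) (C : Set ℝ) (s t : ℝ) : Prop :=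
  ∀ ⦃a b : ℝ⦄, s ≤ a → b ≤ t → Disjoint (Ioo a b) C → InjOn h (Icc a b)

/-- `h` is continuous, piecewise injective on `[s, t]`, and pushes Lebesgue measure on `[s, t]`
to `ν`. -/
structure Seg (h : ℝ → ℝ) (s t : ℝ) (ν : Measure ℝ) : Prop where
  le : s ≤ t
  cont : Continuous h
  map : (volume.restrict (Ioc s t)).map h = ν
  laps : ∃ C : Set ℝ, C.Finite ∧ LapsOn h C s t

theorem continuous_measureReal_Iic {μ : Measure ℝ} [IsFiniteMeasure μ]
    (hμ : ∀ x, μ {x} = 0) : Continuous fun v => μ.real (Iic v) := by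
  have : NullSingletonClass μ := ⟨hμ⟩
  rw [continuous_iff_continuousAt]
  intro v
  have h1 : Tendsto (fun w : ℝ => |w - v|) (𝓝 v) (𝓝 0) := by
    have : Continuous fun w : ℝ => |w - v| := by fun_prop
    simpa using this.tendsto v
  have h2 := (ENNReal.tendsto_toReal ENNReal.zero_ne_top).comp
    ((tendsto_measure_Icc μ v).comp h1)
  rw [ContinuousAt, tendsto_iff_dist_tendsto_zero]
  refine squeeze_zero (fun _ => dist_nonneg) (fun w => ?_) h2
  have key : ∀ a b : ℝ, a ≤ b → μ.real (Iic b) - μ.real (Iic a) = μ.real (Ioc a b) := by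
    intro a b hab
    rw [← Iic_sdiff_Iic, measureReal_sdiff (Iic_subset_Iic.2 hab) measurableSet_Iic]
  have h3 := le_abs_self (w - v)
  have h4 := neg_abs_le (w - v)
  simp only [Function.comp]
  rw [Real.dist_eq]
  change _ ≤ μ.real _
  rcases le_total v w with h | h
  · rw [key v w h, abs_of_nonneg measureReal_nonneg]
    exact measureReal_mono fun x hx => ⟨by linarith [hx.1, abs_nonneg (w - v)], by linarith [hx.2]⟩
  · rw [abs_sub_comm, key w v h, abs_of_nonneg measureReal_nonneg]
    exact measureReal_mono fun x hx => ⟨by linarith [hx.1], by linarith [hx.2, abs_nonneg (w - v)]⟩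

theorem FullOn.exists_increasing {μ : Measure ℝ} {α β : ℝ} (hαβ : α ≤ β) (hμ : FullOn μ α β)
    {s t : ℝ} (ht : t = s + μ.real univ) :
    ∃ h, Seg h s t μ ∧ StrictMonoOn h (Icc s t) ∧ h s = α ∧ h t = β := by
  have := hμ.finite
  set Q : ℝ → ℝ := fun v => s + μ.real (Iic v) with hQ
  have hQc : Continuous Q := continuous_const.add (continuous_measureReal_Iic hμ.singleton)
  have hlow : ∀ v, v ≤ α → μ (Iic v) = 0 := by
    intro v hv
    refine measure_mono_null (t := (Icc α β)ᶜ ∪ {α}) ?_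
      (measure_union_null hμ.compl (hμ.singleton α))
    intro x hx
    by_cases hxa : x = α
    · right; exact hxa
    · left; intro h; exact hxa (le_antisymm (le_trans hx hv) h.1)
  have hhigh : ∀ v, β ≤ v → μ (Iic v) = μ univ := by
    intro v hv
    refine le_antisymm (measure_mono (subset_univ _)) ?_
    calc μ univ ≤ μ (Iic v ∪ (Icc α β)ᶜ) := measure_mono (by
            intro x _
            by_cases hx : x ≤ v
            · left; exact hx
            · right; intro h; exact hx (h.2.trans hv))
      _ ≤ μ (Iic v) + μ (Icc α β)ᶜ := measure_union_le _ _
      _ = μ (Iic v) := by rw [hμ.compl, add_zero]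
  have hQα : Q α = s := by simp [hQ, measureReal_def, hlow α le_rfl]
  have hQβ : Q β = t := by simp [hQ, measureReal_def, hhigh β le_rfl, ht]
  have hQm : StrictMonoOn Q (Icc α β) := by
    intro u hu v hv huv
    have h1 : μ.real (Iic v) = μ.real (Iic u) + μ.real (Ioc u v) := by
      rw [← measureReal_union (by
        rw [Set.disjoint_left]; intro x hx hx'; exact absurd hx'.1 (not_lt.2 hx))
        measurableSet_Ioc, Iic_union_Ioc_eq_Iic huv.le]
    have h2 : 0 < μ.real (Ioc u v) := by
      rw [measureReal_def]
      refine ENNReal.toReal_pos ?_ (measure_ne_top _ _)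
      exact ((hμ.pos u v hu.1 huv hv.2).trans_le (measure_mono Ioo_subset_Ioc_self)).ne'
    simp only [hQ]; linarith
  have hst : s ≤ t := by rw [ht]; linarith [measureReal_nonneg (μ := μ) (s := univ)]
  have hmaps : MapsTo Q (Icc α β) (Icc s t) := by
    intro x hx
    refine ⟨?_, ?_⟩
    · rw [← hQα]; exact hQm.monotoneOn (left_mem_Icc.2 hαβ) hx hx.1
    · rw [← hQβ]; exact hQm.monotoneOn hx (right_mem_Icc.2 hαβ) hx.2
  have hQ'm : StrictMono (hmaps.restrict Q (Icc α β) (Icc s t)) := by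
    intro x y hxy
    exact hQm x.2 y.2 hxy
  have hQ's : Function.Surjective (hmaps.restrict Q (Icc α β) (Icc s t)) := by
    rintro ⟨y, hy⟩
    have := intermediate_value_Icc hαβ hQc.continuousOn
    rw [hQα, hQβ] at this
    obtain ⟨x, hx, hxy⟩ := this hy
    exact ⟨⟨x, hx⟩, Subtype.ext hxy⟩
  set e := StrictMono.orderIsoOfSurjective _ hQ'm hQ's with he
  have hee : ∀ x : Icc α β, (e x : ℝ) = Q x := fun x => rfl
  set h : ℝ → ℝ := IccExtend hst (fun x => (e.symm x : ℝ)) with hh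
  have hc : Continuous h := by
    refine Continuous.Icc_extend' ?_
    exact continuous_subtype_val.comp e.symm.continuous
  have hhx : ∀ x (hx : x ∈ Icc s t), h x = e.symm ⟨x, hx⟩ := fun x hx => IccExtend_of_mem _ _ hx
  have hmono : StrictMonoOn h (Icc s t) := by
    intro x hx y hy hxy
    rw [hhx x hx, hhx y hy]
    exact e.symm.strictMono hxy
  have hgal : ∀ x (hx : x ∈ Icc s t) v (hv : v ∈ Icc α β), h x ≤ v ↔ x ≤ Q v := by
    intro x hx v hv
    rw [hhx x hx]
    have := e.symm_apply_le (x := ⟨v, hv⟩) (y := ⟨x, hx⟩)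
    simpa [← Subtype.coe_le_coe, hee] using this
  have hmem : ∀ x ∈ Icc s t, h x ∈ Icc α β := fun x hx => by
    rw [hhx x hx]; exact (e.symm _).2
  refine ⟨h, ⟨hst, hc, ?_, ∅, finite_empty, fun a b ha hb _ =>
    hmono.injOn.mono (Icc_subset_Icc ha hb)⟩, hmono, ?_, ?_⟩
  · rw [restrict_Ioc_eq_restrict_Icc]
    refine Measure.ext_of_Iic _ _ fun v => ?_
    rw [Measure.map_apply hc.measurable measurableSet_Iic,
      Measure.restrict_apply (hc.measurable measurableSet_Iic)]
    rcases lt_or_ge v α with hv | hv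
    · rw [hlow v hv.le, show h ⁻¹' Iic v ∩ Icc s t = ∅ from ?_, measure_empty]
      rw [eq_empty_iff_forall_notMem]
      rintro x ⟨hx, hx'⟩
      exact absurd ((hmem x hx').1.trans hx) (not_le.2 hv)
    rcases lt_or_ge β v with hv' | hv'
    · rw [hhigh v hv'.le, show h ⁻¹' Iic v ∩ Icc s t = Icc s t from ?_, Real.volume_Icc, ht,
        add_sub_cancel_left, ofReal_measureReal]
      exact inter_eq_right.2 fun x hx => (hmem x hx).2.trans hv'.le
    · rw [show h ⁻¹' Iic v ∩ Icc s t = Icc s (Q v) from ?_, Real.volume_Icc]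
      · simp only [hQ]
        rw [add_sub_cancel_left, ofReal_measureReal]
      · have hQv := hmaps ⟨hv, hv'⟩
        ext x
        constructor
        · rintro ⟨hx, hx'⟩
          exact ⟨hx'.1, (hgal x hx' v ⟨hv, hv'⟩).1 hx⟩
        · intro hx
          have hx' : x ∈ Icc s t := ⟨hx.1, hx.2.trans hQv.2⟩
          exact ⟨(hgal x hx' v ⟨hv, hv'⟩).2 hx.2, hx'⟩
  · refine le_antisymm ?_ (hmem s (left_mem_Icc.2 hst)).1
    exact (hgal s (left_mem_Icc.2 hst) α (left_mem_Icc.2 hαβ)).2 hQα.ge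
  · refine le_antisymm (hmem t (right_mem_Icc.2 hst)).2 ?_
    by_contra hlt
    push Not at hlt
    have := hQm (hmem t (right_mem_Icc.2 hst)) (right_mem_Icc.2 hαβ) hlt
    rw [hQβ] at this
    exact absurd ((hgal t (right_mem_Icc.2 hst) _ (hmem t (right_mem_Icc.2 hst))).1 le_rfl)
      (not_le.2 this)

theorem map_sub_left_restrict_Ioc (s t : ℝ) :
    (volume.restrict (Ioc s t)).map (fun x => s + t - x) = volume.restrict (Ioc s t) := by
  have h1 : MeasurePreserving (fun x : ℝ => s + t - x) volume volume :=
    Measure.measurePreserving_sub_left volume (s + t)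
  have h2 := (h1.restrict_preimage (measurableSet_Ioc (a := s) (b := t))).map_eq
  have h3 : (fun x : ℝ => s + t - x) ⁻¹' Ioc s t = Ico s t := by
    ext x; simp only [mem_preimage, mem_Ioc, mem_Ico]; constructor <;> rintro ⟨h, h'⟩ <;>
      constructor <;> linarith
  rw [h3, restrict_Ico_eq_restrict_Ioc] at h2
  exact h2

theorem FullOn.exists_decreasing {μ : Measure ℝ} {α β : ℝ} (hαβ : α ≤ β) (hμ : FullOn μ α β)
    {s t : ℝ} (ht : t = s + μ.real univ) :
    ∃ h, Seg h s t μ ∧ StrictAntiOn h (Icc s t) ∧ h s = β ∧ h t = α := by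
  obtain ⟨h, hS, hm, h1, h2⟩ := hμ.exists_increasing hαβ ht
  have hanti : StrictAntiOn (fun x => h (s + t - x)) (Icc s t) := by
    intro x hx y hy hxy
    exact hm ⟨by linarith [hy.2], by linarith [hy.1]⟩ ⟨by linarith [hx.2], by linarith [hx.1]⟩
      (by linarith)
  refine ⟨fun x => h (s + t - x), ⟨hS.le, hS.cont.comp (by fun_prop), ?_, ∅, finite_empty,
    fun a b ha hb _ => hanti.injOn.mono (Icc_subset_Icc ha hb)⟩, hanti, by simp [h2], by simp [h1]⟩
  rw [← hS.map]
  conv_rhs => rw [← map_sub_left_restrict_Ioc s t]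
  rw [Measure.map_map hS.cont.measurable (by fun_prop)]
  rfl

/-- The function equal to `h₁` on `(-∞, t]` and to `h₂` on `(t, ∞)`. -/
def glue (t : ℝ) (h₁ h₂ : ℝ → ℝ) : ℝ → ℝ := fun x => if x ≤ t then h₁ x else h₂ x

theorem glue_of_le {t x : ℝ} {h₁ h₂ : ℝ → ℝ} (hx : x ≤ t) : glue t h₁ h₂ x = h₁ x := if_pos hx

theorem glue_of_ge {t x : ℝ} {h₁ h₂ : ℝ → ℝ} (h : h₁ t = h₂ t) (hx : t ≤ x) :
    glue t h₁ h₂ x = h₂ x := by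
  rcases hx.eq_or_lt with rfl | hx
  · rw [glue_of_le le_rfl, h]
  · exact if_neg (not_le.2 hx)

theorem LapsOn.mono {h : ℝ → ℝ} {C D : Set ℝ} {s t : ℝ} (hC : LapsOn h C s t) (hCD : C ⊆ D) :
    LapsOn h D s t := fun _ _ ha hb hd => hC ha hb (hd.mono_right hCD)

theorem Seg.glue {h₁ h₂ : ℝ → ℝ} {s t u : ℝ} {ν₁ ν₂ : Measure ℝ} (H₁ : Seg h₁ s t ν₁)
    (H₂ : Seg h₂ t u ν₂) (h : h₁ t = h₂ t) : Seg (glue t h₁ h₂) s u (ν₁ + ν₂) := by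
  have hc : Continuous (_root_.glue t h₁ h₂) :=
    Continuous.if_le H₁.cont H₂.cont continuous_id continuous_const (by rintro x rfl; exact h)
  refine ⟨H₁.le.trans H₂.le, hc, ?_, ?_⟩
  · rw [← Ioc_union_Ioc_eq_Ioc H₁.le H₂.le, Measure.restrict_union
      (Ioc_disjoint_Ioc_of_le le_rfl) measurableSet_Ioc, Measure.map_add _ _ hc.measurable,
      ← H₁.map, ← H₂.map]
    congr 1
    · refine Measure.map_congr ?_
      filter_upwards [ae_restrict_mem measurableSet_Ioc] with x hx using glue_of_le hx.2
    · refine Measure.map_congr ?_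
      filter_upwards [ae_restrict_mem measurableSet_Ioc] with x hx using glue_of_ge h hx.1.le
  · obtain ⟨C₁, hf₁, hC₁⟩ := H₁.laps
    obtain ⟨C₂, hf₂, hC₂⟩ := H₂.laps
    refine ⟨C₁ ∪ C₂ ∪ {t}, (hf₁.union hf₂).union (finite_singleton t), ?_⟩
    intro a b ha hb hd
    simp only [disjoint_union_right, disjoint_singleton_right] at hd
    obtain ⟨⟨hd₁, hd₂⟩, hdt⟩ := hd
    by_cases hbt : b ≤ t
    · refine (hC₁ ha hbt hd₁).congr fun x hx => ?_
      exact (glue_of_le (hx.2.trans hbt)).symm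
    · have hta : t ≤ a := by
        by_contra hta
        exact hdt ⟨not_le.1 hta, not_le.1 hbt⟩
      refine (hC₂ hta hb hd₂).congr fun x hx => ?_
      exact (glue_of_ge h (hta.trans hx.1)).symm

theorem FullOn.of_le {μ ν : Measure ℝ} {α β : ℝ} (hν : FullOn ν α β) {c : ENNReal} (hc : c ≠ 0)
    (h₁ : c • ν ≤ μ) (h₂ : μ ≤ ν) : FullOn μ α β where
  finite := have := hν.finite; isFiniteMeasure_of_le ν h₂
  singleton x := le_antisymm ((h₂ {x}).trans (hν.singleton x).le) bot_le
  compl := le_antisymm ((h₂ _).trans hν.compl.le) bot_le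
  pos u v hu huv hv := by
    refine lt_of_lt_of_le ?_ (h₁ _)
    rw [Measure.smul_apply, smul_eq_mul]
    exact ENNReal.mul_pos hc (hν.pos u v hu huv hv).ne'

theorem FullOn.smul_restrict_Iic {ν : Measure ℝ} {α β p : ℝ} (hν : FullOn ν α β)
    (hp : p ≤ β) {c : ENNReal} (hc : c ≠ 0) (hc' : c ≠ ⊤) :
    FullOn (c • ν.restrict (Iic p)) α p where
  finite := have := hν.finite; Measure.smul_finite _ hc'
  singleton x := by
    have h := (Measure.restrict_apply_le (μ := ν) (Iic p) {x}).trans (hν.singleton x).le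
    simp [le_antisymm h bot_le]
  compl := by
    have h : ν.restrict (Iic p) (Icc α p)ᶜ = 0 := by
      rw [Measure.restrict_apply measurableSet_Icc.compl]
      refine measure_mono_null ?_ hν.compl
      rintro x ⟨hx, hx'⟩ hx''
      exact hx ⟨hx''.1, hx'⟩
    simp [h]
  pos u v hu huv hv := by
    rw [Measure.smul_apply, smul_eq_mul, Measure.restrict_apply measurableSet_Ioo,
      inter_eq_left.2 fun x hx => hx.2.le.trans hv]
    exact ENNReal.mul_pos hc (hν.pos u v hu huv (hv.trans hp)).ne'

theorem Seg.mapsTo {h : ℝ → ℝ} {s t : ℝ} {ν : Measure ℝ} (H : Seg h s t ν) (hst : s < t)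
    {K : Set ℝ} (hK : IsClosed K) (hν : ν Kᶜ = 0) : MapsTo h (Icc s t) K := by
  intro x hx
  by_contra hxK
  have hO : IsOpen (h ⁻¹' Kᶜ) := hK.isOpen_compl.preimage H.cont
  rw [← closure_Ioo hst.ne] at hx
  obtain ⟨y, hy, hy'⟩ := mem_closure_iff.1 hx _ hO hxK
  have hpos := (hO.inter isOpen_Ioo).measure_pos volume ⟨y, hy, hy'⟩
  rw [← H.map, Measure.map_apply H.cont.measurable hK.measurableSet.compl,
    Measure.restrict_apply hO.measurableSet] at hν
  exact hpos.ne' (measure_mono_null (inter_subset_inter_right _ Ioo_subset_Ioc_self) hν)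

/-- A non-atomic measure with full support on `[α, β]` is the image of Lebesgue measure under a
four-lap path `p ↘ α ↗ β ↘ α ↗ q`. -/
theorem FullOn.exists_four_laps {ν : Measure ℝ} {α β p q s t : ℝ} (hν : FullOn ν α β)
    (hαβ : α < β) (hp : p ∈ Icc α β) (hq : q ∈ Icc α β) (ht : t = s + ν.real univ) :
    ∃ h, Seg h s t ν ∧ h s = p ∧ h t = q ∧
      ∀ v ∈ Ico α β, ∃ u ∈ Icc s t, ∃ u' ∈ Icc s t, u ≠ u' ∧ h u = v ∧ h u' = v := by
  have hfin := hν.finite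
  set c : ENNReal := 4⁻¹ with hc
  have hc0 : c ≠ 0 := by simp [hc]
  have hct : c ≠ ⊤ := by simp [hc]
  have h4 : c • ν + c • ν + c • ν + c • ν = ν := by
    rw [← add_smul, ← add_smul, ← add_smul]
    have : c + c + c + c = 1 := by
      rw [show c + c + c + c = 4 * c by ring, hc, ENNReal.mul_inv_cancel (by simp) (by simp)]
    rw [this, one_smul]
  have hsplit : ∀ r, c • ν.restrict (Iic r) + c • ν.restrict (Ioi r) = c • ν := by
    intro r
    rw [← smul_add, ← compl_Iic, Measure.restrict_add_restrict_compl measurableSet_Iic]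
  set μ₁ := c • ν.restrict (Iic p) with hμ₁
  set μ₂ := c • ν + c • ν.restrict (Ioi p) with hμ₂
  set μ₃ := c • ν + c • ν.restrict (Ioi q) with hμ₃
  set μ₄ := c • ν.restrict (Iic q) with hμ₄
  have hsum : μ₁ + μ₂ + μ₃ + μ₄ = ν := by
    calc μ₁ + μ₂ + μ₃ + μ₄
        = (c • ν.restrict (Iic p) + c • ν.restrict (Ioi p)) +
          (c • ν.restrict (Iic q) + c • ν.restrict (Ioi q)) + c • ν + c • ν := by
          simp only [hμ₁, hμ₂, hμ₃, hμ₄]; abel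
      _ = ν := by rw [hsplit, hsplit, h4]
  have hle : ∀ r, c • ν + c • ν.restrict (Ioi r) ≤ ν := by
    intro r
    have hr : c • ν.restrict (Ioi r) ≤ c • ν := Measure.le_iff'.2 fun A => by
      simp only [Measure.smul_apply, smul_eq_mul]
      exact mul_le_mul_right (Measure.restrict_apply_le _ _) _
    calc c • ν + c • ν.restrict (Ioi r) ≤ c • ν + c • ν := add_le_add le_rfl hr
      _ ≤ c • ν + c • ν + (c • ν + c • ν) := Measure.le_add_right le_rfl
      _ = ν := by rw [← add_assoc, h4]
  have F₁ : FullOn μ₁ α p := hν.smul_restrict_Iic hp.2 hc0 hct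
  have F₄ : FullOn μ₄ α q := hν.smul_restrict_Iic hq.2 hc0 hct
  have F₂ : FullOn μ₂ α β := hν.of_le hc0 (Measure.le_add_right le_rfl) (hle p)
  have F₃ : FullOn μ₃ α β := hν.of_le hc0 (Measure.le_add_right le_rfl) (hle q)
  have f₁ := F₁.finite
  have f₂ := F₂.finite
  have f₃ := F₃.finite
  have f₄ := F₄.finite
  obtain ⟨h₁, S₁, -, hs₁, ht₁⟩ := F₁.exists_decreasing hp.1 (s := s) rfl
  obtain ⟨h₂, S₂, -, hs₂, ht₂⟩ := F₂.exists_increasing hαβ.le (s := s + μ₁.real univ) rfl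
  obtain ⟨h₃, S₃, m₃, hs₃, ht₃⟩ := F₃.exists_decreasing hαβ.le
    (s := s + μ₁.real univ + μ₂.real univ) rfl
  obtain ⟨h₄, S₄, -, hs₄, ht₄⟩ := F₄.exists_increasing hq.1
    (s := s + μ₁.real univ + μ₂.real univ + μ₃.real univ) rfl
  have htot : s + μ₁.real univ + μ₂.real univ + μ₃.real univ + μ₄.real univ = t := by
    rw [ht, ← hsum, measureReal_add_apply (μ₁ := μ₁ + μ₂ + μ₃) (μ₂ := μ₄),
      measureReal_add_apply (μ₁ := μ₁ + μ₂) (μ₂ := μ₃), measureReal_add_apply (μ₁ := μ₁) (μ₂ := μ₂)]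
    ring
  rw [htot] at S₄ ht₄
  set t₁ := s + μ₁.real univ
  set t₂ := t₁ + μ₂.real univ
  set t₃ := t₂ + μ₃.real univ
  have e₁ : h₁ t₁ = h₂ t₁ := by rw [ht₁, hs₂]
  have S₁₂ := S₁.glue S₂ e₁
  have e₂ : glue t₁ h₁ h₂ t₂ = h₃ t₂ := by rw [glue_of_ge e₁ S₂.le, ht₂, hs₃]
  have S₁₃ := S₁₂.glue S₃ e₂
  have e₃ : glue t₂ (glue t₁ h₁ h₂) h₃ t₃ = h₄ t₃ := by rw [glue_of_ge e₂ S₃.le, ht₃, hs₄]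
  have S := S₁₃.glue S₄ e₃
  rw [hsum] at S
  have g₂ : ∀ x, t₁ ≤ x → x ≤ t₂ → glue t₃ (glue t₂ (glue t₁ h₁ h₂) h₃) h₄ x = h₂ x := by
    intro x hx hx'
    rw [glue_of_le (hx'.trans S₃.le), glue_of_le hx', glue_of_ge e₁ hx]
  have g₃ : ∀ x, t₂ ≤ x → x ≤ t₃ → glue t₃ (glue t₂ (glue t₁ h₁ h₂) h₃) h₄ x = h₃ x := by
    intro x hx hx'
    rw [glue_of_le hx', glue_of_ge e₂ hx]
  refine ⟨_, S, ?_, ?_, ?_⟩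
  · rw [glue_of_le (S₁.le.trans (S₂.le.trans S₃.le)), glue_of_le (S₁.le.trans S₂.le),
      glue_of_le S₁.le, hs₁]
  · rw [glue_of_ge e₃ S₄.le, ht₄]
  · intro v hv
    obtain ⟨u, hu, huv⟩ := intermediate_value_Icc S₂.le S₂.cont.continuousOn
      (by rw [hs₂, ht₂]; exact ⟨hv.1, hv.2.le⟩ : v ∈ Icc (h₂ t₁) (h₂ t₂))
    obtain ⟨u', hu', huv'⟩ := intermediate_value_Icc' S₃.le S₃.cont.continuousOn
      (by rw [hs₃, ht₃]; exact ⟨hv.1, hv.2.le⟩ : v ∈ Icc (h₃ t₃) (h₃ t₂))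
    refine ⟨u, ⟨S₁.le.trans hu.1, hu.2.trans (S₃.le.trans S₄.le)⟩, u',
      ⟨S₁.le.trans (S₂.le.trans hu'.1), hu'.2.trans S₄.le⟩, ?_, ?_, ?_⟩
    · rintro rfl
      have : u = t₂ := le_antisymm hu.2 hu'.1
      rw [this, ht₂] at huv
      exact hv.2.ne huv.symm
    · rw [g₂ u hu.1 hu.2, huv]
    · rw [g₃ u' hu'.1 hu'.2, huv']

/-- `f` restricts to a continuous Lebesgue-measure-preserving self-map of `[0, 1]`. -/
structure LebMap (f : ℝ → ℝ) : Prop where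
  cont : Continuous f
  mapsTo : MapsTo f (Icc 0 1) (Icc 0 1)
  map : (volume.restrict (Icc 0 1)).map f = volume.restrict (Icc 0 1)

/-- The values that `h` takes at most once on `[s, t]`. -/
def simpleValues (h : ℝ → ℝ) (s t : ℝ) : Set ℝ :=
  {v | ∀ u ∈ Icc s t, ∀ u' ∈ Icc s t, h u = v → h u' = v → u = u'}

theorem LebMap.volume_preimage {f : ℝ → ℝ} (hf : LebMap f) {A : Set ℝ} (hA : MeasurableSet A) :
    volume (f ⁻¹' A ∩ Icc 0 1) = volume (A ∩ Icc 0 1) := by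
  rw [← Measure.restrict_apply (hf.cont.measurable hA), ← Measure.map_apply hf.cont.measurable hA,
    hf.map, Measure.restrict_apply hA]

theorem measure_inter_Ioo_pos {O : Set ℝ} (hO : IsOpen O) {s t x : ℝ} (hst : s < t)
    (hx : x ∈ Icc s t) (hxO : x ∈ O) : 0 < volume (O ∩ Ioo s t) := by
  rw [← closure_Ioo hst.ne] at hx
  obtain ⟨y, hy, hy'⟩ := mem_closure_iff.1 hx _ hO hxO
  exact (hO.inter isOpen_Ioo).measure_pos volume ⟨y, hy, hy'⟩

theorem LebMap.surjOn {f : ℝ → ℝ} (hf : LebMap f) : SurjOn f (Icc 0 1) (Icc 0 1) := by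
  intro v hv
  by_contra hvf
  have hcl : IsClosed (f '' Icc 0 1) := (isCompact_Icc.image hf.cont).isClosed
  have hpos := measure_inter_Ioo_pos hcl.isOpen_compl zero_lt_one hv hvf
  have h0 := hf.volume_preimage hcl.measurableSet.compl
  rw [show f ⁻¹' (f '' Icc 0 1)ᶜ ∩ Icc 0 1 = ∅ from ?_, measure_empty] at h0
  · exact hpos.ne' (measure_mono_null (inter_subset_inter_right _ Ioo_subset_Icc_self) h0.symm)
  · rw [eq_empty_iff_forall_notMem]
    rintro x ⟨hx, hx'⟩
    exact hx (mem_image_of_mem f hx')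

theorem LebMap.exists_rearrangement {f : ℝ → ℝ} (hf : LebMap f) {s t : ℝ} (hs : 0 ≤ s)
    (hst : s < t) (ht : t ≤ 1) :
    ∃ h, Seg h s t ((volume.restrict (Ioc s t)).map f) ∧ h s = f s ∧ h t = f t ∧
      MapsTo h (Icc s t) (f '' Icc s t) ∧ (f '' Icc s t ∩ simpleValues h s t).Finite ∧
      ¬ InjOn h (Icc s t) := by
  have hsub : Icc s t ⊆ Icc 0 1 := Icc_subset_Icc hs ht
  obtain ⟨α, β, hα⟩ : ∃ α β, f '' Icc s t = Icc α β :=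
    ⟨_, _, hf.cont.continuousOn.image_Icc hst.le⟩
  have hfs : f s ∈ Icc α β := hα ▸ mem_image_of_mem f (left_mem_Icc.2 hst.le)
  have hft : f t ∈ Icc α β := hα ▸ mem_image_of_mem f (right_mem_Icc.2 hst.le)
  have hfx : ∀ x ∈ Icc s t, f x ∈ Icc α β := fun x hx => hα ▸ mem_image_of_mem f hx
  set ν := (volume.restrict (Ioc s t)).map f with hν
  have hνA : ∀ A, MeasurableSet A → ν A = volume (f ⁻¹' A ∩ Ioc s t) := fun A hA => by
    rw [hν, Measure.map_apply hf.cont.measurable hA,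
      Measure.restrict_apply (hf.cont.measurable hA)]
  have hsing : ∀ x, ν {x} = 0 := by
    intro x
    rw [hνA _ (measurableSet_singleton x)]
    refine measure_mono_null (inter_subset_inter_right _ (Ioc_subset_Icc_self.trans hsub)) ?_
    rw [hf.volume_preimage (measurableSet_singleton x)]
    exact measure_mono_null inter_subset_left (by simp)
  have hcompl : ν (Icc α β)ᶜ = 0 := by
    rw [hνA _ measurableSet_Icc.compl]
    convert measure_empty (μ := volume (α := ℝ))
    rw [eq_empty_iff_forall_notMem]
    rintro x ⟨hx, hx'⟩
    exact hx (hfx x (Ioc_subset_Icc_self hx'))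
  have huniv : ν univ = ENNReal.ofReal (t - s) := by
    rw [hνA _ MeasurableSet.univ]; simp
  have hαβ : α < β := by
    refine lt_of_le_of_ne (hfs.1.trans hfs.2) ?_
    rintro rfl
    have h0 : ν univ = 0 := by
      rw [← union_compl_self (Icc α α)]
      refine measure_union_null ?_ hcompl
      rw [Icc_self]; exact hsing α
    rw [huniv, ENNReal.ofReal_eq_zero] at h0
    linarith
  have hfull : FullOn ν α β := by
    refine ⟨⟨by rw [huniv]; exact ENNReal.ofReal_lt_top⟩, hsing, hcompl, ?_⟩
    intro u v hu huv hv
    obtain ⟨w, hw⟩ := exists_between huv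
    obtain ⟨x, hx, hxw⟩ : w ∈ f '' Icc s t := by
      rw [hα]; exact ⟨hu.trans hw.1.le, hw.2.le.trans hv⟩
    rw [hνA _ measurableSet_Ioo]
    refine (measure_inter_Ioo_pos (isOpen_Ioo.preimage hf.cont) hst hx ?_).trans_le
      (measure_mono (inter_subset_inter_right _ Ioo_subset_Ioc_self))
    rw [mem_preimage, hxw]; exact hw
  have htν : t = s + ν.real univ := by
    rw [measureReal_def, huniv, ENNReal.toReal_ofReal (by linarith)]; ring
  obtain ⟨h, S, h1, h2, h3⟩ := hfull.exists_four_laps hαβ hfs hft htν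
  refine ⟨h, S, h1, h2, ?_, ?_, ?_⟩
  · rw [hα]; exact S.mapsTo hst isClosed_Icc hcompl
  · refine (finite_singleton β).subset ?_
    rintro v ⟨hv, hv'⟩
    rw [hα] at hv
    by_contra hvβ
    obtain ⟨u, hu, u', hu', hne, e1, e2⟩ := h3 v ⟨hv.1, lt_of_le_of_ne hv.2 hvβ⟩
    exact hne (hv' u hu u' hu' e1 e2)
  · intro hinj
    obtain ⟨u, hu, u', hu', hne, e1, e2⟩ := h3 α ⟨le_rfl, hαβ⟩
    exact hne (hinj hu hu' (e1.trans e2.symm))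

theorem LebMap.exists_partial_lap_approx {f : ℝ → ℝ} (hf : LebMap f) {N : ℕ} (hN : 0 < N) (k : ℕ)
    (hk : k ≤ N) :
    ∃ h, Seg h 0 (k / N) ((volume.restrict (Ioc 0 (k / N : ℝ))).map f) ∧
      h (k / N) = f (k / N) ∧
      (∀ x ∈ Icc (0 : ℝ) (k / N), ∃ y ∈ Icc (0 : ℝ) 1, |x - y| ≤ 1 / N ∧ h x = f y) ∧
      (f '' Icc 0 (k / N : ℝ) ∩ simpleValues h 0 (k / N)).Finite ∧
      ∀ i < k, ¬ InjOn h (Icc (i / N) ((i + 1) / N)) := by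
  have hN' : (0 : ℝ) < N := by exact_mod_cast hN
  induction k with
  | zero =>
    refine ⟨f, ⟨by simp, hf.cont, by simp, ∅, finite_empty, ?_⟩, rfl, ?_, ?_, by simp⟩
    · intro a b ha hb _
      simp only [CharP.cast_eq_zero, zero_div] at hb
      refine Subsingleton.injOn ?_ _
      exact (subsingleton_Icc_of_ge (α := ℝ) (by linarith))
    · intro x hx
      simp only [CharP.cast_eq_zero, zero_div, Icc_self, mem_singleton_iff] at hx
      exact ⟨0, by simp, by simp [hx], by rw [hx]⟩
    · refine (finite_singleton (f 0)).subset ?_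
      rintro v ⟨hv, -⟩
      simpa using hv
  | succ k ih =>
    obtain ⟨h, S, h1, h2, h3, h4⟩ := ih (by omega)
    have hlt : (k : ℝ) / N < ((k + 1 : ℕ) : ℝ) / N := by
      gcongr; simp
    have h0 : (0 : ℝ) ≤ k / N := by positivity
    have hle : ((k + 1 : ℕ) : ℝ) / N ≤ 1 := by
      rw [div_le_one hN']; exact_mod_cast hk
    obtain ⟨g, T, g1, g2, g3, g4, g5⟩ := hf.exists_rearrangement h0 hlt hle
    have e : h (k / N) = g (k / N) := by rw [h1, g1]
    have hlen : ((k + 1 : ℕ) : ℝ) / N - k / N = 1 / N := by push_cast; ring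
    refine ⟨glue (k / N) h g, ?_, ?_, ?_, ?_, ?_⟩
    · convert S.glue T e using 1
      rw [← Measure.map_add _ _ hf.cont.measurable, ← Measure.restrict_union
        (Ioc_disjoint_Ioc_of_le le_rfl) measurableSet_Ioc, Ioc_union_Ioc_eq_Ioc h0 hlt.le]
    · rw [glue_of_ge e hlt.le, g2]
    · intro x hx
      rcases le_total x (k / N) with hxk | hxk
      · rw [glue_of_le hxk]; exact h2 x ⟨hx.1, hxk⟩
      · rw [glue_of_ge e hxk]
        obtain ⟨y, hy, hyx⟩ := g3 ⟨hxk, hx.2⟩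
        refine ⟨y, ⟨h0.trans hy.1, hy.2.trans hle⟩, ?_, hyx.symm⟩
        rw [abs_le]; constructor <;> linarith [hy.1, hy.2, hx.2]
    · refine (h3.union g4).subset ?_
      rintro v ⟨⟨x, hx, rfl⟩, hv⟩
      rcases le_total x (k / N) with hxk | hxk
      · left
        refine ⟨⟨x, ⟨hx.1, hxk⟩, rfl⟩, fun u hu u' hu' e1 e2 => ?_⟩
        exact hv u ⟨hu.1, hu.2.trans hlt.le⟩ u' ⟨hu'.1, hu'.2.trans hlt.le⟩
          (by rw [glue_of_le hu.2, e1]) (by rw [glue_of_le hu'.2, e2])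
      · right
        refine ⟨⟨x, ⟨hxk, hx.2⟩, rfl⟩, fun u hu u' hu' e1 e2 => ?_⟩
        exact hv u ⟨h0.trans hu.1, hu.2⟩ u' ⟨h0.trans hu'.1, hu'.2⟩
          (by rw [glue_of_ge e hu.1, e1]) (by rw [glue_of_ge e hu'.1, e2])
    · intro i hi hinj
      rcases Nat.lt_succ_iff_lt_or_eq.1 hi with hi | rfl
      · refine h4 i hi (hinj.congr fun x hx => glue_of_le (hx.2.trans ?_))
        gcongr; exact_mod_cast hi
      · refine g5 ((hinj.mono ?_).congr fun x hx => glue_of_ge e hx.1)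
        push_cast; exact subset_rfl

/-- A measure-preserving map is uniformly approximated by piecewise injective
measure-preserving maps that are injective on no interval of length `2 / N` and take all but
finitely many values at least twice. -/
theorem LebMap.exists_lap_approx {f : ℝ → ℝ} (hf : LebMap f) {N : ℕ} (hN : 0 < N) :
    ∃ h C, LebMap h ∧ C.Finite ∧ LapsOn h C 0 1 ∧
      (∀ x ∈ Icc (0 : ℝ) 1, ∃ y ∈ Icc (0 : ℝ) 1, |x - y| ≤ 1 / N ∧ h x = f y) ∧
      (Icc 0 1 ∩ simpleValues h 0 1).Finite ∧
      ∀ a b : ℝ, 0 ≤ a → b ≤ 1 → InjOn h (Icc a b) → b - a ≤ 2 / N := by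
  have hN' : (0 : ℝ) < N := by exact_mod_cast hN
  obtain ⟨h, S, h1, h2, h3, h4⟩ := hf.exists_partial_lap_approx hN N le_rfl
  rw [div_self hN'.ne'] at S h1 h2 h3
  obtain ⟨C, hC, hl⟩ := S.laps
  refine ⟨h, C, ⟨S.cont, ?_, ?_⟩, hC, hl, h2, h3.subset (inter_subset_inter_left _ hf.surjOn), ?_⟩
  · intro x hx
    obtain ⟨y, hy, -, hxy⟩ := h2 x hx
    rw [hxy]; exact hf.mapsTo hy
  · rw [← restrict_Ioc_eq_restrict_Icc, S.map, restrict_Ioc_eq_restrict_Icc, hf.map]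
  · intro a b ha hb hinj
    by_contra! hlt
    set i := ⌈a * N⌉₊ with hi
    have hi1 : a * N ≤ i := Nat.le_ceil _
    have hi2 : (i : ℝ) < a * N + 1 := Nat.ceil_lt_add_one (by positivity)
    have e1 : a ≤ i / N := by rw [le_div_iff₀ hN']; exact hi1
    have e2 : ((i : ℝ) + 1) / N ≤ b := by
      rw [div_le_iff₀ hN']
      rw [div_lt_iff₀ hN'] at hlt
      nlinarith
    have e3 : i < N := by
      have : ((i : ℝ) + 1) / N ≤ 1 := e2.trans hb
      rw [div_le_one hN'] at this
      exact_mod_cast (by linarith : (i : ℝ) < N)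
    exact h4 i e3 (hinj.mono (Icc_subset_Icc e1 e2))

theorem exists_gap {C : Set ℝ} (hC : C.Finite) (h0 : (0 : ℝ) ∈ C) (h1 : (1 : ℝ) ∈ C) :
    ∃ ρ > 0, ∀ c ∈ C, ∀ c' ∈ C, c ≠ c' → ρ ≤ |c - c'| :=
  ⟨C.infsep, hC.infsep_pos_iff_nontrivial.2 ⟨0, h0, 1, h1, zero_ne_one⟩,
    fun _ hc _ hc' hne => infsep_le_dist_of_mem hc hc' hne⟩

theorem LapsOn.sdiff_singleton {g : ℝ → ℝ} {C : Set ℝ} {c : ℝ} (hg : Continuous g)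
    (hl : LapsOn g C 0 1) (hc : ¬ IsLocalExtrOn g (Icc 0 1) c) : LapsOn g (C \ {c}) 0 1 := by
  intro a b ha hb hd
  by_cases hcab : c ∈ Ioo a b
  · have hd' : ∀ x ∈ Ioo a b, x ≠ c → x ∉ C := fun x hx hxc hxC =>
      disjoint_left.1 hd hx ⟨hxC, hxc⟩
    have i₁ : InjOn g (Icc a c) := hl ha (hcab.2.le.trans hb) <|
      disjoint_left.2 fun x hx => hd' x ⟨hx.1, hx.2.trans hcab.2⟩ hx.2.ne
    have i₂ : InjOn g (Icc c b) := hl (ha.trans hcab.1.le) hb <|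
      disjoint_left.2 fun x hx => hd' x ⟨hcab.1.trans hx.1, hx.2⟩ hx.1.ne'
    have hgr : IsGreatest (Icc a c) c := isGreatest_Icc hcab.1.le
    have hle : IsLeast (Icc c b) c := isLeast_Icc hcab.2.le
    have hnhds : Ioo a b ∈ 𝓝 c := Ioo_mem_nhds hcab.1 hcab.2
    have hu : Icc a c ∪ Icc c b = Icc a b := Icc_union_Icc_eq_Icc hcab.1.le hcab.2.le
    rcases hg.continuousOn.strictMonoOn_of_injOn_Icc' hcab.1.le i₁ with m₁ | m₁ <;>
    rcases hg.continuousOn.strictMonoOn_of_injOn_Icc' hcab.2.le i₂ with m₂ | m₂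
    · rw [← hu]; exact (m₁.union m₂ hgr hle).injOn
    · refine absurd (Or.inr (IsLocalMax.on ?_ _)) hc
      filter_upwards [hnhds] with x hx
      rcases le_total x c with h | h
      · exact m₁.monotoneOn ⟨hx.1.le, h⟩ hgr.1 h
      · exact m₂.antitoneOn hle.1 ⟨h, hx.2.le⟩ h
    · refine absurd (Or.inl (IsLocalMin.on ?_ _)) hc
      filter_upwards [hnhds] with x hx
      rcases le_total x c with h | h
      · exact m₁.antitoneOn ⟨hx.1.le, h⟩ hgr.1 h
      · exact m₂.monotoneOn hle.1 ⟨h, hx.2.le⟩ h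
    · rw [← hu]; exact (m₁.union m₂ hgr hle).injOn
  · refine hl ha hb (disjoint_left.2 fun x hx hxC => disjoint_left.1 hd hx ⟨hxC, ?_⟩)
    rintro rfl
    exact hcab hx

theorem LapsOn.isLocalExtrOn_zero {g : ℝ → ℝ} {C : Set ℝ} (hg : Continuous g)
    (hl : LapsOn g C 0 1) (hC : C.Finite) (h0 : (0 : ℝ) ∈ C) (h1 : (1 : ℝ) ∈ C) :
    IsLocalExtrOn g (Icc 0 1) 0 := by
  obtain ⟨ρ, hρ, hgap⟩ := exists_gap hC h0 h1
  have hρ1 : ρ ≤ 1 := by simpa using hgap 0 h0 1 h1 zero_ne_one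
  have hd : Disjoint (Ioo 0 ρ) C := disjoint_left.2 fun x hx hxC => by
    have := hgap x hxC 0 h0 hx.1.ne'
    rw [sub_zero, abs_of_pos hx.1] at this
    exact absurd hx.2 (not_lt.2 this)
  have hn : ∀ᶠ x in 𝓝[Icc (0 : ℝ) 1] 0, x ∈ Icc 0 ρ := by
    filter_upwards [self_mem_nhdsWithin, mem_nhdsWithin_of_mem_nhds (Iio_mem_nhds hρ)]
      with x hx hx' using ⟨hx.1, le_of_lt hx'⟩
  rcases hg.continuousOn.strictMonoOn_of_injOn_Icc' hρ.le (hl le_rfl hρ1 hd) with m | m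
  · left; filter_upwards [hn] with x hx using m.monotoneOn (left_mem_Icc.2 hρ.le) hx hx.1
  · right; filter_upwards [hn] with x hx using m.antitoneOn (left_mem_Icc.2 hρ.le) hx hx.1

theorem LapsOn.isLocalExtrOn_one {g : ℝ → ℝ} {C : Set ℝ} (hg : Continuous g)
    (hl : LapsOn g C 0 1) (hC : C.Finite) (h0 : (0 : ℝ) ∈ C) (h1 : (1 : ℝ) ∈ C) :
    IsLocalExtrOn g (Icc 0 1) 1 := by
  obtain ⟨ρ, hρ, hgap⟩ := exists_gap hC h0 h1
  have hρ1 : ρ ≤ 1 := by simpa using hgap 0 h0 1 h1 zero_ne_one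
  have hd : Disjoint (Ioo (1 - ρ) 1) C := disjoint_left.2 fun x hx hxC => by
    have := hgap x hxC 1 h1 hx.2.ne
    rw [abs_sub_comm, abs_of_pos (by linarith [hx.2])] at this
    linarith [hx.1]
  have hlt : 1 - ρ < 1 := by linarith
  have hn : ∀ᶠ x in 𝓝[Icc (0 : ℝ) 1] 1, x ∈ Icc (1 - ρ) 1 := by
    filter_upwards [self_mem_nhdsWithin, mem_nhdsWithin_of_mem_nhds (Ioi_mem_nhds hlt)]
      with x hx hx' using ⟨le_of_lt hx', hx.2⟩
  rcases hg.continuousOn.strictMonoOn_of_injOn_Icc' hlt.le (hl (by linarith) le_rfl hd)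
    with m | m
  · right; filter_upwards [hn] with x hx using m.monotoneOn hx (right_mem_Icc.2 hlt.le) hx.2
  · left; filter_upwards [hn] with x hx using m.antitoneOn hx (right_mem_Icc.2 hlt.le) hx.2

theorem LapsOn.exists_extremal_subset {g : ℝ → ℝ} {C : Set ℝ} (hg : Continuous g)
    (hl : LapsOn g C 0 1) (hC : C.Finite) (h0 : (0 : ℝ) ∈ C) (h1 : (1 : ℝ) ∈ C) :
    ∃ D ⊆ C, 0 ∈ D ∧ 1 ∈ D ∧ LapsOn g D 0 1 ∧ ∀ c ∈ D, IsLocalExtrOn g (Icc 0 1) c := by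
  have hfin : {D : Set ℝ | D ⊆ C ∧ 0 ∈ D ∧ 1 ∈ D ∧ LapsOn g D 0 1}.Finite :=
    hC.finite_subsets.subset fun D hD => hD.1
  obtain ⟨D, ⟨hDC, hD0, hD1, hDl⟩, hmin⟩ := hfin.exists_minimal ⟨C, subset_rfl, h0, h1, hl⟩
  refine ⟨D, hDC, hD0, hD1, hDl, fun c hc => ?_⟩
  by_contra hex
  have hDf := hC.subset hDC
  have hc0 : (0 : ℝ) ≠ c := by
    rintro rfl; exact hex (hDl.isLocalExtrOn_zero hg hDf hD0 hD1)
  have hc1 : (1 : ℝ) ≠ c := by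
    rintro rfl; exact hex (hDl.isLocalExtrOn_one hg hDf hD0 hD1)
  have := hmin (y := D \ {c}) ⟨sdiff_subset.trans hDC, ⟨hD0, hc0⟩, ⟨hD1, hc1⟩,
    hDl.sdiff_singleton hg hex⟩ sdiff_subset hc
  exact this.2 rfl

/-- A measure-preserving map whose finitely many lap endpoints `C` are local extrema and which
takes all but finitely many values at least twice. -/
structure LapMap (g : ℝ → ℝ) (C : Set ℝ) : Prop where
  leb : LebMap g
  finite : C.Finite
  subset : C ⊆ Icc 0 1
  zero_mem : 0 ∈ C
  one_mem : 1 ∈ C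
  laps : LapsOn g C 0 1
  extr : ∀ c ∈ C, IsLocalExtrOn g (Icc 0 1) c
  simple : (Icc 0 1 ∩ simpleValues g 0 1).Finite

/-- On every lap, the values of `g` are `η`-close to the values of `f`. -/
def LapNear (g : ℝ → ℝ) (C : Set ℝ) (f : ℝ → ℝ) (η : ℝ) : Prop :=
  ∀ ⦃a b : ℝ⦄, 0 ≤ a → b ≤ 1 → Disjoint (Ioo a b) C →
    ∀ x ∈ Icc a b, ∀ y ∈ Icc a b, |g x - f y| ≤ η

theorem LebMap.exists_lapMap {f : ℝ → ℝ} (hf : LebMap f) {η : ℝ} (hη : 0 < η) :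
    ∃ g C, LapMap g C ∧ LapNear g C f η := by
  obtain ⟨δ, hδ, hunif⟩ := Metric.uniformContinuousOn_iff_le.1
    (isCompact_Icc.uniformContinuousOn_of_continuous hf.cont.continuousOn) η hη
  obtain ⟨n, hn⟩ := exists_nat_one_div_lt (show 0 < δ / 3 by positivity)
  obtain ⟨g, C, hg, hC, hl, hnear, hs, hshort⟩ := hf.exists_lap_approx n.succ_pos
  set D := insert 0 (insert 1 (C ∩ Icc 0 1)) with hD
  have hDf : D.Finite := ((hC.inter_of_left _).insert _).insert _
  have hDs : D ⊆ Icc 0 1 := by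
    rintro x (rfl | rfl | hx)
    · simp
    · simp
    · exact hx.2
  have hDl : LapsOn g D 0 1 := by
    intro a b ha hb hd
    refine hl ha hb (disjoint_left.2 fun x hx hxC => disjoint_left.1 hd hx ?_)
    exact Or.inr (Or.inr ⟨hxC, ha.trans hx.1.le, hx.2.le.trans hb⟩)
  obtain ⟨E, hED, hE0, hE1, hEl, hEx⟩ :=
    hDl.exists_extremal_subset hg.cont hDf (by simp [hD]) (by simp [hD])
  refine ⟨g, E, ⟨hg, hDf.subset hED, hED.trans hDs, hE0, hE1, hEl, hEx, hs⟩, ?_⟩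
  intro a b ha hb hd x hx y hy
  have hxI : x ∈ Icc (0 : ℝ) 1 := ⟨ha.trans hx.1, hx.2.trans hb⟩
  have hyI : y ∈ Icc (0 : ℝ) 1 := ⟨ha.trans hy.1, hy.2.trans hb⟩
  obtain ⟨z, hz, hxz, hgz⟩ := hnear x hxI
  have hlen := hshort a b ha hb (hEl ha hb hd)
  push_cast at hxz hlen
  rw [hgz]
  refine hunif z hz y hyI ?_
  have h2 : (2 : ℝ) / (n + 1) = 1 / (n + 1) + 1 / (n + 1) := by ring
  rw [Real.dist_eq]
  rw [abs_le] at hxz ⊢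
  constructor <;> linarith [hx.1, hx.2, hy.1, hy.2]

theorem Seg.id {s t : ℝ} (hst : s ≤ t) : Seg id s t (volume.restrict (Ioc s t)) :=
  ⟨hst, continuous_id, Measure.map_id, ∅, finite_empty, fun _ _ _ _ _ => injOn_id _⟩

theorem fullOn_smul_restrict_Ioc {a b w : ℝ} (hw : 0 < w) :
    FullOn (ENNReal.ofReal w • volume.restrict (Ioc a b)) a b where
  finite := Measure.smul_finite _ ENNReal.ofReal_ne_top
  singleton x := by
    have : volume.restrict (Ioc a b) {x} = 0 := by simp
    simp
  compl := by
    rw [Measure.smul_apply, Measure.restrict_apply measurableSet_Icc.compl,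
      show (Icc a b)ᶜ ∩ Ioc a b = ∅ from ?_, measure_empty, smul_zero]
    rw [eq_empty_iff_forall_notMem]
    exact fun x hx => hx.1 (Ioc_subset_Icc_self hx.2)
  pos u v hu huv hv := by
    rw [Measure.smul_apply, smul_eq_mul, Measure.restrict_apply measurableSet_Ioo,
      inter_eq_left.2 ((Ioo_subset_Ioo hu hv).trans Ioo_subset_Ioc_self), Real.volume_Ioo]
    exact ENNReal.mul_pos (by simpa using hw) (by simpa using huv)

theorem smul_restrict_Ioc_real_univ {a b l : ℝ} (hab : a < b) (hl : 0 ≤ l) :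
    (ENNReal.ofReal (l / (b - a)) • volume.restrict (Ioc a b)).real univ = l := by
  have : 0 < b - a := by linarith
  rw [measureReal_ennreal_smul_apply, measureReal_def, Measure.restrict_apply_univ,
    Real.volume_Ioc, ENNReal.toReal_ofReal (by positivity), ENNReal.toReal_ofReal this.le]
  field_simp

/-- A measure-preserving map which is the identity off `[a, b]` and runs through `[a, b]` in three
laps `a ↗ b ↘ a ↗ b` with turning points `c < d`. -/
structure Zigzag (ψ : ℝ → ℝ) (a c d b : ℝ) : Prop where
  leb : LebMap ψ
  left : ∀ x ≤ a, ψ x = x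
  right : ∀ x, b ≤ x → ψ x = x
  apply_left : ψ c = b
  apply_right : ψ d = a
  mapsTo₁ : MapsTo ψ (Icc a c) (Icc a b)
  mapsTo₂ : MapsTo ψ (Icc c d) (Icc a b)
  mapsTo₃ : MapsTo ψ (Icc d b) (Icc a b)
  injOn₁ : InjOn ψ (Icc a c)
  injOn₂ : InjOn ψ (Icc c d)
  injOn₃ : InjOn ψ (Icc d b)

theorem exists_zigzag {a c d b : ℝ} (ha : 0 ≤ a) (hac : a < c) (hcd : c < d) (hdb : d < b)
    (hb : b ≤ 1) : ∃ ψ, Zigzag ψ a c d b := by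
  have hab : a < b := hac.trans (hcd.trans hdb)
  have hba : 0 < b - a := by linarith
  have l₁ : 0 < c - a := by linarith
  have l₂ : 0 < d - c := by linarith
  have l₃ : 0 < b - d := by linarith
  have hF : ∀ l, 0 < l → FullOn (ENNReal.ofReal (l / (b - a)) • volume.restrict (Ioc a b)) a b :=
    fun l hl => fullOn_smul_restrict_Ioc (div_pos hl hba)
  obtain ⟨h₁, S₁, m₁, s₁, t₁⟩ := (hF _ l₁).exists_increasing hab.le (s := a) (t := c)
    (by rw [smul_restrict_Ioc_real_univ hab l₁.le]; ring)
  obtain ⟨h₂, S₂, m₂, s₂, t₂⟩ := (hF _ l₂).exists_decreasing hab.le (s := c) (t := d)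
    (by rw [smul_restrict_Ioc_real_univ hab l₂.le]; ring)
  obtain ⟨h₃, S₃, m₃, s₃, t₃⟩ := (hF _ l₃).exists_increasing hab.le (s := d) (t := b)
    (by rw [smul_restrict_Ioc_real_univ hab l₃.le]; ring)
  have e₀ : id a = h₁ a := s₁.symm
  have T₁ := (Seg.id ha).glue S₁ e₀
  have e₁ : glue a id h₁ c = h₂ c := by rw [glue_of_ge e₀ hac.le, t₁, s₂]
  have T₂ := T₁.glue S₂ e₁
  have e₂ : glue c (glue a id h₁) h₂ d = h₃ d := by rw [glue_of_ge e₁ hcd.le, t₂, s₃]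
  have T₃ := T₂.glue S₃ e₂
  have e₃ : glue d (glue c (glue a id h₁) h₂) h₃ b = id b := by
    rw [glue_of_ge e₂ hdb.le, t₃, id]
  have T := T₃.glue (Seg.id hb) e₃
  set ψ := glue b (glue d (glue c (glue a id h₁) h₂) h₃) id with hψ
  have ψ₀ : ∀ x ≤ a, ψ x = x := fun x hx => by
    rw [hψ, glue_of_le (hx.trans hab.le), glue_of_le (hx.trans (hac.trans hcd).le),
      glue_of_le (hx.trans hac.le), glue_of_le hx, id]
  have ψ₁ : ∀ x ∈ Icc a c, h₁ x = ψ x := fun x hx => by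
    rw [hψ, glue_of_le (hx.2.trans (hcd.trans hdb).le), glue_of_le (hx.2.trans hcd.le),
      glue_of_le hx.2, glue_of_ge e₀ hx.1]
  have ψ₂ : ∀ x ∈ Icc c d, h₂ x = ψ x := fun x hx => by
    rw [hψ, glue_of_le (hx.2.trans hdb.le), glue_of_le hx.2, glue_of_ge e₁ hx.1]
  have ψ₃ : ∀ x ∈ Icc d b, h₃ x = ψ x := fun x hx => by
    rw [hψ, glue_of_le hx.2, glue_of_ge e₂ hx.1]
  have ψ₄ : ∀ x, b ≤ x → ψ x = x := fun x hx => by rw [hψ, glue_of_ge e₃ hx, id]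
  have M₁ : MapsTo ψ (Icc a c) (Icc a b) := fun x hx => by
    rw [← ψ₁ x hx]
    exact ⟨s₁.symm.le.trans (m₁.monotoneOn (left_mem_Icc.2 hac.le) hx hx.1),
      (m₁.monotoneOn hx (right_mem_Icc.2 hac.le) hx.2).trans t₁.le⟩
  have M₂ : MapsTo ψ (Icc c d) (Icc a b) := fun x hx => by
    rw [← ψ₂ x hx]
    exact ⟨t₂.symm.le.trans (m₂.antitoneOn hx (right_mem_Icc.2 hcd.le) hx.2),
      (m₂.antitoneOn (left_mem_Icc.2 hcd.le) hx hx.1).trans s₂.le⟩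
  have M₃ : MapsTo ψ (Icc d b) (Icc a b) := fun x hx => by
    rw [← ψ₃ x hx]
    exact ⟨s₃.symm.le.trans (m₃.monotoneOn (left_mem_Icc.2 hdb.le) hx hx.1),
      (m₃.monotoneOn hx (right_mem_Icc.2 hdb.le) hx.2).trans t₃.le⟩
  refine ⟨ψ, ⟨T.cont, ?_, ?_⟩, ψ₀, ψ₄, ?_, ?_, M₁, M₂, M₃, m₁.injOn.congr ψ₁, m₂.injOn.congr ψ₂,
    m₃.injOn.congr ψ₃⟩
  · intro x hx
    have hsub : Icc a b ⊆ Icc 0 1 := Icc_subset_Icc ha hb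
    rcases le_total x a with h | h
    · rwa [ψ₀ x h]
    rcases le_total x c with h' | h'
    · exact hsub (M₁ ⟨h, h'⟩)
    rcases le_total x d with h'' | h''
    · exact hsub (M₂ ⟨h', h''⟩)
    rcases le_total x b with h₃ | h₃
    · exact hsub (M₃ ⟨h'', h₃⟩)
    · rwa [ψ₄ x h₃]
  · rw [← restrict_Ioc_eq_restrict_Icc, T.map]
    have hw : ENNReal.ofReal ((c - a) / (b - a)) • volume.restrict (Ioc a b) +
        ENNReal.ofReal ((d - c) / (b - a)) • volume.restrict (Ioc a b) +
        ENNReal.ofReal ((b - d) / (b - a)) • volume.restrict (Ioc a b) =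
        volume.restrict (Ioc a b) := by
      rw [← add_smul, ← add_smul, ← ENNReal.ofReal_add (by positivity) (by positivity),
        ← ENNReal.ofReal_add (by positivity) (by positivity), ← add_div, ← add_div,
        show c - a + (d - c) + (b - d) = b - a by ring, div_self hba.ne', ENNReal.ofReal_one,
        one_smul]
    rw [add_assoc (volume.restrict (Ioc 0 a)), add_assoc (volume.restrict (Ioc 0 a)), hw,
      ← Measure.restrict_union (Ioc_disjoint_Ioc_of_le le_rfl) measurableSet_Ioc,
      Ioc_union_Ioc_eq_Ioc ha hab.le,
      ← Measure.restrict_union (Ioc_disjoint_Ioc_of_le le_rfl) measurableSet_Ioc,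
      Ioc_union_Ioc_eq_Ioc (ha.trans hab.le) hb]
  · rw [← ψ₁ c (right_mem_Icc.2 hac.le), t₁]
  · rw [← ψ₂ d (right_mem_Icc.2 hcd.le), t₂]

theorem LebMap.comp {f g : ℝ → ℝ} (hg : LebMap g) (hf : LebMap f) : LebMap (g ∘ f) :=
  ⟨hg.cont.comp hf.cont, hg.mapsTo.comp hf.mapsTo, by
    rw [← Measure.map_map hg.cont.measurable hf.cont.measurable, hf.map, hg.map]⟩

/-- A zigzag on a lap of `C` carries each lap of the refined partition injectively into a lap of
`C` which contains it. -/
theorem Zigzag.exists_lap {ψ : ℝ → ℝ} {a c d b : ℝ} {C : Set ℝ} (hψ : Zigzag ψ a c d b)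
    (ha : 0 ≤ a) (hb : b ≤ 1) (haC : a ∈ C) (hbC : b ∈ C) (hC : Disjoint (Ioo a b) C) {x y : ℝ} (hx : 0 ≤ x) (hy : y ≤ 1)
    (hd : Disjoint (Ioo x y) (insert c (insert d C))) :
    ∃ x' y', 0 ≤ x' ∧ y' ≤ 1 ∧ Disjoint (Ioo x' y') C ∧ Icc x y ⊆ Icc x' y' ∧
      InjOn ψ (Icc x y) ∧ MapsTo ψ (Icc x y) (Icc x' y') := by
  have key : ∀ p ∈ insert c (insert d C), y ≤ p ∨ p ≤ x := by
    intro p hp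
    by_contra! h
    exact disjoint_right.1 hd hp ⟨h.2, h.1⟩
  have hdC : Disjoint (Ioo x y) C :=
    hd.mono_right ((subset_insert _ _).trans (subset_insert _ _))
  rcases key a (by simp [haC]) with h₁ | h₁
  · have hid : ∀ z ∈ Icc x y, z = ψ z := fun z hz => (hψ.left z (hz.2.trans h₁)).symm
    exact ⟨x, y, hx, hy, hdC, subset_rfl, (injOn_id _).congr hid,
      (mapsTo_id _).congr hid⟩
  rcases key b (by simp [hbC]) with h₂ | h₂
  · refine ⟨a, b, ha, hb, hC, Icc_subset_Icc h₁ h₂, ?_⟩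
    rcases key c (by simp) with h₃ | h₃
    · have hs : Icc x y ⊆ Icc a c := Icc_subset_Icc h₁ h₃
      exact ⟨hψ.injOn₁.mono hs, hψ.mapsTo₁.mono_left hs⟩
    rcases key d (by simp) with h₄ | h₄
    · have hs : Icc x y ⊆ Icc c d := Icc_subset_Icc h₃ h₄
      exact ⟨hψ.injOn₂.mono hs, hψ.mapsTo₂.mono_left hs⟩
    · have hs : Icc x y ⊆ Icc d b := Icc_subset_Icc h₄ h₂
      exact ⟨hψ.injOn₃.mono hs, hψ.mapsTo₃.mono_left hs⟩
  · have hid : ∀ z ∈ Icc x y, z = ψ z := fun z hz => (hψ.right z (h₂.trans hz.1)).symm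
    exact ⟨x, y, hx, hy, hdC, subset_rfl, (injOn_id _).congr hid,
      (mapsTo_id _).congr hid⟩

theorem exists_adjacent {C : Set ℝ} (hC : C.Finite) {c x y : ℝ} (hx : x ∈ C) (hy : y ∈ C)
    (hxc : x < c) (hcy : c < y) (hc : c ∉ C) :
    ∃ a ∈ C, ∃ b ∈ C, a < c ∧ c < b ∧ Disjoint (Ioo a b) C := by
  obtain ⟨a, ha, ha'⟩ := exists_max_image (C ∩ Iio c) id (hC.inter_of_left _) ⟨x, hx, hxc⟩
  obtain ⟨b, hb, hb'⟩ := exists_min_image (C ∩ Ioi c) id (hC.inter_of_left _) ⟨y, hy, hcy⟩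
  refine ⟨a, ha.1, b, hb.1, ha.2, hb.2, disjoint_left.2 fun z hz hzC => ?_⟩
  rcases lt_trichotomy z c with h | rfl | h
  · exact absurd hz.1 (not_lt.2 (ha' z ⟨hzC, h⟩))
  · exact hc hzC
  · exact absurd hz.2 (not_lt.2 (hb' z ⟨hzC, h⟩))

theorem LapMap.exists_refine {g f : ℝ → ℝ} {C : Set ℝ} {η c : ℝ} (hg : LapMap g C)
    (hn : LapNear g C f η) (hc : c ∈ Icc 0 1) (hcC : c ∉ C) :
    ∃ g' C', LapMap g' C' ∧ LapNear g' C' f η ∧ c ∈ C' ∧ C ⊆ C' ∧ g' '' C' ⊆ g '' C := by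
  have hc0 : 0 < c := lt_of_le_of_ne hc.1 (by rintro rfl; exact hcC hg.zero_mem)
  have hc1 : c < 1 := lt_of_le_of_ne hc.2 (by rintro rfl; exact hcC hg.one_mem)
  obtain ⟨a, haC, b, hbC, hac, hcb, hC⟩ :=
    exists_adjacent hg.finite hg.zero_mem hg.one_mem hc0 hc1 hcC
  obtain ⟨d, hcd, hdb⟩ := exists_between hcb
  have ha := (hg.subset haC).1
  have hb := (hg.subset hbC).2
  obtain ⟨ψ, hψ⟩ := exists_zigzag ha hac hcd hdb hb
  have hlap := fun x y => hψ.exists_lap ha hb haC hbC hC (x := x) (y := y)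
  have hψC : ∀ p ∈ insert c (insert d C), ψ p ∈ C := by
    rintro p (rfl | rfl | hp)
    · rwa [hψ.apply_left]
    · rwa [hψ.apply_right]
    · rcases le_or_gt p a with h | h
      · rwa [hψ.left p h]
      rcases le_or_gt b p with h' | h'
      · rwa [hψ.right p h']
      · exact absurd hp (disjoint_left.1 hC ⟨h, h'⟩)
  have hsub : insert c (insert d C) ⊆ Icc 0 1 := by
    rintro p (rfl | rfl | hp)
    · exact hc
    · exact ⟨hc.1.trans hcd.le, hdb.le.trans hb⟩
    · exact hg.subset hp
  have hCs : C ⊆ insert c (insert d C) := (subset_insert _ _).trans (subset_insert _ _)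
  refine ⟨g ∘ ψ, insert c (insert d C), ⟨hg.leb.comp hψ.leb, (hg.finite.insert d).insert c, hsub,
    hCs hg.zero_mem, hCs hg.one_mem, ?_, ?_, ?_⟩, ?_, mem_insert _ _, hCs, ?_⟩
  · intro x y hx hy hd
    obtain ⟨x', y', hx', hy', hd', -, hi, hm⟩ := hlap x y hx hy hd
    exact (hg.laps hx' hy' hd').comp hi hm
  · intro p hp
    exact (hg.extr _ (hψC p hp)).comp_tendsto
      (hψ.leb.cont.continuousWithinAt.tendsto_nhdsWithin hψ.leb.mapsTo)
  · refine hg.simple.subset (inter_subset_inter_right _ fun v hv u hu u' hu' e e' => ?_)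
    obtain ⟨w, hw, rfl⟩ := hψ.leb.surjOn hu
    obtain ⟨w', hw', rfl⟩ := hψ.leb.surjOn hu'
    rw [hv w hw w' hw' e e']
  · intro x y hx hy hd u hu v hv
    obtain ⟨x', y', hx', hy', hd', hs, hi, hm⟩ := hlap x y hx hy hd
    exact hn hx' hy' hd' _ (hm hu) _ (hs hv)
  · rintro _ ⟨p, hp, rfl⟩
    exact ⟨ψ p, hψC p hp, rfl⟩

theorem LapMap.exists_markov {g f : ℝ → ℝ} {C : Set ℝ} {η : ℝ} (hg : LapMap g C)
    (hn : LapNear g C f η) :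
    ∃ g' C', LapMap g' C' ∧ LapNear g' C' f η ∧ MapsTo g' C' C' := by
  induction hk : (g '' C \ C).ncard using Nat.strong_induction_on generalizing g C with
  | _ k ih =>
    by_cases hgC : MapsTo g C C
    · exact ⟨g, C, hg, hn, hgC⟩
    · obtain ⟨p, hp, hpC⟩ : ∃ p ∈ C, g p ∉ C := by simpa [MapsTo] using hgC
      obtain ⟨g', C', h1, h2, h3, h4, h5⟩ :=
        hg.exists_refine hn (hg.leb.mapsTo (hg.subset hp)) hpC
      refine ih _ ?_ h1 h2 rfl
      rw [← hk]
      refine ncard_lt_ncard ?_ (hg.finite.image g).sdiff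
      refine ⟨fun x hx => ⟨h5 hx.1, fun h => hx.2 (h4 h)⟩, fun h => ?_⟩
      exact (h ⟨mem_image_of_mem g hp, hpC⟩).2 h3

theorem LapMap.sub_lt_abs_sub {g : ℝ → ℝ} {C : Set ℝ} (hg : LapMap g C) {x y : ℝ} (hx : 0 ≤ x)
    (hxy : x < y) (hy : y ≤ 1) (hd : Disjoint (Ioo x y) C) : y - x < |g x - g y| := by
  have hsub : Icc x y ⊆ Icc 0 1 := Icc_subset_Icc hx hy
  have hinj := hg.laps hx hy hd
  have hxm : x ∈ Icc x y := left_mem_Icc.2 hxy.le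
  have hym : y ∈ Icc x y := right_mem_Icc.2 hxy.le
  obtain ⟨l, r, hlr, hr, hV, hVI⟩ : ∃ l r, l < r ∧ r - l = |g x - g y| ∧
      MapsTo g (Ioo x y) (Ioo l r) ∧ Ioo l r ⊆ Icc 0 1 := by
    rcases hg.leb.cont.continuousOn.strictMonoOn_of_injOn_Icc' hxy.le hinj with m | m
    · have h := m hxm hym hxy
      refine ⟨g x, g y, h, by rw [abs_of_neg (by linarith)]; ring, fun z hz => ?_, ?_⟩
      · exact ⟨m hxm (Ioo_subset_Icc_self hz) hz.1, m (Ioo_subset_Icc_self hz) hym hz.2⟩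
      · exact Ioo_subset_Icc_self.trans
          (Icc_subset_Icc (hg.leb.mapsTo (hsub hxm)).1 (hg.leb.mapsTo (hsub hym)).2)
    · have h := m hxm hym hxy
      refine ⟨g y, g x, h, by rw [abs_of_pos (by linarith)], fun z hz => ?_, ?_⟩
      · exact ⟨m (Ioo_subset_Icc_self hz) hym hz.2, m hxm (Ioo_subset_Icc_self hz) hz.1⟩
      · exact Ioo_subset_Icc_self.trans
          (Icc_subset_Icc (hg.leb.mapsTo (hsub hym)).1 (hg.leb.mapsTo (hsub hxm)).2)
  obtain ⟨v, hv, hvs⟩ := (Ioo_infinite hlr).exists_notMem_finite hg.simple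
  obtain ⟨u, hu, huv, hu'⟩ : ∃ u ∈ Icc (0 : ℝ) 1, g u = v ∧ u ∉ Icc x y := by
    have hvs' : v ∉ simpleValues g 0 1 := fun h => hvs ⟨hVI hv, h⟩
    simp only [simpleValues, mem_ofPred_eq] at hvs'
    push Not at hvs'
    obtain ⟨u, hu, u', hu', e, e', hne⟩ := hvs'
    by_cases h : u ∈ Icc x y
    · exact ⟨u', hu', e', fun h' => hne (hinj h h' (e.trans e'.symm))⟩
    · exact ⟨u, hu, e, h⟩
  set O := g ⁻¹' Ioo l r ∩ (Icc x y)ᶜ with hO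
  have hpos : 0 < volume (O ∩ Ioo 0 1) := measure_inter_Ioo_pos
    ((isOpen_Ioo.preimage hg.leb.cont).inter isClosed_Icc.isOpen_compl) zero_lt_one hu
    ⟨by rwa [mem_preimage, huv], hu'⟩
  have hle : volume (Ioo x y ∪ O ∩ Ioo 0 1) ≤ volume (g ⁻¹' Ioo l r ∩ Icc 0 1) := by
    refine measure_mono (union_subset ?_ ?_)
    · exact fun z hz => ⟨hV hz, hsub (Ioo_subset_Icc_self hz)⟩
    · exact inter_subset_inter inter_subset_left Ioo_subset_Icc_self
  have hdisj : Disjoint (Ioo x y) (O ∩ Ioo 0 1) := disjoint_left.2 fun z hz hz' =>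
    hz'.1.2 (Ioo_subset_Icc_self hz)
  have hOm : MeasurableSet (O ∩ Ioo 0 1) :=
    ((hg.leb.cont.measurable measurableSet_Ioo).inter measurableSet_Icc.compl).inter
      measurableSet_Ioo
  rw [measure_union hdisj hOm, hg.leb.volume_preimage measurableSet_Ioo, inter_eq_left.2 hVI,
    Real.volume_Ioo, Real.volume_Ioo, hr] at hle
  exact (ENNReal.ofReal_lt_ofReal_iff_of_nonneg (by linarith)).1
    ((ENNReal.lt_add_right ENNReal.ofReal_ne_top hpos.ne').trans_le hle)

theorem LapMap.exists_expansion {g : ℝ → ℝ} {C : Set ℝ} (hg : LapMap g C) {ε : ℝ} (hε : 0 < ε) :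
    ∃ δ > 0, ∀ x, 0 ≤ x → x + ε ≤ 1 → Disjoint (Ioo x (x + ε)) C →
      ε + δ ≤ |g x - g (x + ε)| := by
  set K : Set ℝ := Icc 0 (1 - ε) ∩ ⋂ c ∈ C, {x | c ≤ x ∨ x + ε ≤ c} with hK
  have hKc : IsCompact K := by
    refine isCompact_Icc.inter_right (isClosed_biInter fun c _ => ?_)
    exact (isClosed_le continuous_const continuous_id).union
      (isClosed_le (continuous_id.add continuous_const) continuous_const)
  have hmem : ∀ x, 0 ≤ x → x + ε ≤ 1 → Disjoint (Ioo x (x + ε)) C → x ∈ K := by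
    intro x hx hx1 hd
    refine ⟨⟨hx, by linarith⟩, mem_iInter₂.2 fun c hc => ?_⟩
    by_contra h
    simp only [mem_ofPred_eq, not_or, not_le] at h
    exact disjoint_right.1 hd hc h
  rcases K.eq_empty_or_nonempty with h | h
  · refine ⟨1, one_pos, fun x hx hx1 hd => ?_⟩
    have := hmem x hx hx1 hd
    simp [h] at this
  · have hcont : Continuous fun x => |g x - g (x + ε)| :=
      (hg.leb.cont.sub (hg.leb.cont.comp (continuous_id.add continuous_const))).abs
    obtain ⟨z, hz, hmin⟩ := hKc.exists_isMinOn h hcont.continuousOn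
    have hlt := hg.sub_lt_abs_sub (x := z) (y := z + ε) hz.1.1 (by linarith)
      (by linarith [hz.1.2]) (disjoint_right.2 fun c hc hcz => by
        rcases mem_iInter₂.1 hz.2 c hc with h | h
        · exact absurd hcz.1 (not_lt.2 h)
        · exact absurd hcz.2 (not_lt.2 h))
    refine ⟨|g z - g (z + ε)| - ε, by linarith, fun x hx hx1 hd => ?_⟩
    have := isMinOn_iff.1 hmin x (hmem x hx hx1 hd)
    simpa using this

/-- `δ` is small enough, relative to `ε`, for intervals of radius about `ε` to absorb errors of
size `δ`. -/
structure Scale (g : ℝ → ℝ) (C : Set ℝ) (ε δ : ℝ) : Prop where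
  pos : 0 < δ
  le : δ ≤ ε
  gap : ∀ c ∈ C, ∀ c' ∈ C, c ≠ c' → 2 * ε < |c - c'|
  expand : ∃ κ, δ ≤ κ ∧
    (∀ x, 0 ≤ x → x + ε ≤ 1 → Disjoint (Ioo x (x + ε)) C → ε + 2 * κ ≤ |g x - g (x + ε)|) ∧
    ∀ u ∈ Icc (0 : ℝ) 1, ∀ v ∈ Icc (0 : ℝ) 1, |u - v| < δ → |g u - g v| < κ
  extr : ∀ c ∈ C, (∀ z ∈ Icc (0 : ℝ) 1, |z - c| < δ → g z ≤ g c) ∨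
    ∀ z ∈ Icc (0 : ℝ) 1, |z - c| < δ → g c ≤ g z

theorem Scale.neg {g : ℝ → ℝ} {C : Set ℝ} {ε δ : ℝ} (h : Scale g C ε δ) :
    Scale (fun x => -g x) C ε δ where
  pos := h.pos
  le := h.le
  gap := h.gap
  expand := by
    obtain ⟨κ, h1, h2, h3⟩ := h.expand
    have hab : ∀ a b : ℝ, |-a - -b| = |a - b| := fun a b => by
      rw [← abs_neg]; congr 1; ring
    exact ⟨κ, h1, by simpa only [hab] using h2, by simpa only [hab] using h3⟩
  extr c hc := by simpa only [neg_le_neg_iff] using (h.extr c hc).symm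

theorem LapMap.exists_scale {g : ℝ → ℝ} {C : Set ℝ} (hg : LapMap g C) :
    ∃ ρ > 0, ∀ ε, 0 < ε → ε < ρ → ∃ δ, Scale g C ε δ := by
  obtain ⟨ρ, hρ, hgap⟩ := exists_gap hg.finite hg.zero_mem hg.one_mem
  refine ⟨ρ / 2, by positivity, fun ε hε hερ => ?_⟩
  obtain ⟨κ, hκ, hexp⟩ := hg.exists_expansion hε
  obtain ⟨δ, hδ, hunif⟩ := Metric.uniformContinuousOn_iff.1
    (isCompact_Icc.uniformContinuousOn_of_continuous hg.leb.cont.continuousOn) (κ / 2)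
    (by positivity)
  have hr : ∃ r > 0, ∀ c ∈ C, (∀ z ∈ Icc (0 : ℝ) 1, |z - c| < r → g z ≤ g c) ∨
      ∀ z ∈ Icc (0 : ℝ) 1, |z - c| < r → g c ≤ g z := by
    have : ∀ᶠ r in 𝓝[>] (0 : ℝ), ∀ c ∈ C, (∀ z ∈ Icc (0 : ℝ) 1, |z - c| < r → g z ≤ g c) ∨
        ∀ z ∈ Icc (0 : ℝ) 1, |z - c| < r → g c ≤ g z := by
      refine (eventually_all_finite hg.finite).2 fun c hc => ?_
      rcases hg.extr c hc with h | h
      · obtain ⟨r, hr, hr'⟩ := Metric.mem_nhdsWithin_iff.1 h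
        filter_upwards [Ioo_mem_nhdsGT hr] with s hs
        right
        exact fun z hz hzs => hr' ⟨by rw [mem_ball, Real.dist_eq]; exact hzs.trans hs.2, hz⟩
      · obtain ⟨r, hr, hr'⟩ := Metric.mem_nhdsWithin_iff.1 h
        filter_upwards [Ioo_mem_nhdsGT hr] with s hs
        left
        exact fun z hz hzs => hr' ⟨by rw [mem_ball, Real.dist_eq]; exact hzs.trans hs.2, hz⟩
    obtain ⟨r, hr, hr'⟩ := (this.and self_mem_nhdsWithin).exists
    exact ⟨r, hr', hr⟩
  obtain ⟨r, hr, hex⟩ := hr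
  have hm₁ : min (min ε (κ / 2)) (min δ r) ≤ ε := (min_le_left _ _).trans (min_le_left _ _)
  have hm₂ : min (min ε (κ / 2)) (min δ r) ≤ κ / 2 := (min_le_left _ _).trans (min_le_right _ _)
  have hm₃ : min (min ε (κ / 2)) (min δ r) ≤ δ := (min_le_right _ _).trans (min_le_left _ _)
  have hm₄ : min (min ε (κ / 2)) (min δ r) ≤ r := (min_le_right _ _).trans (min_le_right _ _)
  refine ⟨min (min ε (κ / 2)) (min δ r), by positivity, hm₁, ?_, ⟨κ / 2, hm₂, ?_, ?_⟩, ?_⟩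
  · intro c hc c' hc' hne
    linarith [hgap c hc c' hc' hne]
  · intro x hx hx1 hd
    linarith [hexp x hx hx1 hd]
  · intro u hu v hv huv
    exact hunif u hu v hv (huv.trans_le hm₃)
  · intro c hc
    exact (hex c hc).imp (fun h z hz hzc => h z hz (hzc.trans_le hm₄))
      fun h z hz hzc => h z hz (hzc.trans_le hm₄)

/-- `[a, b]` is contained in a lap of `C`, and is the interval of radius `ε` about a point `m`
close to `y`, cut off at `C`. -/
structure Cell (C : Set ℝ) (ε δ y a b : ℝ) : Prop where
  nonneg : 0 ≤ a
  lt : a < b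
  le_one : b ≤ 1
  disj : Disjoint (Ioo a b) C
  center : ∃ m ∈ Icc a b, (m = y ∨ m ∈ C ∧ |m - y| < δ) ∧ (a = m - ε ∨ a ∈ C ∧ m - ε < a) ∧
    (b = m + ε ∨ b ∈ C ∧ b < m + ε)

theorem Cell.image_of_strictMonoOn {g : ℝ → ℝ} {C : Set ℝ} {ε δ y a b : ℝ}
    (h : Cell C ε δ y a b) (hs : Scale g C ε δ) (hm : StrictMonoOn g (Icc a b))
    (hy : y ∈ Icc 0 1) :
    g y ∈ Icc (g a) (g b) ∧ (g a ≤ g y - (ε + δ) ∨ a ∈ C) ∧ (g y + (ε + δ) ≤ g b ∨ b ∈ C) := by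
  obtain ⟨m, hmab, hmy, ha, hb⟩ := h.center
  obtain ⟨κ, hκ, hexp, hunif⟩ := hs.expand
  have hδ := hs.pos
  have hδε := hs.le
  have ham : a ∈ Icc a b := left_mem_Icc.2 h.lt.le
  have hbm : b ∈ Icc a b := right_mem_Icc.2 h.lt.le
  have hsub : Icc a b ⊆ Icc 0 1 := Icc_subset_Icc h.nonneg h.le_one
  have hgm : |g m - g y| < κ := by
    refine hunif m (hsub hmab) y hy ?_
    rcases hmy with rfl | hmy
    · simpa using hs.pos
    · exact hmy.2
  rw [abs_lt] at hgm
  have hl : a = m - ε → g a ≤ g y - (ε + δ) := by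
    intro e
    have e' : a + ε = m := by linarith
    have := hexp a h.nonneg (by linarith [hmab.2, h.le_one])
      (h.disj.mono_left (Ioo_subset_Ioo_right (by linarith [hmab.2])))
    rw [e', abs_of_nonpos (by linarith [hm.monotoneOn ham hmab hmab.1])] at this
    linarith
  have hr : b = m + ε → g y + (ε + δ) ≤ g b := by
    intro e
    have := hexp m (hsub hmab).1 (by linarith [h.le_one])
      (h.disj.mono_left (Ioo_subset_Ioo hmab.1 (by linarith)))
    rw [← e, abs_of_nonpos (by linarith [hm.monotoneOn hmab hbm hmab.2])] at this
    linarith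
  refine ⟨?_, ha.imp hl And.left, hb.imp hr And.left⟩
  rcases hmy with rfl | ⟨hmC, hmy⟩
  · exact ⟨hm.monotoneOn ham hmab hmab.1, hm.monotoneOn hmab hbm hmab.2⟩
  have hend : m = a ∨ m = b := by
    by_contra! hne
    exact disjoint_left.1 h.disj
      ⟨lt_of_le_of_ne hmab.1 hne.1.symm, lt_of_le_of_ne hmab.2 hne.2⟩ hmC
  rw [abs_sub_comm] at hmy
  rcases hend with rfl | rfl
  · have hlow : g m ≤ g y := by
      rcases hs.extr m hmC with hx | hx
      · have hz : min b (m + δ / 2) ∈ Icc m b :=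
          ⟨le_min h.lt.le (by linarith), min_le_left _ _⟩
        have hlt : m < min b (m + δ / 2) := lt_min h.lt (by linarith)
        have h1 := hx _ (hsub hz) (by
          rw [abs_of_nonneg (by linarith)]; linarith [min_le_right b (m + δ / 2)])
        exact absurd (hm ham hz hlt) (not_lt.2 h1)
      · exact hx y hy hmy
    refine ⟨hlow, ?_⟩
    rcases hb with hb | hb
    · linarith [hr hb]
    · have := hs.gap b hb.1 m hmC h.lt.ne'
      rw [abs_of_pos (by linarith [h.lt])] at this
      linarith
  · have hhigh : g y ≤ g m := by
      rcases hs.extr m hmC with hx | hx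
      · exact hx y hy hmy
      · have hz : max a (m - δ / 2) ∈ Icc a m :=
          ⟨le_max_left _ _, max_le h.lt.le (by linarith)⟩
        have hlt : max a (m - δ / 2) < m := max_lt h.lt (by linarith)
        have h1 := hx _ (hsub hz) (by
          rw [abs_of_nonpos (by linarith)]; linarith [le_max_right a (m - δ / 2)])
        exact absurd (hm hz hbm hlt) (not_lt.2 h1)
    refine ⟨?_, hhigh⟩
    rcases ha with ha | ha
    · linarith [hl ha]
    · have := hs.gap a ha.1 m hmC h.lt.ne
      rw [abs_of_neg (by linarith [h.lt])] at this
      linarith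

theorem Cell.exists_image {g : ℝ → ℝ} {C : Set ℝ} {ε δ y a b : ℝ} (h : Cell C ε δ y a b)
    (hg : LapMap g C) (hgC : MapsTo g C C) (hs : Scale g C ε δ) (hy : y ∈ Icc 0 1) :
    ∃ L R, L < R ∧ Icc L R ⊆ g '' Icc a b ∧ 0 ≤ L ∧ R ≤ 1 ∧ g y ∈ Icc L R ∧
      (L ≤ g y - (ε + δ) ∨ L ∈ C) ∧ (g y + (ε + δ) ≤ R ∨ R ∈ C) := by
  have hsub : Icc a b ⊆ Icc 0 1 := Icc_subset_Icc h.nonneg h.le_one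
  have ham : a ∈ Icc a b := left_mem_Icc.2 h.lt.le
  have hbm : b ∈ Icc a b := right_mem_Icc.2 h.lt.le
  have ha := hg.leb.mapsTo (hsub ham)
  have hb := hg.leb.mapsTo (hsub hbm)
  rcases hg.leb.cont.continuousOn.strictMonoOn_of_injOn_Icc' h.lt.le
    (hg.laps h.nonneg h.le_one h.disj) with m | m
  · obtain ⟨h1, h2, h3⟩ := h.image_of_strictMonoOn hs m hy
    exact ⟨g a, g b, m ham hbm h.lt, intermediate_value_Icc h.lt.le hg.leb.cont.continuousOn,
      ha.1, hb.2, h1, h2.imp_right (@hgC a), h3.imp_right (@hgC b)⟩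
  · obtain ⟨h1, h2, h3⟩ := h.image_of_strictMonoOn hs.neg m.neg hy
    exact ⟨g b, g a, m ham hbm h.lt, intermediate_value_Icc' h.lt.le hg.leb.cont.continuousOn,
      hb.1, ha.2, ⟨by linarith [h1.2], by linarith [h1.1]⟩,
      h3.imp (fun h => by linarith) (@hgC b), h2.imp (fun h => by linarith) (@hgC a)⟩

theorem exists_cell {C : Set ℝ} {ε δ L R w z r : ℝ} (hε : 0 < ε)
    (hgap : ∀ c ∈ C, ∀ c' ∈ C, c ≠ c' → 2 * ε < |c - c'|) (hLR : L < R) (hL : 0 ≤ L) (hR : R ≤ 1)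
    (hw : w ∈ Icc L R) (hzw : |z - w| < δ) (hr : ε + δ ≤ r) (hLC : L ≤ w - r ∨ L ∈ C)
    (hRC : w + r ≤ R ∨ R ∈ C) : ∃ a b, Cell C ε δ z a b ∧ Icc a b ⊆ Icc L R := by
  have hzw' := abs_lt.1 hzw
  obtain ⟨m, hm, hmz, hmw⟩ : ∃ m ∈ Icc L R, (m = z ∨ m ∈ C ∧ |m - z| < δ) ∧ |m - w| < δ := by
    rcases lt_or_ge z L with hzL | hzL
    · have hLC' : L ∈ C := hLC.resolve_left fun h => by linarith
      refine ⟨L, left_mem_Icc.2 hLR.le, Or.inr ⟨hLC', ?_⟩, ?_⟩ <;> rw [abs_lt] <;>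
        constructor <;> linarith [hw.1]
    rcases lt_or_ge R z with hzR | hzR
    · have hRC' : R ∈ C := hRC.resolve_left fun h => by linarith
      refine ⟨R, right_mem_Icc.2 hLR.le, Or.inr ⟨hRC', ?_⟩, ?_⟩ <;> rw [abs_lt] <;>
        constructor <;> linarith [hw.2]
    · exact ⟨z, ⟨hzL, hzR⟩, Or.inl rfl, hzw⟩
  rw [abs_lt] at hmw
  obtain ⟨l, hLl, hlm, hl⟩ : ∃ l, L ≤ l ∧ l ≤ m ∧ (l = m - ε ∨ l = L ∧ L ∈ C ∧ m - ε < l) := by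
    rcases le_or_gt L (m - ε) with h | h
    · exact ⟨m - ε, h, by linarith, Or.inl rfl⟩
    · exact ⟨L, le_rfl, hm.1, Or.inr ⟨rfl, hLC.resolve_left fun h => by linarith, h⟩⟩
  obtain ⟨u, huR, hmu, hu⟩ : ∃ u, u ≤ R ∧ m ≤ u ∧ (u = m + ε ∨ u = R ∧ R ∈ C ∧ u < m + ε) := by
    rcases le_or_gt (m + ε) R with h | h
    · exact ⟨m + ε, h, by linarith, Or.inl rfl⟩
    · exact ⟨R, le_rfl, hm.2, Or.inr ⟨rfl, hRC.resolve_left fun h => by linarith, h⟩⟩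
  have hlu : l < u := by
    rcases hl with hl | hl
    · linarith
    rcases hu with hu | hu
    · linarith
    · rw [hl.1, hu.1]; exact hLR
  have hle : m - ε ≤ l := by rcases hl with hl | hl <;> [exact hl.ge; exact hl.2.2.le]
  have hue : u ≤ m + ε := by rcases hu with hu | hu <;> [exact hu.le; exact hu.2.2.le]
  have hl' : l = m - ε ∨ l ∈ C ∧ m - ε < l := by
    rcases hl with h | ⟨h, h', h''⟩
    exacts [Or.inl h, Or.inr ⟨by rw [h]; exact h', h''⟩]
  have hu' : u = m + ε ∨ u ∈ C ∧ u < m + ε := by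
    rcases hu with h | ⟨h, h', h''⟩
    exacts [Or.inl h, Or.inr ⟨by rw [h]; exact h', h''⟩]
  by_cases hd : Disjoint (Ioo l u) C
  · exact ⟨l, u, ⟨hL.trans hLl, hlu, huR.trans hR, hd, m, ⟨hlm, hmu⟩, hmz, hl', hu'⟩,
      Icc_subset_Icc hLl huR⟩
  obtain ⟨c, hc, hcC⟩ := not_disjoint_iff.1 hd
  have huniq : ∀ x ∈ Ioo l u, x ∈ C → x = c := by
    intro x hx hxC
    by_contra hne
    have h1 := hgap x hxC c hcC hne
    have h2 : |x - c| ≤ 2 * ε := by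
      rw [abs_le]; constructor <;> linarith [hx.1, hx.2, hc.1, hc.2]
    linarith
  rcases le_total m c with hmc | hmc
  · refine ⟨l, c, ⟨hL.trans hLl, hc.1, hc.2.le.trans (huR.trans hR), ?_, m, ⟨hlm, hmc⟩, hmz, hl',
      Or.inr ⟨hcC, hc.2.trans_le hue⟩⟩, Icc_subset_Icc hLl (hc.2.le.trans huR)⟩
    exact disjoint_left.2 fun x hx hxC => hx.2.ne (huniq x ⟨hx.1, hx.2.trans hc.2⟩ hxC)
  · refine ⟨c, u, ⟨hL.trans (hLl.trans hc.1.le), hc.2, huR.trans hR, ?_, m, ⟨hmc, hmu⟩, hmz,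
      Or.inr ⟨hcC, hle.trans_lt hc.1⟩, hu'⟩, Icc_subset_Icc (hLl.trans hc.1.le) huR⟩
    exact disjoint_left.2 fun x hx hxC => hx.1.ne' (huniq x ⟨hc.1.trans hx.1, hx.2⟩ hxC)

theorem exists_iterate_mem {X : Type*} [TopologicalSpace X] [T2Space X] {g : X → X}
    (hg : Continuous g) {K : ℕ → Set X} (hK : ∀ n, IsCompact (K n)) (hne : ∀ n, (K n).Nonempty)
    (h : ∀ n, K (n + 1) ⊆ g '' K n) : ∃ x, ∀ n, g^[n] x ∈ K n := by
  have key : ∀ n, ∀ z ∈ K n, ∃ x, g^[n] x = z ∧ ∀ j ≤ n, g^[j] x ∈ K j := by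
    intro n
    induction n with
    | zero =>
      intro z hz
      refine ⟨z, rfl, fun j hj => ?_⟩
      rw [Nat.le_zero.1 hj]; exact hz
    | succ n ih =>
      intro z hz
      obtain ⟨w, hw, rfl⟩ := h n hz
      obtain ⟨x, rfl, hx⟩ := ih w hw
      refine ⟨x, Function.iterate_succ_apply' g n x, fun j hj => ?_⟩
      rcases Nat.le_succ_iff.1 hj with hj | rfl
      · exact hx j hj
      · rw [Nat.succ_eq_add_one, Function.iterate_succ_apply']; exact hz
  set T : ℕ → Set X := fun n => ⋂ j ∈ Iic n, g^[j] ⁻¹' K j with hT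
  have hcl : ∀ n, IsClosed (T n) := fun n =>
    isClosed_biInter fun j _ => (hK j).isClosed.preimage (hg.iterate j)
  have hmemT : ∀ n x, x ∈ T n ↔ ∀ j ≤ n, g^[j] x ∈ K j := by simp [hT]
  obtain ⟨x, hx⟩ := IsCompact.nonempty_iInter_of_sequence_nonempty_isCompact_isClosed T
    (fun n x hx => (hmemT _ _).2 fun j hj => (hmemT _ _).1 hx j (hj.trans n.le_succ))
    (fun n => by
      obtain ⟨z, hz⟩ := hne n
      obtain ⟨x, -, hx⟩ := key n z hz
      exact ⟨x, (hmemT _ _).2 hx⟩)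
    ((hK 0).of_isClosed_subset (hcl 0) fun x hx => (hmemT _ _).1 hx 0 le_rfl) hcl
  exact ⟨x, fun n => (hmemT _ _).1 (mem_iInter.1 hx n) n le_rfl⟩

theorem LapMap.exists_trace {g : ℝ → ℝ} {C : Set ℝ} (hg : LapMap g C) (hgC : MapsTo g C C)
    {ε δ y : ℕ → ℝ} (hs : ∀ n, Scale g C (ε n) (δ n)) (hy : ∀ n, y n ∈ Icc 0 1)
    (hle : ∀ n, ε (n + 1) + δ (n + 1) ≤ ε n + δ n)
    (hd : ∀ n, |g (y n) - y (n + 1)| < δ (n + 1)) :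
    ∃ x ∈ Icc (0 : ℝ) 1, ∀ n, |g^[n] x - y n| ≤ 2 * ε n := by
  have hε : ∀ n, 0 < ε n := fun n => (hs n).pos.trans_le (hs n).le
  have h0 : ∃ p : ℝ × ℝ, Cell C (ε 0) (δ 0) (y 0) p.1 p.2 := by
    obtain ⟨a, b, h, -⟩ := exists_cell (hε 0) (hs 0).gap zero_lt_one le_rfl le_rfl (hy 0)
      (z := y 0) (by simpa using (hs 0).pos) le_rfl (Or.inr hg.zero_mem) (Or.inr hg.one_mem)
    exact ⟨(a, b), h⟩
  have hstep : ∀ n (p : ℝ × ℝ), Cell C (ε n) (δ n) (y n) p.1 p.2 → ∃ q : ℝ × ℝ,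
      Cell C (ε (n + 1)) (δ (n + 1)) (y (n + 1)) q.1 q.2 ∧
        Icc q.1 q.2 ⊆ g '' Icc p.1 p.2 := by
    intro n p hp
    obtain ⟨L, R, hLR, hsub, hL, hR, hw, h1, h2⟩ := hp.exists_image hg hgC (hs n) (hy n)
    obtain ⟨a, b, h, hab⟩ := exists_cell (hε (n + 1)) (hs (n + 1)).gap hLR hL hR hw
      (by rw [abs_sub_comm]; exact hd n) (hle n) h1 h2
    exact ⟨(a, b), h, hab.trans hsub⟩
  obtain ⟨p₀, hp₀⟩ := h0
  choose! next hnext hnext' using hstep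
  set A : ℕ → ℝ × ℝ := fun n => Nat.rec p₀ next n with hA
  have hcell : ∀ n, Cell C (ε n) (δ n) (y n) (A n).1 (A n).2 := by
    intro n
    induction n with
    | zero => exact hp₀
    | succ n ih => exact hnext n _ ih
  obtain ⟨x, hx⟩ := exists_iterate_mem hg.leb.cont (K := fun n => Icc (A n).1 (A n).2)
    (fun _ => isCompact_Icc) (fun n => nonempty_Icc.2 (hcell n).lt.le)
    (fun n => hnext' n _ (hcell n))
  refine ⟨x, ⟨(hcell 0).nonneg.trans (hx 0).1, (hx 0).2.trans (hcell 0).le_one⟩, fun n => ?_⟩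
  obtain ⟨m, hm, hmy, ha, hb⟩ := (hcell n).center
  have h1 : |m - y n| ≤ ε n := by
    rcases hmy with h | h
    · rw [h, sub_self, abs_zero]; exact (hε n).le
    · exact h.2.le.trans (hs n).le
  have h2 : m - ε n ≤ (A n).1 := by rcases ha with h | h <;> [exact h.ge; exact h.2.le]
  have h3 : (A n).2 ≤ m + ε n := by rcases hb with h | h <;> [exact h.le; exact h.2.le]
  have h4 := hx n
  rw [abs_le] at h1 ⊢
  constructor <;> linarith [h4.1, h4.2]

theorem exists_slow_sequence {d D : ℕ → ℝ} (hd : Tendsto d atTop (𝓝 0)) (hD : ∀ k, 0 < D k)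
    (h0 : ∀ n, d n < D 0) :
    ∃ k : ℕ → ℕ, Monotone k ∧ Tendsto k atTop atTop ∧ ∀ n, d n < D (k (n + 1)) := by
  classical
  set P : ℕ → ℕ → Prop := fun n k => ∀ j, n ≤ j + 1 → d j < D k with hP
  have hspec : ∀ n, P n (Nat.findGreatest (P n) n) := fun n =>
    Nat.findGreatest_spec (P := P n) (Nat.zero_le n) fun j _ => h0 j
  refine ⟨fun n => Nat.findGreatest (P n) n, fun m n hmn => ?_, ?_, fun n => ?_⟩
  · exact Nat.findGreatest_mono (fun k hk j hj => hk j (hmn.trans hj)) hmn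
  · refine tendsto_atTop.2 fun K => ?_
    obtain ⟨N, hN⟩ := eventually_atTop.1 (hd.eventually_lt_const (hD K))
    filter_upwards [eventually_ge_atTop (max K (N + 1))] with n hn
    refine Nat.le_findGreatest ((le_max_left _ _).trans hn) fun j hj => hN j ?_
    have := (le_max_right K (N + 1)).trans hn
    omega
  · exact hspec (n + 1) n le_rfl

theorem LapMap.exists_sLimit_shadow {g : ℝ → ℝ} {C : Set ℝ} (hg : LapMap g C)
    (hgC : MapsTo g C C) {ε : ℝ} (hε : 0 < ε) :
    ∃ δ > 0, ∀ y : ℕ → ℝ, (∀ n, y n ∈ Icc 0 1) → (∀ n, |g (y n) - y (n + 1)| < δ) →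
      (∃ x ∈ Icc (0 : ℝ) 1, ∀ n, |g^[n] x - y n| < ε) ∧
      (Tendsto (fun n => |g (y n) - y (n + 1)|) atTop (𝓝 0) →
        ∃ x ∈ Icc (0 : ℝ) 1, (∀ n, |g^[n] x - y n| < ε) ∧
          Tendsto (fun n => |g^[n] x - y n|) atTop (𝓝 0)) := by
  obtain ⟨ρ, hρ, hscale⟩ := hg.exists_scale
  set e : ℕ → ℝ := fun k => min (ρ / 2) (ε / 3) * (1 / 2) ^ k with he
  have hm : 0 < min (ρ / 2) (ε / 3) := by positivity
  have hm1 := min_le_left (ρ / 2) (ε / 3)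
  have hm2 := min_le_right (ρ / 2) (ε / 3)
  have he0 : ∀ k, 0 < e k := fun k => by positivity
  have hele : ∀ k, e k ≤ min (ρ / 2) (ε / 3) := fun k =>
    mul_le_of_le_one_right hm.le (pow_le_one₀ (by norm_num) (by norm_num))
  choose D hD using fun k => hscale (e k) (he0 k) (by linarith [hele k])
  have hstep : Antitone fun k => e k + D k := by
    refine antitone_nat_of_succ_le fun k => ?_
    have h1 : e (k + 1) = e k / 2 := by simp only [he, pow_succ]; ring
    linarith [(hD (k + 1)).le, (hD k).pos]
  refine ⟨D 0, (hD 0).pos, fun y hy hd => ⟨?_, fun ht => ?_⟩⟩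
  · obtain ⟨x, hx, h⟩ := hg.exists_trace hgC (fun _ => hD 0) hy (fun _ => le_rfl) hd
    exact ⟨x, hx, fun n => (h n).trans_lt (by linarith [hele 0])⟩
  · obtain ⟨k, hk, hkt, hdk⟩ := exists_slow_sequence ht (fun k => (hD k).pos) hd
    obtain ⟨x, hx, h⟩ := hg.exists_trace hgC (fun n => hD (k n)) hy
      (fun n => hstep (hk n.le_succ)) hdk
    refine ⟨x, hx, fun n => (h n).trans_lt (by linarith [hele (k n)]), ?_⟩
    have h0 : Tendsto e atTop (𝓝 0) := by
      have := (tendsto_pow_atTop_nhds_zero_of_lt_one (r := (1 / 2 : ℝ)) (by norm_num)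
        (by norm_num)).const_mul (min (ρ / 2) (ε / 3))
      rwa [mul_zero] at this
    refine squeeze_zero (fun _ => abs_nonneg _) h ?_
    simpa using (h0.comp hkt).const_mul 2

theorem MeasPres.lebMap_projIcc {f : C(unitInterval, unitInterval)} (hf : MeasPres f) :
    LebMap fun x => (f (projIcc 0 1 zero_le_one x) : ℝ) where
  cont := continuous_subtype_val.comp (f.continuous.comp continuous_projIcc)
  mapsTo _ _ := (f _).2
  map := by
    have hc : Continuous fun x => (f (projIcc (0 : ℝ) 1 zero_le_one x) : ℝ) :=
      continuous_subtype_val.comp (f.continuous.comp continuous_projIcc)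
    ext A hA
    rw [Measure.map_apply hc.measurable hA,
      Measure.restrict_apply (hc.measurable hA), Measure.restrict_apply hA]
    have h := hf (Subtype.val ⁻¹' A) (measurable_subtype_coe hA)
    rw [lebI_apply, lebI_apply, Subtype.image_preimage_coe, inter_comm] at h
    rw [← h]
    congr 1
    ext x
    constructor
    · rintro ⟨hx, hxI⟩
      refine ⟨⟨x, hxI⟩, ?_, rfl⟩
      simpa only [mem_preimage, projIcc_of_mem zero_le_one hxI] using hx
    · rintro ⟨x, hx, rfl⟩
      refine ⟨?_, x.2⟩
      simpa only [mem_preimage, projIcc_val] using hx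

/-- The restriction of a Lebesgue measure preserving map to the unit interval. -/
def LebMap.toContinuousMap {g : ℝ → ℝ} (hg : LebMap g) : C(unitInterval, unitInterval) :=
  ⟨hg.mapsTo.restrict, hg.cont.restrict hg.mapsTo⟩

theorem LebMap.coe_iterate_toContinuousMap {g : ℝ → ℝ} (hg : LebMap g) (n : ℕ)
    (x : unitInterval) : ((hg.toContinuousMap)^[n] x : ℝ) = g^[n] x := by
  induction n generalizing x with
  | zero => rfl
  | succ n ih => rw [Function.iterate_succ_apply, ih, Function.iterate_succ_apply]; rfl

theorem LebMap.measPres_toContinuousMap {g : ℝ → ℝ} (hg : LebMap g) :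
    MeasPres hg.toContinuousMap := by
  intro A hA
  have hA' := (MeasurableEmbedding.subtype_coe measurableSet_Icc).measurableSet_image.2 hA
  have h := hg.volume_preimage hA'
  have hsub : Subtype.val '' A ∩ Icc (0 : ℝ) 1 = Subtype.val '' A :=
    inter_eq_left.2 (by rintro _ ⟨x, -, rfl⟩; exact x.2)
  rw [hsub] at h
  rw [lebI_apply, lebI_apply, ← h]
  congr 1
  ext x
  constructor
  · rintro ⟨x, hx, rfl⟩
    exact ⟨⟨_, hx, rfl⟩, x.2⟩
  · rintro ⟨⟨y, hy, hyx⟩, hx⟩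
    refine ⟨⟨x, hx⟩, ?_, rfl⟩
    have : hg.toContinuousMap ⟨x, hx⟩ = y := Subtype.ext hyx.symm
    rwa [mem_preimage, this]

theorem LapMap.sLimitShadowing {g : ℝ → ℝ} {C : Set ℝ} (hg : LapMap g C)
    (hgC : MapsTo g C C) : SLimitShadowing hg.leb.toContinuousMap := by
  intro ε hε
  obtain ⟨δ, hδ, h⟩ := hg.exists_sLimit_shadow hgC hε
  have hdist : ∀ (x : unitInterval) (y : ℕ → unitInterval) n,
      dist ((hg.leb.toContinuousMap)^[n] x) (y n) = |g^[n] x - y n| := fun x y n => by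
    rw [Subtype.dist_eq, Real.dist_eq, hg.leb.coe_iterate_toContinuousMap]
  refine ⟨δ, hδ, fun y hy => ?_, fun y hy ht => ?_⟩
  · obtain ⟨x, hx, hxy⟩ := (h (fun n => y n) (fun n => (y n).2) hy).1
    exact ⟨⟨x, hx⟩, fun n => (hdist ⟨x, hx⟩ y n).trans_lt (hxy n)⟩
  · obtain ⟨x, hx, hxy, hlim⟩ := (h (fun n => y n) (fun n => (y n).2) hy).2 ht
    refine ⟨⟨x, hx⟩, fun n => (hdist ⟨x, hx⟩ y n).trans_lt (hxy n), ?_⟩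
    simpa only [hdist] using hlim

theorem sLimitShadowing_dense :
    Dense {f : ↥CLam | SLimitShadowing (⇑f.1)} := by
  refine Metric.dense_iff.2 fun f ε hε => ?_
  obtain ⟨g₀, C₀, hg₀, hn₀⟩ := f.2.lebMap_projIcc.exists_lapMap (half_pos hε)
  obtain ⟨g, C, hg, hn, hgC⟩ := hg₀.exists_markov hn₀
  refine ⟨⟨hg.leb.toContinuousMap, hg.leb.measPres_toContinuousMap⟩, ?_,
    hg.sLimitShadowing hgC⟩
  rw [mem_ball, Subtype.dist_eq]
  refine ((ContinuousMap.dist_le (half_pos hε).le).2 fun x => ?_).trans_lt (half_lt_self hε)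
  have h := hn x.2.1 x.2.2 (by simp) x (by simp) x (by simp)
  simp only [projIcc_val] at h
  exact h
end
end
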